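/- Assume V⁺ ∈ L¹ and assumption (i): ℙ{V(ω,z) ≥ 0} = 1 for all z ∈ R₀ and there exists c ∈ ℝ with ℙ{V(ω,z) ≥ c} = 1 for all z ∈ R∖R₀. Fix a face A ≠ {0} of C₊ (possibly C₊ itself), let R' = R ∩ A, and assume V⁺(·,z) ∈ L_{z,R'} for each z ∈ R'∖{0} and V⁺(·,0) ∈ L_{ẑ,R'} for some ẑ ∈ R'∖{0}. Then there exists a stochastic process {α(ξ) : ξ ∈ relint A} such that the following hold ℙ-almost surely: (a) there is a positive random variable C with E[C] < ∞ such that |α(ξ)| ≤ C|ξ|₁ for all ξ ∈ relint A; (b) α(sξ) = sα(ξ) and α(ξ) + α(ζ) ≥ α(ξ+ζ) for all s ∈ ℝ₊ and ξ, ζ ∈ relint A (hence α is convex and continuous on relint A); (c) for every δ > 0, limsup over x ∈ G₊ ∩ A_δ with |x|₁ → ∞ of |a(0,x) − α(x)|/|x|₁ equals 0. Moreover, if ℙ is ergodic under {T_z : z ∈ R ∩ A}, then α (and the C in (a)) is deterministic on relint A. -/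

import Mathlib

open MeasureTheory Filter Set
open scoped ENNReal NNReal Classical Topology

noncomputable section

namespace RWRP

abbrev Zd (d : ℕ) := Fin d → ℤ

variable {d : ℕ} {Ω : Type*} {Γ : Type*}

/-- Embedding of `ℤ^d` into `ℝ^d`. -/
def toR (x : Zd d) : Fin d → ℝ := fun i => (x i : ℝ)

/-- The `ℓ¹` norm on `ℝ^d`. -/
def n1 (ξ : Fin d → ℝ) : ℝ := ∑ i, |ξ i|

/-- The `ℓ¹` norm of a lattice point. -/
def n1Z (x : Zd d) : ℝ := n1 (toR x)

/-- `G₊`: the additive semigroup (ℤ₊-combinations) generated by the step set. -/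
def Gp (R : Finset (Zd d)) : Set (Zd d) := {x | ∃ b : Zd d → ℕ, x = ∑ z ∈ R, b z • z}

/-- `G(R')`: the additive group (ℤ-combinations) generated by `R'`. -/
def GZ (R : Finset (Zd d)) : Set (Zd d) := {x | ∃ b : Zd d → ℤ, x = ∑ z ∈ R, b z • z}

/-- ℤ₊-combinations of elements of a set of lattice points. -/
def GpS (S : Set (Zd d)) : Set (Zd d) :=
  {x | ∃ (m : ℕ) (c : Fin m → Zd d), (∀ i, c i ∈ S) ∧ x = ∑ i, c i}

/-- `C₊`: the real cone generated by the step set. -/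
def Cp (R : Finset (Zd d)) : Set (Fin d → ℝ) :=
  {ξ | ∃ b : Zd d → ℝ, (∀ z, 0 ≤ b z) ∧ ξ = ∑ z ∈ R, b z • toR z}

/-- `C'₊`: the rational cone generated by the step set. -/
def CpQ (R : Finset (Zd d)) : Set (Fin d → ℝ) :=
  {ξ | ∃ b : Zd d → ℚ, (∀ z, 0 ≤ b z) ∧ ξ = ∑ z ∈ R, (b z : ℝ) • toR z}

/-- `A` is a face of the convex set `K`. -/
def IsFace (K A : Set (Fin d → ℝ)) : Prop :=
  A ⊆ K ∧ Convex ℝ A ∧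
    ∀ ⦃ξ ζ η : Fin d → ℝ⦄ ⦃t : ℝ⦄, ξ ∈ A → ζ ∈ K → η ∈ K → t ∈ Set.Ioo (0:ℝ) 1 →
      ξ = t • ζ + (1 - t) • η → ζ ∈ A ∧ η ∈ A

/-- `U`: the convex hull of the step set. -/
def hullU (R : Finset (Zd d)) : Set (Fin d → ℝ) := convexHull ℝ (toR '' (R : Set (Zd d)))

/-- `U₀` is the face of `U` containing `0` in its relative interior (the empty set if `0 ∉ U`). -/
def IsZeroFace (R : Finset (Zd d)) (U₀ : Set (Fin d → ℝ)) : Prop :=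
  ((0 : Fin d → ℝ) ∈ hullU R ∧ IsFace (hullU R) U₀ ∧
    (0 : Fin d → ℝ) ∈ intrinsicInterior ℝ U₀) ∨
  ((0 : Fin d → ℝ) ∉ hullU R ∧ U₀ = ∅)

/-- `R₀ = R ∩ U₀`. -/
def R0 (R : Finset (Zd d)) (U₀ : Set (Fin d → ℝ)) : Set (Zd d) := {z | z ∈ R ∧ toR z ∈ U₀}

/-- `A_δ`: the directions in the face `A` at ℓ¹ distance `≥ δ` (after normalization) from the
relative boundary of `A`. -/
def faceDelta (A : Set (Fin d → ℝ)) (δ : ℝ) : Set (Fin d → ℝ) :=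
  {ξ | ξ ∈ A ∧ ξ ≠ 0 ∧
    ENNReal.ofReal δ ≤ ⨅ (η : Fin d → ℝ) (_ : η ∈ A \ intrinsicInterior ℝ A),
      ENNReal.ofReal (n1 ((n1 ξ)⁻¹ • ξ - η))}

/-- `U'_δ = {ξ ∈ U' : dist(ξ, U' ∖ relint Uall) ≥ δ}`. -/
def faceDeltaU (Uall U' : Set (Fin d → ℝ)) (δ : ℝ) : Set (Fin d → ℝ) :=
  {ξ | ξ ∈ U' ∧
    ENNReal.ofReal δ ≤ ⨅ (η : Fin d → ℝ) (_ : η ∈ U' \ intrinsicInterior ℝ Uall),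
      ENNReal.ofReal (n1 (ξ - η))}

/-- `D_n`: points reachable in exactly `n` admissible steps (counted with multiplicities). -/
def Dn (R : Finset (Zd d)) (n : ℕ) : Set (Zd d) :=
  {x | ∃ b : Zd d → ℕ, (∑ z ∈ R, b z) = n ∧ x = ∑ z ∈ R, b z • z}

/-- Position after `k` steps of the path with increments `f`, started at `x`. -/
def pos (x : Zd d) (f : ℕ → Zd d) (k : ℕ) : Zd d := x + ∑ i ∈ Finset.range k, f i

/-- Convert a finite tuple of admissible steps to an increment sequence. -/
def stepF {R : Finset (Zd d)} (n : ℕ) (s : Fin n → {z : Zd d // z ∈ R}) : ℕ → Zd d :=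
  fun i => if h : i < n then (s ⟨i, h⟩ : Zd d) else 0

/-- The path started at `x` with increments `f` hits `y` for the first time (after time `0`)
at time `n`. -/
def firstHit (x y : Zd d) (n : ℕ) (f : ℕ → Zd d) : Prop :=
  pos x f n = y ∧ ∀ k ∈ Finset.Ioo 0 n, pos x f k ≠ y

/-- Probability weight of a tuple of steps under the random walk kernel `p`. -/
def pathW (p : Zd d → ℝ) {R : Finset (Zd d)} {n : ℕ} (s : Fin n → {z : Zd d // z ∈ R}) : ℝ≥0∞ :=
  ∏ i, ENNReal.ofReal (p (s i : Zd d))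

/-- Total potential collected along the first `n` steps of a path. -/
def pathV (T : Zd d → Ω → Ω) (V : Ω → Zd d → ℝ) (ω : Ω) (x : Zd d) (n : ℕ)
    (f : ℕ → Zd d) : ℝ :=
  ∑ i ∈ Finset.range n, V (T (pos x f i) ω) (f i)

/-- `E_x[exp(-∑_{k<τ_y} V(T_{X_k}ω, Z_{k+1})) 1{τ_y < ∞}]`, as a sum over killed paths. -/
def walkK (T : Zd d → Ω → Ω) (V : Ω → Zd d → ℝ) (p : Zd d → ℝ) (R : Finset (Zd d))
    (ω : Ω) (x y : Zd d) : ℝ≥0∞ :=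
  ∑' n : ℕ, ∑ s : Fin (n+1) → {z : Zd d // z ∈ R},
    if firstHit x y (n+1) (stepF (n+1) s) then
      pathW p s * ENNReal.ofReal (Real.exp (-(pathV T V ω x (n+1) (stepF (n+1) s))))
    else 0

/-- The point-to-point quantity `a(ω,x,y)` (real-valued version, with junk values where the
underlying expectation is `0` or `∞`). -/
def aFun (T : Zd d → Ω → Ω) (V : Ω → Zd d → ℝ) (p : Zd d → ℝ) (R : Finset (Zd d))
    (ω : Ω) (x y : Zd d) : ℝ :=
  if y = x then 0 else - Real.log ((walkK T V p R ω x y).toReal)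

/-- The point-to-point quantity `a(ω,x,y)` with values in `[-∞,∞]`. -/
def aE (T : Zd d → Ω → Ω) (V : Ω → Zd d → ℝ) (p : Zd d → ℝ) (R : Finset (Zd d))
    (ω : Ω) (x y : Zd d) : EReal :=
  if y = x then (0 : EReal) else - (ENNReal.log (walkK T V p R ω x y))

/-- The zero-temperature quantity `a_∞(ω,x,y)`: the infimum of the total potential over
admissible paths from `x` to `y` that hit `y` for the first time at their last step. -/
def aInf (T : Zd d → Ω → Ω) (V : Ω → Zd d → ℝ) (R : Finset (Zd d))
    (ω : Ω) (x y : Zd d) : ℝ :=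
  if y = x then 0 else
    sInf {v : ℝ | ∃ n : ℕ, ∃ s : Fin (n+1) → {z : Zd d // z ∈ R},
      firstHit x y (n+1) (stepF (n+1) s) ∧ v = pathV T V ω x (n+1) (stepF (n+1) s)}

/-- The Green's function `g(ω,x,y)`, with values in `[0,∞]`. -/
def greenK (T : Zd d → Ω → Ω) (V : Ω → Zd d → ℝ) (p : Zd d → ℝ) (R : Finset (Zd d))
    (ω : Ω) (x y : Zd d) : ℝ≥0∞ :=
  (if y = x then 1 else 0) +
  ∑' n : ℕ, ∑ s : Fin (n+1) → {z : Zd d // z ∈ R},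
    if pos x (stepF (n+1) s) (n+1) = y then
      pathW p s * ENNReal.ofReal (Real.exp (-(pathV T V ω x (n+1) (stepF (n+1) s))))
    else 0

/-- `E_x[exp(-∑_{k<n} V) 1{X_n = y}]`: the restricted-length partition function. -/
def resK (T : Zd d → Ω → Ω) (V : Ω → Zd d → ℝ) (p : Zd d → ℝ) (R : Finset (Zd d))
    (ω : Ω) (n : ℕ) (x y : Zd d) : ℝ≥0∞ :=
  ∑ s : Fin n → {z : Zd d // z ∈ R},
    if pos x (stepF n s) n = y then
      pathW p s * ENNReal.ofReal (Real.exp (-(pathV T V ω x n (stepF n s))))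
    else 0

/-- `G_{x,(n),y} = log E_x[exp(-∑_{k<n} V) 1{X_n = y}]`. -/
def GRes (T : Zd d → Ω → Ω) (V : Ω → Zd d → ℝ) (p : Zd d → ℝ) (R : Finset (Zd d))
    (ω : Ω) (n : ℕ) (x y : Zd d) : ℝ :=
  Real.log ((resK T V p R ω n x y).toReal)

/-- The return probability `P₀(τ₀ < ∞)` of the reference walk. -/
def retP (p : Zd d → ℝ) (R : Finset (Zd d)) : ℝ≥0∞ :=
  ∑' n : ℕ, ∑ s : Fin (n+1) → {z : Zd d // z ∈ R},
    if firstHit (0 : Zd d) 0 (n+1) (stepF (n+1) s) then pathW p s else 0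

/-- `R_ε`: the ℓ¹-distance from the origin to the nearest point `x` of `G₊(S)` with
`V(T_x ω, z) ≥ ε` for some `z ∈ S`, as an element of `[0,∞]`. -/
def Reps (T : Zd d → Ω → Ω) (V : Ω → Zd d → ℝ) (S : Set (Zd d)) (ε : ℝ) (ω : Ω) : ℝ≥0∞ :=
  ⨅ (x : Zd d) (_ : x ∈ GpS S ∧ ∃ z ∈ S, ε ≤ V (T x ω) z), ENNReal.ofReal (n1Z x)

/-- The shift maps on a product space. -/
def shiftT (z : Zd d) (ω : Zd d → Γ) : Zd d → Γ := fun y => ω (z + y)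

/-- A function is locally Lipschitz (w.r.t. the ℓ¹ norm) on a set. -/
def LocLipOn (f : (Fin d → ℝ) → ℝ) (S : Set (Fin d → ℝ)) : Prop :=
  ∀ ξ ∈ S, ∃ K ε : ℝ, 0 < ε ∧ ∀ x ∈ S, ∀ y ∈ S,
    n1 (x - ξ) < ε → n1 (y - ξ) < ε → |f x - f y| ≤ K * n1 (x - y)

section measurable

variable [MeasurableSpace Ω]

/-- The σ-algebra of measurable sets invariant under the shifts `{T_z : z ∈ S}`. -/
def invSigma (T : Zd d → Ω → Ω) (S : Set (Zd d)) : MeasurableSpace Ω where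
  MeasurableSet' A := MeasurableSet A ∧ ∀ z ∈ S, T z ⁻¹' A = A
  measurableSet_empty := ⟨MeasurableSet.empty, fun _ _ => by simp⟩
  measurableSet_compl A hA := ⟨hA.1.compl, fun z hz => by
    rw [Set.preimage_compl, hA.2 z hz]⟩
  measurableSet_iUnion f hf := ⟨MeasurableSet.iUnion fun i => (hf i).1, fun z hz => by
    rw [Set.preimage_iUnion]
    exact Set.iUnion_congr fun i => (hf i).2 z hz⟩

/-- `ℙ` is ergodic under the shifts `{T_z : z ∈ S}`. -/
def ErgodicUnder (ℙ : Measure Ω) (T : Zd d → Ω → Ω) (S : Set (Zd d)) : Prop :=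
  ∀ A : Set Ω, MeasurableSet A → (∀ z ∈ S, T z ⁻¹' A = A) → ℙ A = 0 ∨ ℙ A = 1

/-- The class `𝓛_{z,R'}`. -/
def classL (ℙ : Measure Ω) (T : Zd d → Ω → Ω) (g : Ω → ℝ) (z : Zd d)
    (R' : Finset (Zd d)) : Prop :=
  ∀ᵐ ω ∂ℙ,
    (⨅ ε : {e : ℝ // 0 < e},
      Filter.limsup (fun n : ℕ =>
        ⨆ (x : Zd d) (_ : x ∈ Gp R' ∧ n1Z x ≤ n),
          (n : ℝ≥0∞)⁻¹ *
            ∑ k ∈ Finset.range (⌊(ε : ℝ) * n⌋₊ + 1), ENNReal.ofReal (g (T (x + k • z) ω)))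
        Filter.atTop) = 0

/-- Extended conditional expectation, with values in `[-∞,∞]`: the decreasing limit of the
conditional expectations of the truncations `max f (-n)`.  It agrees a.s. with the usual
conditional expectation in `[-∞,∞)` whenever `f⁺` is integrable. -/
def condExpE (ℙ : Measure Ω) (m : MeasurableSpace Ω) (f : Ω → ℝ) : Ω → EReal :=
  fun ω => ⨅ n : ℕ, ((MeasureTheory.condExp m ℙ (fun ω' => max (f ω') (-(n : ℝ))) ω : ℝ) : EReal)

/-- `EReal → ℝ≥0∞`, sending `[-∞,0]` to `0` and `⊤` to `⊤`. -/
def erealToENN (x : EReal) : ℝ≥0∞ := if x = ⊤ then ⊤ else ENNReal.ofReal x.toReal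

/-- `ᾱ(x) = inf_{n ≥ 1} (1/n) E[a(0,nx) | I_x]`, with `ᾱ(0) = 0`. -/
def alphaBar (ℙ : Measure Ω) (T : Zd d → Ω → Ω) (V : Ω → Zd d → ℝ) (p : Zd d → ℝ)
    (R : Finset (Zd d)) (x : Zd d) : Ω → EReal :=
  fun ω =>
    if x = 0 then 0 else
    ⨅ n : {m : ℕ // 0 < m},
      (((n : ℕ) : ℝ)⁻¹ : EReal) *
        condExpE ℙ (invSigma T {x}) (fun ω' => aFun T V p R ω' 0 ((n : ℕ) • x)) ω

/-- `x̂_t(ξ) = ∑_z ⌊tγ_z⌋ z`. -/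
def xhat (R : Finset (Zd d)) (γ : Zd d → ℝ) (t : ℝ) : Zd d := ∑ z ∈ R, ⌊t * γ z⌋ • z

/-- `tilde-α(ξ) = inf_{t ∈ ℚ, t>0} (1/t) E[a(0, x̂_t(ξ)) | 𝔖]`, where `𝔖` is the σ-algebra of
sets invariant under the shifts from `S`. -/
def tAlpha (ℙ : Measure Ω) (T : Zd d → Ω → Ω) (V : Ω → Zd d → ℝ) (p : Zd d → ℝ)
    (R : Finset (Zd d)) (S : Set (Zd d)) (γ : Zd d → ℝ) : Ω → EReal :=
  fun ω => ⨅ t : {q : ℚ // 0 < q},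
    ((((t : ℚ) : ℝ))⁻¹ : EReal) *
      condExpE ℙ (invSigma T S) (fun ω' => aFun T V p R ω' 0 (xhat R γ ((t : ℚ) : ℝ))) ω

/-- The σ-algebra `𝔖_ξ` of sets invariant under the shifts from `R_ξ = R ∩ C_ξ`. -/
def Sface (T : Zd d → Ω → Ω) (R : Finset (Zd d))
    (Cface : (Fin d → ℝ) → Set (Fin d → ℝ)) (ξ : Fin d → ℝ) : MeasurableSpace Ω :=
  invSigma T {z | z ∈ R ∧ toR z ∈ Cface ξ}

/-- `tilde-α` as a function of the direction `ξ`, given a choice `Cface` of the face `C_ξ`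
and a choice `γfun` of cone coefficients. -/
def tAlphaF (ℙ : Measure Ω) (T : Zd d → Ω → Ω) (V : Ω → Zd d → ℝ) (p : Zd d → ℝ)
    (R : Finset (Zd d)) (Cface : (Fin d → ℝ) → Set (Fin d → ℝ))
    (γfun : (Fin d → ℝ) → Zd d → ℝ) (ξ : Fin d → ℝ) : Ω → EReal :=
  fun ω => if ξ = 0 then 0 else tAlpha ℙ T V p R {z | z ∈ R ∧ toR z ∈ Cface ξ} (γfun ξ) ω

/-- `B` is an `L¹` covariant cocycle on the group generated by the allowed steps. -/
def IsCocycle (ℙ : Measure Ω) (T : Zd d → Ω → Ω) (S : Set (Zd d))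
    (B : Ω → Zd d → Zd d → ℝ) : Prop :=
  (∀ x y : Zd d, Measurable fun ω => B ω x y) ∧
  (∀ x ∈ S, ∀ y ∈ S, Integrable (fun ω => B ω x y) ℙ) ∧
  (∀ᵐ ω ∂ℙ, ∀ x ∈ S, ∀ y ∈ S, ∀ z ∈ S, B ω x y + B ω y z = B ω x z) ∧
  (∀ᵐ ω ∂ℙ, ∀ x ∈ S, ∀ y ∈ S, ∀ z ∈ S, B ω (x + z) (y + z) = B (T z ω) x y)

/-- The class `K⁺_A(V)` of centered cocycles. -/
def InKplus (ℙ : Measure Ω) (T : Zd d → Ω → Ω) (V : Ω → Zd d → ℝ) (p : Zd d → ℝ)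
    (R' : Finset (Zd d)) (B : Ω → Zd d → Zd d → ℝ) : Prop :=
  IsCocycle ℙ T (GZ R') B ∧
  ∀ᵐ ω ∂ℙ, ∑ z ∈ R', p z * Real.exp (-(V ω z) - B ω 0 z) ≤ 1

/-- The standing setting: shifts, stationary `ℙ`, finite step set, measurable potential,
random walk kernel. -/
def Setting (ℙ : Measure Ω) (T : Zd d → Ω → Ω) (R : Finset (Zd d))
    (V : Ω → Zd d → ℝ) (p : Zd d → ℝ) : Prop :=
  (∀ z : Zd d, Measurable (T z)) ∧ T 0 = id ∧ (∀ x y : Zd d, T (x + y) = T x ∘ T y) ∧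
  (∀ z : Zd d, MeasurePreserving (T z) ℙ ℙ) ∧ 2 ≤ R.card ∧
  (∀ z : Zd d, Measurable fun ω => V ω z) ∧
  (∀ z ∈ R, 0 < p z ∧ p z < 1) ∧ ∑ z ∈ R, p z = 1

/-- `V⁺ ∈ L¹`. -/
def VplusL1 (ℙ : Measure Ω) (V : Ω → Zd d → ℝ) (R : Finset (Zd d)) : Prop :=
  ∀ z ∈ R, Integrable (fun ω => max (V ω z) 0) ℙ

/-- Assumption (i): `V ≥ 0` a.s. on `R₀` and `V ≥ c` a.s. on `R ∖ R₀`. -/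
def AssumptionI (ℙ : Measure Ω) (V : Ω → Zd d → ℝ) (R : Finset (Zd d))
    (U₀ : Set (Fin d → ℝ)) : Prop :=
  (∀ z ∈ R0 R U₀, ∀ᵐ ω ∂ℙ, 0 ≤ V ω z) ∧
  ∃ c : ℝ, ∀ z ∈ R, toR z ∉ U₀ → ∀ᵐ ω ∂ℙ, c ≤ V ω z

end measurable

end RWRP


namespace RWRP

set_option linter.unusedSectionVars false
set_option linter.unusedVariables false

section kingman

variable {Ω : Type*} [MeasurableSpace Ω] {μ : Measure Ω} [IsProbabilityMeasure μ] {τ : Ω → Ω}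

def maxSum (τ : Ω → Ω) (f : Ω → ℝ) : ℕ → Ω → ℝ
  | 0, _ => 0
  | n+1, ω => max 0 (f ω + maxSum τ f n (τ ω))

lemma maxSum_nonneg (f : Ω → ℝ) (n : ℕ) (ω : Ω) : 0 ≤ maxSum τ f n ω := by
  cases n with
  | zero => simp [maxSum]
  | succ n => simp [maxSum]

lemma maxSum_mono (f : Ω → ℝ) (n : ℕ) (ω : Ω) : maxSum τ f n ω ≤ maxSum τ f (n+1) ω := by
  induction n generalizing ω with
  | zero => simp [maxSum]
  | succ n ih =>
    show max 0 (f ω + maxSum τ f n (τ ω)) ≤ max 0 (f ω + maxSum τ f (n+1) (τ ω))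
    exact max_le_max le_rfl (by linarith [ih (τ ω)])

lemma sum_le_maxSum (f : Ω → ℝ) (n : ℕ) (ω : Ω) :
    ∑ k ∈ Finset.range n, f (τ^[k] ω) ≤ maxSum τ f n ω := by
  induction n generalizing ω with
  | zero => simp [maxSum]
  | succ n ih =>
    rw [Finset.sum_range_succ']
    have := ih (τ ω)
    simp only [Function.iterate_succ, Function.comp, Function.iterate_zero, id]
    exact le_trans (by linarith) (le_max_right _ _)

lemma maxSum_meas (hτ : Measurable τ) {f : Ω → ℝ} (hf : Measurable f) (n : ℕ) :
    Measurable (maxSum τ f n) := by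
  induction n with
  | zero => exact measurable_const
  | succ n ih => exact measurable_const.max (hf.add (ih.comp hτ))

lemma maxSum_int (hτ : MeasurePreserving τ μ μ) {f : Ω → ℝ} (hf : Integrable f μ) (n : ℕ) :
    Integrable (maxSum τ f n) μ := by
  induction n with
  | zero => exact integrable_zero _ _ _
  | succ n ih =>
    exact (integrable_zero _ _ _).sup (hf.add (hτ.integrable_comp_of_integrable ih))

lemma maximal_aux (hτ : MeasurePreserving τ μ μ) {f : Ω → ℝ} (hfm : Measurable f)
    (hf : Integrable f μ) (n : ℕ) :
    0 ≤ ∫ ω in {ω | 0 < maxSum τ f (n+1) ω}, f ω ∂μ := by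
  set M := maxSum τ f (n+1) with hM
  have hMm : Measurable M := maxSum_meas hτ.measurable hfm _
  have hMi : Integrable M μ := maxSum_int hτ hf _
  have hMτ : Integrable (fun ω => M (τ ω)) μ := hτ.integrable_comp_of_integrable hMi
  have hs : MeasurableSet {ω | 0 < M ω} := measurableSet_lt measurable_const hMm
  have h1 : ∫ ω in {ω | 0 < M ω}, (M ω - M (τ ω)) ∂μ ≤ ∫ ω in {ω | 0 < M ω}, f ω ∂μ := by
    apply setIntegral_mono_on (hMi.sub hMτ).integrableOn hf.integrableOn hs
    intro ω hω
    have h2 : M ω = max 0 (f ω + maxSum τ f n (τ ω)) := rfl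
    have h3 := maxSum_mono (τ := τ) f n (τ ω)
    have h4 : (0:ℝ) < M ω := hω
    show M ω - M (τ ω) ≤ f ω
    rw [h2] at h4 ⊢
    have : max 0 (f ω + maxSum τ f n (τ ω)) = f ω + maxSum τ f n (τ ω) := by
      rcases lt_max_iff.1 h4 with h | h
      · exact absurd h (lt_irrefl _)
      · exact max_eq_right h.le
    rw [this]
    linarith
  have h2 : ∫ ω, (M ω - M (τ ω)) ∂μ ≤ ∫ ω in {ω | 0 < M ω}, (M ω - M (τ ω)) ∂μ := by
    rw [← integral_indicator hs]
    apply integral_mono (hMi.sub hMτ) ((hMi.sub hMτ).indicator hs)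
    intro ω
    by_cases h : 0 < M ω
    · simp [Set.indicator, h]
    · have h0 : M ω = 0 := le_antisymm (not_lt.1 h) (maxSum_nonneg _ _ _)
      have := maxSum_nonneg (τ := τ) f (n+1) (τ ω)
      simp [Set.indicator, h0]
      exact this
  have h3 : ∫ ω, (M ω - M (τ ω)) ∂μ = 0 := by
    rw [integral_sub hMi hMτ]
    have : ∫ ω, M (τ ω) ∂μ = ∫ ω, M ω ∂μ := by
      have := integral_map (μ := μ) hτ.measurable.aemeasurable (f := M)
        (by rw [hτ.map_eq]; exact hMm.aestronglyMeasurable)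
      rw [hτ.map_eq] at this
      exact this.symm
    rw [this, sub_self]
  linarith

lemma maximal_ineq (hτ : MeasurePreserving τ μ μ) {g : Ω → ℝ} (hgm : Measurable g)
    (hg : Integrable g μ) (hg0 : ∀ ω, 0 ≤ g ω) {c : ℝ} (hc : 0 < c) :
    μ {ω | ∃ n : ℕ, c * n < ∑ k ∈ Finset.range n, g (τ^[k] ω)} ≤ ENNReal.ofReal ((∫ ω, g ω ∂μ) / c) := by
  set f : Ω → ℝ := fun ω => g ω - c
  have hfm : Measurable f := hgm.sub_const c
  have hf : Integrable f μ := hg.sub (integrable_const c)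
  have hsub : {ω | ∃ n : ℕ, c * n < ∑ k ∈ Finset.range n, g (τ^[k] ω)} ⊆
      ⋃ n, {ω | 0 < maxSum τ f (n+1) ω} := by
    rintro ω ⟨n, hn⟩
    refine mem_iUnion.2 ⟨n, ?_⟩
    have h1 := sum_le_maxSum (τ := τ) f n ω
    have h2 := maxSum_mono (τ := τ) f n ω
    have h3 : ∑ k ∈ Finset.range n, f (τ^[k] ω) = ∑ k ∈ Finset.range n, g (τ^[k] ω) - c * n := by
      simp [f, Finset.sum_sub_distrib, mul_comm]
    show 0 < maxSum τ f (n+1) ω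
    linarith
  refine (measure_mono hsub).trans ?_
  rw [Monotone.measure_iUnion]
  · refine iSup_le fun n => ?_
    set s := {ω | 0 < maxSum τ f (n+1) ω}
    have hs : MeasurableSet s := measurableSet_lt measurable_const (maxSum_meas hτ.measurable hfm _)
    have h := maximal_aux hτ hfm hf n
    have h1 : ∫ ω in s, f ω ∂μ = ∫ ω in s, g ω ∂μ - c * μ.real s := by
      rw [integral_sub hg.integrableOn (integrable_const c).integrableOn]
      simp [mul_comm]
    have h2 : ∫ ω in s, g ω ∂μ ≤ ∫ ω, g ω ∂μ :=
      setIntegral_le_integral hg (Filter.Eventually.of_forall hg0)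
    have h3 : μ.real s ≤ (∫ ω, g ω ∂μ) / c := by
      rw [le_div_iff₀ hc]
      change 0 ≤ ∫ ω in s, f ω ∂μ at h
      linarith
    rw [← ENNReal.ofReal_toReal (measure_ne_top μ s)]
    exact ENNReal.ofReal_le_ofReal h3
  · exact monotone_nat_of_le_succ fun n ω hω => lt_of_lt_of_le hω (maxSum_mono _ _ _)

/-- invariance from an inequality -/
lemma ae_eq_comp_of_le (hτ : MeasurePreserving τ μ μ) {f : Ω → ℝ≥0∞} (hf : Measurable f)
    (hfin : ∫⁻ ω, f ω ∂μ ≠ ∞) (h : ∀ᵐ ω ∂μ, f ω ≤ f (τ ω)) : ∀ᵐ ω ∂μ, f (τ ω) = f ω := by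
  have h2 : ∫⁻ ω, f (τ ω) ∂μ = ∫⁻ ω, f ω ∂μ := hτ.lintegral_comp hf
  have := ae_eq_of_ae_le_of_lintegral_le (μ := μ) h hfin (hf.comp hτ.measurable).aemeasurable h2.le
  filter_upwards [this] with ω hω using hω.symm

/-- deterministic greedy bound -/
lemma greedy (f : ℕ → Ω → ℝ) (h0 : ∀ ω, f 0 ω = 0) (hnn : ∀ n ω, 0 ≤ f n ω)
    (hsub : ∀ n m ω, f (n + m) ω ≤ f n ω + f m (τ^[n] ω)) (G : Ω → ℝ) (hG : ∀ ω, 0 ≤ G ω)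
    (N : ℕ) (K c : ℝ) (hK : 0 ≤ K) (hc : 0 ≤ c) (hGK : ∀ ω, f 1 ω ≤ G ω + K) (ω : Ω)
    (hgood : ∀ k, f 1 (τ^[k] ω) ≤ G (τ^[k] ω) ∨
      ∃ l, 1 ≤ l ∧ l ≤ N ∧ f l (τ^[k] ω) ≤ l * c) (n : ℕ) :
    ∀ k, f n (τ^[k] ω) ≤ n * c + ∑ j ∈ Finset.range n, G (τ^[k + j] ω) + N * K := by
  have hit : ∀ a b, τ^[a] (τ^[b] ω) = τ^[b + a] ω := by
    intro a b; rw [← Function.iterate_add_apply, add_comm]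
  induction n using Nat.strong_induction_on with
  | _ n ih =>
  intro k
  have hNK : 0 ≤ (N:ℝ) * K := by positivity
  rcases Nat.eq_zero_or_pos n with rfl | hn
  · simp [h0, hNK]
  rcases hgood k with hb | ⟨l, hl1, hlN, hl⟩
  · obtain ⟨m, rfl⟩ := Nat.exists_eq_succ_of_ne_zero hn.ne'
    have h1 := hsub 1 m (τ^[k] ω)
    rw [hit] at h1
    have h2 := ih m (Nat.lt_succ_self m) (k+1)
    rw [Finset.sum_range_succ']
    have h3 : ∑ j ∈ Finset.range m, G (τ^[k + (j+1)] ω) = ∑ j ∈ Finset.range m, G (τ^[k + 1 + j] ω) := by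
      refine Finset.sum_congr rfl fun j _ => ?_
      rw [show k + (j+1) = k + 1 + j by ring]
    rw [h3, Nat.succ_eq_one_add]
    simp only [add_zero]
    push_cast
    linarith
  · by_cases hln : l ≤ n
    · obtain ⟨m, rfl⟩ := Nat.exists_eq_add_of_le hln
      have h1 := hsub l m (τ^[k] ω)
      rw [hit] at h1
      have h2 := ih m (by omega) (k+l)
      rw [Finset.sum_range_add]
      have h4 : 0 ≤ ∑ j ∈ Finset.range l, G (τ^[k + j] ω) := Finset.sum_nonneg fun j _ => hG _
      have h3 : ∑ j ∈ Finset.range m, G (τ^[k + (l+j)] ω) = ∑ j ∈ Finset.range m, G (τ^[k + l + j] ω) := by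
        refine Finset.sum_congr rfl fun j _ => ?_
        rw [show k + (l+j) = k + l + j by ring]
      rw [h3]
      push_cast
      linarith
    · have h1 : ∀ m, ∀ k, f m (τ^[k] ω) ≤ ∑ j ∈ Finset.range m, G (τ^[k + j] ω) + m * K := by
        intro m
        induction m with
        | zero => intro k; simp [h0]
        | succ m ihm =>
          intro k
          have h1 := hsub m 1 (τ^[k] ω)
          rw [hit] at h1
          rw [Finset.sum_range_succ]
          have := hGK (τ^[k+m] ω)
          have := ihm k
          push_cast
          linarith
      have h2 := h1 n k
      have h3 : (n:ℝ) * K ≤ N * K := by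
        apply mul_le_mul_of_nonneg_right _ hK
        exact_mod_cast (by omega : n ≤ N)
      have : 0 ≤ (n:ℝ) * c := by positivity
      linarith

end kingman
end RWRP

namespace RWRP
set_option linter.unusedSectionVars false
set_option linter.unusedVariables false

section kingman2

variable {Ω : Type*} [MeasurableSpace Ω] {μ : Measure Ω} [IsProbabilityMeasure μ] {τ : Ω → Ω}

def kLim (f : ℕ → Ω → ℝ) (ω : Ω) : ℝ≥0∞ :=
  liminf (fun n : ℕ => ENNReal.ofReal (f n ω / n)) atTop

lemma kLim_meas {f : ℕ → Ω → ℝ} (hf : ∀ n, Measurable (f n)) : Measurable (kLim f) :=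
  Measurable.liminf fun n => ((hf n).div_const _).ennreal_ofReal

lemma sub_le_sum {f : ℕ → Ω → ℝ} (h0 : ∀ ω, f 0 ω = 0)
    (hsub : ∀ n m ω, f (n + m) ω ≤ f n ω + f m (τ^[n] ω)) (n : ℕ) (ω : Ω) :
    f n ω ≤ ∑ k ∈ Finset.range n, f 1 (τ^[k] ω) := by
  induction n with
  | zero => simp [h0]
  | succ n ih => rw [Finset.sum_range_succ]; linarith [hsub n 1 ω]

lemma int_fn (hτ : MeasurePreserving τ μ μ) {f : ℕ → Ω → ℝ} (hf : ∀ n, Measurable (f n))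
    (h0 : ∀ ω, f 0 ω = 0) (hnn : ∀ n ω, 0 ≤ f n ω) (hint : Integrable (f 1) μ)
    (hsub : ∀ n m ω, f (n + m) ω ≤ f n ω + f m (τ^[n] ω)) (n : ℕ) :
    Integrable (f n) μ ∧ ∫ ω, f n ω ∂μ ≤ n * ∫ ω, f 1 ω ∂μ := by
  have hk : ∀ k, Integrable (fun ω => f 1 (τ^[k] ω)) μ := fun k =>
    (hτ.iterate k).integrable_comp_of_integrable hint
  have hs : Integrable (fun ω => ∑ k ∈ Finset.range n, f 1 (τ^[k] ω)) μ :=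
    integrable_finsetSum _ fun k _ => hk k
  have hi : Integrable (f n) μ := by
    refine hs.mono' (hf n).aestronglyMeasurable (Eventually.of_forall fun ω => ?_)
    rw [Real.norm_of_nonneg (hnn n ω)]
    exact sub_le_sum h0 hsub n ω
  refine ⟨hi, (integral_mono hi hs fun ω => sub_le_sum h0 hsub n ω).trans ?_⟩
  rw [integral_finsetSum _ fun k _ => hk k]
  have : ∀ k, ∫ ω, f 1 (τ^[k] ω) ∂μ = ∫ ω, f 1 ω ∂μ := by
    intro k
    have h := integral_map (μ := μ) (hτ.iterate k).measurable.aemeasurable (f := f 1)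
      (by rw [(hτ.iterate k).map_eq]; exact (hf 1).aestronglyMeasurable)
    rw [(hτ.iterate k).map_eq] at h
    exact h.symm
  simp [this]

lemma lint_kLim (hτ : MeasurePreserving τ μ μ) {f : ℕ → Ω → ℝ} (hf : ∀ n, Measurable (f n))
    (h0 : ∀ ω, f 0 ω = 0) (hnn : ∀ n ω, 0 ≤ f n ω) (hint : Integrable (f 1) μ)
    (hsub : ∀ n m ω, f (n + m) ω ≤ f n ω + f m (τ^[n] ω)) :
    ∫⁻ ω, kLim f ω ∂μ ≠ ∞ := by
  refine ne_of_lt (lt_of_le_of_lt (lintegral_liminf_le fun n => ((hf n).div_const _).ennreal_ofReal) ?_)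
  refine lt_of_le_of_lt (b := ENNReal.ofReal (∫ ω, f 1 ω ∂μ)) ?_ ENNReal.ofReal_lt_top
  refine liminf_le_of_le (by isBoundedDefault) fun b hb => ?_
  obtain ⟨n, hn1, hn⟩ := (hb.and (eventually_gt_atTop 0)).exists
  refine hn1.trans ?_
  have hi := int_fn hτ hf h0 hnn hint hsub n
  have hn' : (0:ℝ) < n := by exact_mod_cast hn
  rw [← ofReal_integral_eq_lintegral_ofReal (hi.1.div_const _)
    (Eventually.of_forall fun ω => div_nonneg (hnn n ω) hn'.le)]
  apply ENNReal.ofReal_le_ofReal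
  rw [integral_div, div_le_iff₀ hn']
  linarith [hi.2]

lemma kLim_le_comp {f : ℕ → Ω → ℝ} (hnn : ∀ n ω, 0 ≤ f n ω)
    (hsub : ∀ n m ω, f (n + m) ω ≤ f n ω + f m (τ^[n] ω)) (ω : Ω) :
    kLim f ω ≤ kLim f (τ ω) := by
  have h1 : kLim f ω = liminf (fun n : ℕ => ENNReal.ofReal (f (n+1) ω / ((n+1 : ℕ):ℝ))) atTop :=
    (liminf_nat_add (fun n : ℕ => ENNReal.ofReal (f n ω / n)) 1).symm
  have h2 : ∀ n : ℕ, 0 < n → ENNReal.ofReal (f (n+1) ω / ((n+1 : ℕ):ℝ)) ≤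
      ENNReal.ofReal (f 1 ω / n) + ENNReal.ofReal (f n (τ ω) / n) := by
    intro n hn
    have hn' : (0:ℝ) < n := by exact_mod_cast hn
    rw [← ENNReal.ofReal_add (div_nonneg (hnn _ _) hn'.le) (div_nonneg (hnn _ _) hn'.le)]
    apply ENNReal.ofReal_le_ofReal
    have := hsub 1 n ω
    rw [add_comm 1 n, Function.iterate_one] at this
    rw [← add_div]
    have h3 : 0 ≤ f 1 ω + f n (τ ω) := add_nonneg (hnn _ _) (hnn _ _)
    apply div_le_div₀ h3 this hn'
    push_cast; linarith
  rw [h1]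
  have h3 : Tendsto (fun n : ℕ => ENNReal.ofReal (f 1 ω / n)) atTop (𝓝 0) := by
    rw [← ENNReal.ofReal_zero]
    exact (ENNReal.continuous_ofReal.tendsto _).comp (tendsto_const_div_atTop_nhds_zero_nat _)
  refine ENNReal.le_of_forall_pos_le_add fun ε hε _ => ?_
  have h4 : ∀ᶠ n : ℕ in atTop, ENNReal.ofReal (f (n+1) ω / ((n+1 : ℕ):ℝ)) ≤
      ENNReal.ofReal (f n (τ ω) / n) + ε := by
    filter_upwards [h3.eventually_le_const (show (0:ℝ≥0∞) < ε by exact_mod_cast hε),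
      eventually_gt_atTop 0] with n hn hn0
    calc _ ≤ _ := h2 n hn0
      _ ≤ ε + ENNReal.ofReal (f n (τ ω) / n) := by gcongr
      _ = _ := add_comm _ _
  refine (liminf_le_liminf h4).trans ?_
  refine liminf_le_of_le (by isBoundedDefault) fun b hb => ?_
  rw [← tsub_le_iff_right]
  refine le_liminf_of_le (by isBoundedDefault) ?_
  filter_upwards [hb] with n hn
  rwa [tsub_le_iff_right]

theorem kingman (hτ : MeasurePreserving τ μ μ) {f : ℕ → Ω → ℝ} (hf : ∀ n, Measurable (f n))
    (h0 : ∀ ω, f 0 ω = 0) (hnn : ∀ n ω, 0 ≤ f n ω) (hint : Integrable (f 1) μ)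
    (hsub : ∀ n m ω, f (n + m) ω ≤ f n ω + f m (τ^[n] ω)) :
    ∀ᵐ ω ∂μ, Tendsto (fun n : ℕ => f n ω / n) atTop (𝓝 (kLim f ω).toReal) := by
  have hm := kLim_meas hf
  have hfin := lint_kLim hτ hf h0 hnn hint hsub
  set φ : Ω → ℝ := fun ω => (kLim f ω).toReal with hφ
  have hφm : Measurable φ := hm.ennreal_toReal
  have hlt : ∀ᵐ ω ∂μ, kLim f ω < ∞ := ae_lt_top hm hfin
  have hinv1 : ∀ᵐ ω ∂μ, kLim f (τ ω) = kLim f ω :=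
    ae_eq_comp_of_le hτ hm hfin (Eventually.of_forall fun ω => kLim_le_comp hnn hsub ω)
  have hinv : ∀ᵐ ω ∂μ, ∀ k, kLim f (τ^[k] ω) = kLim f ω := by
    rw [ae_all_iff]
    intro k
    induction k with
    | zero => simp
    | succ k ih =>
      filter_upwards [hinv1, hτ.quasiMeasurePreserving.ae ih] with ω h1 h2
      rw [Function.iterate_succ_apply, h2, h1]
  -- upper bound
  have hup : ∀ ε : ℝ, 0 < ε → ∀ᵐ ω ∂μ, ∀ᶠ n : ℕ in atTop, f n ω / n ≤ φ ω + 3 * ε := by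
    intro ε hε
    let bad : ℕ → Set Ω := fun N =>
      {ω | (∀ l, 1 ≤ l → l ≤ N → l * (φ ω + ε) < f l ω) ∨ (N:ℝ) < f 1 ω}
    have hbm : ∀ N, MeasurableSet (bad N) := by
      intro N
      have : bad N = (⋂ l, ⋂ (_ : 1 ≤ l), ⋂ (_ : l ≤ N), {ω | l * (φ ω + ε) < f l ω}) ∪
          {ω | (N:ℝ) < f 1 ω} := by
        ext ω; simp [bad]
      rw [this]
      refine MeasurableSet.union ?_ (measurableSet_lt measurable_const (hf 1))
      refine MeasurableSet.iInter fun l => MeasurableSet.iInter fun _ => MeasurableSet.iInter fun _ => ?_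
      exact measurableSet_lt ((hφm.add_const _).const_mul _) (hf l)
    let G : ℕ → Ω → ℝ := fun N => (bad N).indicator (f 1)
    have hG0 : ∀ N ω, 0 ≤ G N ω := fun N ω => Set.indicator_nonneg (fun ω _ => hnn 1 ω) ω
    have hGm : ∀ N, Measurable (G N) := fun N => (hf 1).indicator (hbm N)
    have hGi : ∀ N, Integrable (G N) μ := fun N => hint.indicator (hbm N)
    have hGlim : Tendsto (fun N => ∫ ω, G N ω ∂μ) atTop (𝓝 0) := by
      have : Tendsto (fun N => ∫ ω, G N ω ∂μ) atTop (𝓝 (∫ ω, (0:ℝ) ∂μ)) := by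
        refine tendsto_integral_of_dominated_convergence (f 1)
          (fun N => (hGm N).aestronglyMeasurable) hint ?_ ?_
        · intro N
          refine Eventually.of_forall fun ω => ?_
          rw [Real.norm_of_nonneg (hG0 N ω)]
          exact Set.indicator_le_self' (fun ω _ => hnn 1 ω) ω
        · filter_upwards [hlt] with ω hω
          have hx : ∃ l : ℕ, 1 ≤ l ∧ f l ω ≤ l * (φ ω + ε) := by
            have h1 : kLim f ω < ENNReal.ofReal (φ ω + ε) := by
              rw [← ENNReal.ofReal_toReal hω.ne]
              exact (ENNReal.ofReal_lt_ofReal_iff (by positivity)).2 (by simp [φ, hε])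
            have h2 := frequently_lt_of_liminf_lt (by isBoundedDefault) h1
            obtain ⟨l, hl1, hl2⟩ := (h2.and_eventually (eventually_ge_atTop 1)).exists
            refine ⟨l, hl2, ?_⟩
            have hl' : (0:ℝ) < l := by exact_mod_cast hl2
            have h3 := (ENNReal.ofReal_lt_ofReal_iff (by positivity)).1 hl1
            rw [div_lt_iff₀ hl'] at h3
            linarith
          obtain ⟨l, hl1, hl2⟩ := hx
          obtain ⟨m, hm⟩ := exists_nat_ge (f 1 ω)
          refine tendsto_const_nhds.congr' ?_
          filter_upwards [eventually_ge_atTop l, eventually_ge_atTop m] with N hN1 hN2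
          have : ω ∉ bad N := by
            simp only [bad, mem_ofPred_eq, not_or, not_forall, not_lt]
            refine ⟨⟨l, hl1, hN1, hl2⟩, hm.trans (by exact_mod_cast hN2)⟩
          simp [G, this]
      simpa using this
    have hset : ∀ N, μ {ω | ¬ ∀ᶠ n : ℕ in atTop, f n ω / n ≤ φ ω + 3 * ε} ≤
        ENNReal.ofReal ((∫ ω, G N ω ∂μ) / ε) := by
      intro N
      refine le_trans (measure_mono_ae ?_) (maximal_ineq hτ (hGm N) (hGi N) (hG0 N) hε)
      filter_upwards [hinv] with ω hω hn
      by_contra hcon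
      apply hn
      have hcon' : ∀ n : ℕ, ∑ k ∈ Finset.range n, G N (τ^[k] ω) ≤ ε * n := by
        intro n
        by_contra h
        exact hcon ⟨n, not_le.1 h⟩
      have hφ0 : 0 ≤ φ ω := ENNReal.toReal_nonneg
      have hgr := greedy (τ := τ) f h0 hnn hsub (G N) (hG0 N) N N (φ ω + ε) (by positivity)
        (by positivity) (fun ω => by
          by_cases h : ω ∈ bad N
          · simp [G, h]
          · simp only [G, h, not_false_eq_true, Set.indicator_of_notMem, zero_add]
            simp only [bad, mem_ofPred_eq, not_or, not_lt] at h
            exact h.2) ω (fun k => by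
          by_cases h : τ^[k] ω ∈ bad N
          · left; simp [G, h]
          · right
            simp only [bad, mem_ofPred_eq, not_or, not_forall, not_lt] at h
            obtain ⟨⟨l, hl1, hl2, hl3⟩, -⟩ := h
            refine ⟨l, hl1, hl2, ?_⟩
            have : φ (τ^[k] ω) = φ ω := by simp [φ, hω k]
            rwa [this] at hl3)
      obtain ⟨m, hm⟩ := exists_nat_ge ((N * N : ℝ) / ε)
      filter_upwards [eventually_ge_atTop m, eventually_gt_atTop 0] with n hn1 hn0
      have hn' : (0:ℝ) < n := by exact_mod_cast hn0
      have h5 := hgr n 0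
      simp only [Function.iterate_zero, id, zero_add] at h5
      have h6 := hcon' n
      have h7 : (N * N : ℝ) ≤ n * ε := by
        rw [div_le_iff₀ hε] at hm
        refine hm.trans ?_
        gcongr
      rw [div_le_iff₀ hn']
      nlinarith
    have hz : μ {ω | ¬ ∀ᶠ n : ℕ in atTop, f n ω / n ≤ φ ω + 3 * ε} ≤ 0 := by
      have : Tendsto (fun N => ENNReal.ofReal ((∫ ω, G N ω ∂μ) / ε)) atTop (𝓝 0) := by
        rw [← ENNReal.ofReal_zero]
        refine (ENNReal.continuous_ofReal.tendsto _).comp ?_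
        simpa using hGlim.div_const ε
      exact ge_of_tendsto' this hset
    exact le_antisymm hz bot_le
  have hup2 : ∀ᵐ ω ∂μ, ∀ j : ℕ, ∀ᶠ n : ℕ in atTop, f n ω / n ≤ φ ω + 3 * (1 / (j+1 : ℝ)) := by
    rw [ae_all_iff]
    intro j
    exact hup _ (by positivity)
  filter_upwards [hup2, hlt] with ω h1 h2
  rw [tendsto_order]
  constructor
  · intro a ha
    by_cases ha0 : a < 0
    · exact Eventually.of_forall fun n => lt_of_lt_of_le ha0 (div_nonneg (hnn n ω) (Nat.cast_nonneg n))
    · have h3 : ENNReal.ofReal a < kLim f ω := by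
        rw [ENNReal.ofReal_lt_iff_lt_toReal (not_lt.1 ha0) h2.ne]; exact ha
      filter_upwards [eventually_lt_of_lt_liminf h3] with n hn
      exact (ENNReal.ofReal_lt_ofReal_iff_of_nonneg (not_lt.1 ha0)).1 hn
  · intro a ha
    obtain ⟨j, hj⟩ := exists_nat_one_div_lt (show 0 < (a - φ ω) / 3 by
      have : φ ω < a := ha
      linarith)
    filter_upwards [h1 j] with n hn
    linarith

end kingman2
end RWRP

namespace RWRP
set_option linter.unusedSectionVars false
set_option linter.unusedVariables false

section geom

variable {d : ℕ}

lemma toR_add (x y : Zd d) : toR (x + y) = toR x + toR y := by ext i; simp [toR]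
lemma toR_sub (x y : Zd d) : toR (x - y) = toR x - toR y := by ext i; simp [toR]
lemma toR_zero : toR (0 : Zd d) = 0 := by ext i; simp [toR]
lemma toR_nsmul (n : ℕ) (x : Zd d) : toR (n • x) = (n:ℝ) • toR x := by ext i; simp [toR]
lemma toR_zsmul (n : ℤ) (x : Zd d) : toR (n • x) = (n:ℝ) • toR x := by ext i; simp [toR]
lemma toR_sum {ι : Type*} (s : Finset ι) (f : ι → Zd d) : toR (∑ i ∈ s, f i) = ∑ i ∈ s, toR (f i) := by
  ext i; simp [toR]
lemma toR_inj {x y : Zd d} (h : toR x = toR y) : x = y := by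
  ext i; have := congrFun h i; simpa [toR] using this

lemma n1_nonneg (ξ : Fin d → ℝ) : 0 ≤ n1 ξ := Finset.sum_nonneg fun _ _ => abs_nonneg _
lemma n1_add (ξ ζ : Fin d → ℝ) : n1 (ξ + ζ) ≤ n1 ξ + n1 ζ := by
  unfold n1; rw [← Finset.sum_add_distrib]
  exact Finset.sum_le_sum fun i _ => abs_add_le _ _
lemma n1_smul (t : ℝ) (ξ : Fin d → ℝ) : n1 (t • ξ) = |t| * n1 ξ := by
  simp [n1, Finset.mul_sum, abs_mul]
lemma n1_zero : n1 (0 : Fin d → ℝ) = 0 := by simp [n1]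
lemma n1_pos {ξ : Fin d → ℝ} (h : ξ ≠ 0) : 0 < n1 ξ := by
  refine lt_of_le_of_ne (n1_nonneg ξ) fun h0 => h ?_
  ext i
  have := (Finset.sum_eq_zero_iff_of_nonneg (fun i _ => abs_nonneg (ξ i))).1 h0.symm i (Finset.mem_univ i)
  simpa using this
lemma norm_le_n1 (ξ : Fin d → ℝ) : ‖ξ‖ ≤ n1 ξ := by
  rw [pi_norm_le_iff_of_nonneg (n1_nonneg ξ)]
  intro i
  exact Finset.single_le_sum (f := fun i => |ξ i|) (fun i _ => abs_nonneg _) (Finset.mem_univ i)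
lemma n1_sum {ι : Type*} (s : Finset ι) (f : ι → Fin d → ℝ) : n1 (∑ i ∈ s, f i) ≤ ∑ i ∈ s, n1 (f i) := by
  induction s using Finset.induction_on with
  | empty => simp [n1_zero]
  | insert a s ha ih => rw [Finset.sum_insert ha, Finset.sum_insert ha]; linarith [n1_add (f a) (∑ i ∈ s, f i)]

/-- real linear combination -/
def lin (J : Finset (Zd d)) (b : Zd d → ℝ) : Fin d → ℝ := ∑ z ∈ J, b z • toR z

lemma lin_add (J : Finset (Zd d)) (b c : Zd d → ℝ) : lin J (fun z => b z + c z) = lin J b + lin J c := by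
  simp [lin, add_smul, Finset.sum_add_distrib]
lemma lin_sub (J : Finset (Zd d)) (b c : Zd d → ℝ) : lin J (fun z => b z - c z) = lin J b - lin J c := by
  simp [lin, sub_smul, Finset.sum_sub_distrib]
lemma lin_smul (J : Finset (Zd d)) (t : ℝ) (b : Zd d → ℝ) : lin J (fun z => t * b z) = t • lin J b := by
  simp [lin, mul_smul, Finset.smul_sum]
lemma lin_congr (J : Finset (Zd d)) {b c : Zd d → ℝ} (h : ∀ z ∈ J, b z = c z) : lin J b = lin J c :=
  Finset.sum_congr rfl fun z hz => by rw [h z hz]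
lemma toR_nsum (J : Finset (Zd d)) (b : Zd d → ℕ) :
    toR (∑ z ∈ J, b z • z) = lin J (fun z => (b z : ℝ)) := by
  rw [toR_sum]; exact Finset.sum_congr rfl fun z _ => toR_nsmul _ _
lemma toR_zsum (J : Finset (Zd d)) (b : Zd d → ℤ) :
    toR (∑ z ∈ J, b z • z) = lin J (fun z => (b z : ℝ)) := by
  rw [toR_sum]; exact Finset.sum_congr rfl fun z _ => toR_zsmul _ _

lemma n1_lin (J : Finset (Zd d)) (b : Zd d → ℝ) : n1 (lin J b) ≤ ∑ z ∈ J, |b z| * n1Z z := by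
  refine (n1_sum _ _).trans (le_of_eq (Finset.sum_congr rfl fun z _ => ?_))
  rw [n1_smul]; rfl

/-- bounded representation in a finitely generated cone -/
lemma cone_bound (n : ℕ) : ∀ J : Finset (Zd d), J.card = n → ∃ κ : ℝ, 0 < κ ∧ ∀ ξ ∈ Cp J,
    ∃ b : Zd d → ℝ, (∀ z, 0 ≤ b z) ∧ ξ = lin J b ∧ ∀ z ∈ J, b z ≤ κ * n1 ξ := by
  induction n with
  | zero =>
    intro J hJ
    rw [Finset.card_eq_zero] at hJ
    subst hJ
    refine ⟨1, one_pos, fun ξ hξ => ⟨fun _ => 0, fun _ => le_rfl, ?_, by simp⟩⟩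
    obtain ⟨b, -, rfl⟩ := hξ
    simp [lin]
  | succ n ih =>
    intro J hJ
    let f : (J → ℝ) →ₗ[ℝ] (Fin d → ℝ) :=
      { toFun := fun b => ∑ z : J, b z • toR (z : Zd d)
        map_add' := by intro a b; simp [add_smul, Finset.sum_add_distrib]
        map_smul' := by intro t b; simp [mul_smul, Finset.smul_sum] }
    have hf : ∀ b : Zd d → ℝ, f (fun z => b z) = lin J b := by
      intro b
      show ∑ z : J, b z • toR (z : Zd d) = _
      rw [lin, ← Finset.sum_coe_sort J (fun z => b z • toR z)]
    by_cases hinj : LinearMap.ker f = ⊥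
    · obtain ⟨K, hK, hanti⟩ := LinearMap.exists_antilipschitzWith f hinj
      refine ⟨K, by exact_mod_cast hK, fun ξ hξ => ?_⟩
      obtain ⟨b, hb, rfl⟩ := hξ
      refine ⟨b, hb, rfl, fun z hz => ?_⟩
      have h1 := hanti.le_mul_dist (fun z : J => b z) 0
      rw [dist_zero_right, map_zero, dist_zero_right, hf] at h1
      have h2 : |b z| ≤ ‖fun z : J => b z‖ := norm_le_pi_norm (fun z : J => b z) ⟨z, hz⟩
      have h3 := norm_le_n1 (lin J b)
      calc b z ≤ |b z| := le_abs_self _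
        _ ≤ K * ‖lin J b‖ := h2.trans h1
        _ ≤ K * n1 (lin J b) := by gcongr
    · have hex : ∃ c : Zd d → ℝ, lin J c = 0 ∧ ∃ z ∈ J, 0 < c z := by
        rw [Submodule.eq_bot_iff] at hinj
        push Not at hinj
        obtain ⟨c, hc, hc0⟩ := hinj
        let c' : Zd d → ℝ := fun z => if h : z ∈ J then c ⟨z, h⟩ else 0
        have hc' : (fun z : J => c' z) = c := by ext z; simp [c']
        have hl : lin J c' = 0 := by rw [← hf, hc']; exact hc
        have : ∃ z : J, c z ≠ 0 := by
          by_contra hcon; push Not at hcon; exact hc0 (funext hcon)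
        obtain ⟨z, hz⟩ := this
        have hcz : c' z = c z := congrFun hc' z
        rcases lt_or_gt_of_ne hz with h | h
        · refine ⟨fun w => (-1) * c' w, by rw [lin_smul, hl, smul_zero], z, z.2, ?_⟩
          show 0 < -1 * c' z
          rw [hcz]; linarith
        · exact ⟨c', hl, z, z.2, by rw [hcz]; exact h⟩
      obtain ⟨c, hc, hcpos⟩ := hex
      have ih' : ∀ z ∈ J, ∃ κ : ℝ, 0 < κ ∧ ∀ ξ ∈ Cp (J.erase z),
          ∃ b : Zd d → ℝ, (∀ z, 0 ≤ b z) ∧ ξ = lin (J.erase z) b ∧ ∀ w ∈ J.erase z, b w ≤ κ * n1 ξ :=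
        fun z hz => ih _ (by rw [Finset.card_erase_of_mem hz, hJ]; rfl)
      choose! κ hκ0 hκ using ih'
      refine ⟨∑ z ∈ J, κ z, Finset.sum_pos hκ0 (hcpos.imp fun _ h => h.1), fun ξ hξ => ?_⟩
      obtain ⟨b, hb, hξb⟩ := hξ
      change ξ = lin J b at hξb
      obtain ⟨z0, hz0, hmin⟩ := Finset.exists_min_image (J.filter fun z => 0 < c z) (fun z => b z / c z)
        (by obtain ⟨z, h1, h2⟩ := hcpos; exact ⟨z, Finset.mem_filter.2 ⟨h1, h2⟩⟩)
      rw [Finset.mem_filter] at hz0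
      set t := b z0 / c z0
      have ht : 0 ≤ t := div_nonneg (hb _) hz0.2.le
      have hz0' : b z0 - t * c z0 = 0 := by
        have := hz0.2.ne'
        simp only [t]; field_simp; ring
      have hnn : ∀ z ∈ J, 0 ≤ b z - t * c z := by
        intro z hz
        by_cases hcz : 0 < c z
        · have := hmin z (Finset.mem_filter.2 ⟨hz, hcz⟩)
          rw [le_div_iff₀ hcz] at this
          linarith
        · have : t * c z ≤ 0 := mul_nonpos_of_nonneg_of_nonpos ht (not_lt.1 hcz)
          linarith [hb z]
      have hξ2 : ξ = lin J (fun z => b z - t * c z) := by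
        rw [lin_sub J b (fun z => t * c z), lin_smul, hc, smul_zero, sub_zero, hξb]
      have hmem : ξ ∈ Cp (J.erase z0) := by
        refine ⟨fun z => max 0 (b z - t * c z), fun z => le_max_left _ _, ?_⟩
        rw [hξ2, lin, ← Finset.add_sum_erase J _ hz0.1, hz0', zero_smul, zero_add]
        refine Finset.sum_congr rfl fun z hz => ?_
        dsimp only
        rw [max_eq_right (hnn z (Finset.mem_of_mem_erase hz))]
      obtain ⟨e, he0, hξe, hebd⟩ := hκ z0 hz0.1 ξ hmem
      refine ⟨fun z => if z = z0 then 0 else e z, fun z => by dsimp only; split_ifs; exacts [le_rfl, he0 z], ?_, ?_⟩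
      · rw [lin, ← Finset.add_sum_erase J _ hz0.1]
        simp only [if_true, zero_smul, zero_add]
        rw [hξe]
        refine Finset.sum_congr rfl fun z hz => ?_
        rw [if_neg (Finset.ne_of_mem_erase hz)]
      · intro z hz
        have hle : κ z0 ≤ ∑ z ∈ J, κ z := Finset.single_le_sum (f := κ) (fun z hz => (hκ0 z hz).le) hz0.1
        have hn := n1_nonneg ξ
        dsimp only
        split_ifs with h
        · have : 0 < ∑ z ∈ J, κ z := lt_of_lt_of_le (hκ0 z0 hz0.1) hle
          positivity
        · exact (hebd z (Finset.mem_erase.2 ⟨h, hz⟩)).trans (by gcongr)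

lemma lin_continuous (J : Finset (Zd d)) : Continuous (lin J) := by
  unfold lin; fun_prop

lemma Cp_closed (J : Finset (Zd d)) : IsClosed (Cp J) := by
  obtain ⟨κ, hκ, hb⟩ := cone_bound J.card J rfl
  rw [← isSeqClosed_iff_isClosed]
  intro u ξ hu hlim
  choose b hb0 hbl hbb using fun n => hb (u n) (hu n)
  have hn1c : Continuous (n1 : (Fin d → ℝ) → ℝ) := by unfold n1; fun_prop
  obtain ⟨M, hM⟩ := ((hn1c.tendsto ξ).comp hlim).bddAbove_range
  let c : ℕ → Zd d → ℝ := fun n z => if z ∈ J then b n z else 0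
  have hc : ∀ n, c n ∈ Set.pi Set.univ (fun z : Zd d => Set.Icc (0:ℝ) (κ * M)) := by
    intro n z _
    have hMn : n1 (u n) ≤ M := hM ⟨n, rfl⟩
    simp only [c]
    split_ifs with h
    · exact ⟨hb0 n z, (hbb n z h).trans (by gcongr)⟩
    · exact ⟨le_rfl, mul_nonneg hκ.le ((n1_nonneg _).trans hMn)⟩
  have hcomp : IsCompact (Set.pi Set.univ (fun z : Zd d => Set.Icc (0:ℝ) (κ * M))) :=
    isCompact_univ_pi fun _ => isCompact_Icc
  obtain ⟨a, ha, ψ, hψ, hψlim⟩ := hcomp.tendsto_subseq hc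
  refine ⟨a, fun z => (ha z (Set.mem_univ z)).1, ?_⟩
  refine tendsto_nhds_unique (hlim.comp hψ.tendsto_atTop) ?_
  refine (((lin_continuous J).tendsto a).comp hψlim).congr fun n => ?_
  show lin J (c (ψ n)) = u (ψ n)
  rw [hbl (ψ n)]
  exact lin_congr J fun z hz => by simp [c, hz]

/-- moving inside the relative interior -/
lemma relint_move {A : Set (Fin d → ℝ)} {ξ v : Fin d → ℝ} (hξ : ξ ∈ intrinsicInterior ℝ A)
    (hv : ∀ t : ℝ, ξ + t • v ∈ affineSpan ℝ A) :
    ∀ᶠ t : ℝ in 𝓝 0, ξ + t • v ∈ intrinsicInterior ℝ A := by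
  rw [mem_intrinsicInterior] at hξ
  obtain ⟨y, hy, rfl⟩ := hξ
  let g : ℝ → affineSpan ℝ A := fun t => ⟨(y : Fin d → ℝ) + t • v, hv t⟩
  have hg : Continuous g := by
    refine Continuous.subtype_mk ?_ _
    fun_prop
  have hg0 : g 0 = y := by ext1; simp [g]
  have h1 := hg.tendsto 0
  rw [hg0] at h1
  filter_upwards [h1.eventually (isOpen_interior.mem_nhds hy)] with t ht
  exact mem_intrinsicInterior.2 ⟨g t, ht, rfl⟩

lemma affine_mem {A : Set (Fin d → ℝ)} (h0 : (0 : Fin d → ℝ) ∈ A) {ξ v : Fin d → ℝ} (hξ : ξ ∈ A)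
    (hv : v ∈ Submodule.span ℝ A) (t : ℝ) : ξ + t • v ∈ affineSpan ℝ A := by
  have h2 : v ∈ (affineSpan ℝ A).direction := by
    rw [direction_affineSpan]
    have : Submodule.span ℝ A ≤ vectorSpan ℝ A := by
      rw [Submodule.span_le]
      intro a ha
      have := vsub_mem_vectorSpan ℝ ha h0
      simpa using this
    exact this hv
  have h3 := AffineSubspace.vadd_mem_of_mem_direction (Submodule.smul_mem _ t h2) (mem_affineSpan ℝ hξ)
  rwa [vadd_eq_add, add_comm] at h3

lemma exists_functional (R : Finset (Zd d)) (U₀ : Set (Fin d → ℝ)) (hU₀ : IsZeroFace R U₀) :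
    ∃ u : (Fin d → ℝ) →ₗ[ℝ] ℝ, ∀ z ∈ R, 0 ≤ u (toR z) ∧ (toR z ∉ U₀ → 0 < u (toR z)) := by
  set S : Set (Fin d → ℝ) := convexHull ℝ (toR '' {z | z ∈ R ∧ toR z ∉ U₀}) with hS
  set W : Submodule ℝ (Fin d → ℝ) := Submodule.span ℝ (toR '' {z | z ∈ R ∧ toR z ∈ U₀}) with hW
  have hSU : S ⊆ hullU R := by
    apply convexHull_mono
    rintro _ ⟨z, hz, rfl⟩
    exact ⟨z, hz.1, rfl⟩
  have hScomp : IsCompact S := by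
    apply Set.Finite.isCompact_convexHull
    apply Set.Finite.image
    exact R.finite_toSet.subset fun z hz => hz.1
  have hdisj : Disjoint S (W : Set (Fin d → ℝ)) := by
    rw [Set.disjoint_left]
    intro η hηS hηW
    rcases hU₀ with ⟨h0U, hface, hrel⟩ | ⟨h0U, rfl⟩
    · have h0 : (0 : Fin d → ℝ) ∈ U₀ := intrinsicInterior_subset hrel
      have hηsp : η ∈ Submodule.span ℝ U₀ := by
        refine Submodule.span_mono ?_ hηW
        rintro _ ⟨z, hz, rfl⟩
        exact hz.2
      have hev := relint_move (v := η) hrel (fun t => affine_mem h0 h0 hηsp t)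
      have hneg : ∃ ε : ℝ, 0 < ε ∧ (-ε) • η ∈ U₀ := by
        obtain ⟨r, hr, hball⟩ := Metric.eventually_nhds_iff.1 hev
        refine ⟨r/2, by positivity, ?_⟩
        have := hball (y := -(r/2)) (by rw [dist_zero_right, Real.norm_eq_abs, abs_neg, abs_of_pos (by positivity)]; linarith)
        rw [zero_add] at this
        exact intrinsicInterior_subset this
      obtain ⟨ε, hε, hεη⟩ := hneg
      have hηU0 : η ∈ U₀ := by
        refine (hface.2.2 (t := ε / (1 + ε)) h0 (hSU hηS) (hface.1 hεη) ⟨by positivity, ?_⟩ ?_).1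
        · rw [div_lt_one (by positivity)]; linarith
        · have : (1 + ε) ≠ 0 := by positivity
          rw [smul_smul, ← add_smul]
          have : ε / (1 + ε) + (1 - ε / (1 + ε)) * -ε = 0 := by field_simp; ring
          rw [this, zero_smul]
      have hconv : Convex ℝ (hullU R \ U₀) := by
        intro a ha b hb s t hs ht hst
        refine ⟨(convex_convexHull ℝ _) ha.1 hb.1 hs ht hst, fun hcon => ?_⟩
        rcases hs.eq_or_lt with rfl | hs'
        · have : t = 1 := by linarith
          subst this
          simp at hcon; exact hb.2 hcon
        rcases ht.eq_or_lt with rfl | ht'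
        · have : s = 1 := by linarith
          subst this
          simp at hcon; exact ha.2 hcon
        refine ha.2 (hface.2.2 (t := s) hcon ha.1 hb.1 ⟨hs', by linarith⟩ ?_).1
        rw [show 1 - s = t by linarith]
      have hS2 : S ⊆ hullU R \ U₀ := by
        apply convexHull_min _ hconv
        rintro _ ⟨z, hz, rfl⟩
        exact ⟨subset_convexHull ℝ _ ⟨z, hz.1, rfl⟩, hz.2⟩
      exact (hS2 hηS).2 hηU0
    · have : η = 0 := by
        have : W = ⊥ := by simp [hW]
        rw [this] at hηW
        simpa using hηW
      subst this
      exact h0U (hSU hηS)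
  obtain ⟨f, a, b, h1, h2, h3⟩ := geometric_hahn_banach_compact_closed (convex_convexHull ℝ _) hScomp
    W.convex (Submodule.closed_of_finiteDimensional W) hdisj
  have hfW : ∀ w ∈ W, f w = 0 := by
    intro w hw
    by_contra hne
    have := h3 (((b - 1) / f w) • w) (W.smul_mem _ hw)
    rw [map_smul, smul_eq_mul, div_mul_cancel₀ _ hne] at this
    linarith
  have hb0 : b < 0 := by simpa using h3 0 W.zero_mem
  refine ⟨-f.toLinearMap, fun z hz => ?_⟩
  by_cases hzU : toR z ∈ U₀
  · have : f (toR z) = 0 := hfW _ (Submodule.subset_span ⟨z, ⟨hz, hzU⟩, rfl⟩)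
    simp [this, hzU]
  · have : f (toR z) < a := h1 _ (subset_convexHull ℝ _ ⟨z, ⟨hz, hzU⟩, rfl⟩)
    have h4 : 0 < -f (toR z) := by linarith
    exact ⟨h4.le, fun _ => h4⟩

end geom
end RWRP

namespace RWRP
set_option linter.unusedSectionVars false
set_option linter.unusedVariables false

section face

variable {d : ℕ} {R R' : Finset (Zd d)} {A : Set (Fin d → ℝ)}

lemma Cp_smul {ξ : Fin d → ℝ} (h : ξ ∈ Cp R) {s : ℝ} (hs : 0 ≤ s) : s • ξ ∈ Cp R := by
  obtain ⟨b, hb, rfl⟩ := h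
  exact ⟨fun z => s * b z, fun z => mul_nonneg hs (hb z), by simp [Finset.smul_sum, mul_smul]⟩

lemma face_zero (hA : IsFace (Cp R) A) {a : Fin d → ℝ} (ha : a ∈ A) : (0 : Fin d → ℝ) ∈ A := by
  have h0 : (0 : Fin d → ℝ) ∈ Cp R := by simpa using Cp_smul (hA.1 ha) (le_refl (0:ℝ))
  refine (hA.2.2 (t := 1/2) ha h0 (Cp_smul (hA.1 ha) (zero_le_two)) ⟨by norm_num, by norm_num⟩ ?_).1
  rw [smul_zero, zero_add, smul_smul]; norm_num

lemma face_smul (hA : IsFace (Cp R) A) {a : Fin d → ℝ} (ha : a ∈ A) {s : ℝ} (hs : 0 ≤ s) : s • a ∈ A := by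
  have h0 := face_zero hA ha
  by_cases h1 : s ≤ 1
  · have := hA.2.1 h0 ha (show 0 ≤ 1 - s by linarith) hs (by ring)
    simpa using this
  · have h1' : 1 < s := not_le.1 h1
    refine (hA.2.2 (t := 1/s) ha (Cp_smul (hA.1 ha) hs) (hA.1 h0) ⟨by positivity, ?_⟩ ?_).1
    · rw [div_lt_one (by positivity)]; exact h1'
    · rw [smul_zero, add_zero, smul_smul, one_div, inv_mul_cancel₀ (by positivity), one_smul]

lemma face_add (hA : IsFace (Cp R) A) {a b : Fin d → ℝ} (ha : a ∈ A) (hb : b ∈ A) : a + b ∈ A := by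
  have := hA.2.1 (face_smul hA ha zero_le_two) (face_smul hA hb zero_le_two)
    (show (0:ℝ) ≤ 1/2 by norm_num) (show (0:ℝ) ≤ 1/2 by norm_num) (by norm_num)
  rw [smul_smul, smul_smul] at this
  norm_num at this
  exact this

lemma face_part (hA : IsFace (Cp R) A) {b : Zd d → ℝ} (hb : ∀ z ∈ R, 0 ≤ b z)
    (h : lin R b ∈ A) {z : Zd d} (hz : z ∈ R) (hbz : 0 < b z) : toR z ∈ A := by
  have h1 : lin R b = (1/2 : ℝ) • ((2 * b z) • toR z) + (1 - 1/2 : ℝ) • ((2:ℝ) • ∑ w ∈ R.erase z, b w • toR w) := by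
    rw [lin, ← Finset.add_sum_erase R _ hz, smul_smul, smul_smul]
    norm_num
    congr 2; ring
  have hzC : toR z ∈ Cp R := by
    refine ⟨fun w => if w = z then 1 else 0, fun w => by dsimp only; split_ifs <;> norm_num, ?_⟩
    simp [ite_smul, Finset.sum_ite_eq', hz]
  have hrest : ∑ w ∈ R.erase z, b w • toR w ∈ Cp R := by
    refine ⟨fun w => if w ∈ R.erase z then b w else 0, fun w => ?_, ?_⟩
    · dsimp only; split_ifs with hw
      · exact hb w (Finset.mem_of_mem_erase hw)
      · exact le_rfl
    · rw [← Finset.add_sum_erase R _ hz]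
      simp only [Finset.mem_erase, ne_eq, not_true_eq_false, false_and, if_false, zero_smul, zero_add]
      refine Finset.sum_congr rfl fun w hw => ?_
      rw [if_pos (by simpa using hw)]
  have h2 := (hA.2.2 (t := 1/2) h (Cp_smul hzC (show 0 ≤ 2 * b z by positivity))
    (Cp_smul hrest zero_le_two) ⟨by norm_num, by norm_num⟩ h1).1
  have h3 := face_smul hA h2 (show 0 ≤ (2 * b z)⁻¹ by positivity)
  rwa [smul_smul, inv_mul_cancel₀ (by positivity), one_smul] at h3

lemma face_eq (hA : IsFace (Cp R) A) (hR' : ∀ z, z ∈ R' ↔ z ∈ R ∧ toR z ∈ A)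
    (hne : R'.Nonempty) : A = Cp R' := by
  have hsub : R' ⊆ R := fun z hz => ((hR' z).1 hz).1
  obtain ⟨z0, hz0⟩ := hne
  have h0 := face_zero hA ((hR' z0).1 hz0).2
  ext ξ
  constructor
  · intro hξ
    obtain ⟨b, hb, rfl⟩ := hA.1 hξ
    refine ⟨b, hb, ?_⟩
    symm
    apply Finset.sum_subset hsub
    intro z hz hz'
    have : ¬ 0 < b z := fun hpos => hz' ((hR' z).2 ⟨hz, face_part hA (fun z _ => hb z) hξ hz hpos⟩)
    rw [le_antisymm (not_lt.1 this) (hb z), zero_smul]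
  · rintro ⟨b, hb, rfl⟩
    have : ∀ J : Finset (Zd d), J ⊆ R' → ∑ z ∈ J, b z • toR z ∈ A := by
      intro J
      induction J using Finset.induction_on with
      | empty => intro _; simpa using h0
      | insert a s ha ih =>
        intro hJ
        rw [Finset.sum_insert ha]
        exact face_add hA (face_smul hA ((hR' a).1 (hJ (Finset.mem_insert_self a s))).2 (hb a))
          (ih ((Finset.subset_insert a s).trans hJ))
    exact this R' subset_rfl

lemma face_Gp (hA : IsFace (Cp R) A) (hR' : ∀ z, z ∈ R' ↔ z ∈ R ∧ toR z ∈ A) {x : Zd d}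
    (hx : x ∈ Gp R) (hxA : toR x ∈ A) : x ∈ Gp R' := by
  have hsub : R' ⊆ R := fun z hz => ((hR' z).1 hz).1
  obtain ⟨b, rfl⟩ := hx
  refine ⟨b, ?_⟩
  symm
  apply Finset.sum_subset hsub
  intro z hz hz'
  rw [toR_nsum] at hxA
  have : ¬ 0 < b z := fun hpos => hz' ((hR' z).2 ⟨hz, face_part hA (fun z _ => Nat.cast_nonneg _) hxA hz
    (by exact_mod_cast hpos)⟩)
  rw [Nat.eq_zero_of_not_pos this, zero_smul]

lemma relint_pos (hA : A = Cp R') {ξ : Fin d → ℝ} (hξ : ξ ∈ intrinsicInterior ℝ A) :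
    ∃ c : Zd d → ℝ, (∀ z, 0 < c z) ∧ ξ = lin R' c := by
  have hs : lin R' (fun _ => 1) ∈ A := by rw [hA]; exact ⟨fun _ => 1, fun _ => zero_le_one, rfl⟩
  have h0 : (0 : Fin d → ℝ) ∈ A := by rw [hA]; exact ⟨fun _ => 0, fun _ => le_rfl, by simp⟩
  have hev := relint_move (v := lin R' (fun _ => 1)) hξ
    (fun t => affine_mem h0 (intrinsicInterior_subset hξ) (Submodule.subset_span hs) t)
  obtain ⟨r, hr, hball⟩ := Metric.eventually_nhds_iff.1 hev
  have := hball (y := -(r/2)) (by rw [dist_zero_right, Real.norm_eq_abs, abs_neg, abs_of_pos (by positivity)]; linarith)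
  have h2 := intrinsicInterior_subset this
  rw [hA] at h2
  obtain ⟨b, hb, hbe⟩ := h2
  refine ⟨fun z => b z + r/2 * 1, fun z => by have := hb z; dsimp only; linarith, ?_⟩
  rw [lin_add R' b (fun z => r/2 * 1), lin_smul R' (r/2) (fun _ => 1)]
  change _ = lin R' b at hbe
  rw [← hbe]; module

lemma delta_rep (hA : A = Cp R') {δ : ℝ} (hδ : 0 < δ) :
    ∃ ε₀ B : ℝ, 0 < ε₀ ∧ 0 < B ∧ ∀ ξ ∈ faceDelta A δ, ∃ β : Zd d → ℝ, ξ = lin R' β ∧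
      ∀ z ∈ R', ε₀ * n1 ξ ≤ β z ∧ β z ≤ B * n1 ξ := by
  obtain ⟨κ, hκ, hcb⟩ := cone_bound R'.card R' rfl
  set s := lin R' (fun _ => 1) with hsdef
  have hs : s ∈ A := by rw [hA]; exact ⟨fun _ => 1, fun _ => zero_le_one, rfl⟩
  have h0 : (0 : Fin d → ℝ) ∈ A := by rw [hA]; exact ⟨fun _ => 0, fun _ => le_rfl, by simp⟩
  have hs0 := n1_nonneg s
  set ε₀ := δ / (2 * (n1 s + 1)) with hε₀
  have hε₀p : 0 < ε₀ := by positivity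
  have hε₀s : ε₀ * n1 s < δ := by
    rw [hε₀, div_mul_eq_mul_div, div_lt_iff₀ (by positivity)]
    nlinarith
  have hclosed : IsClosed A := by rw [hA]; exact Cp_closed R'
  refine ⟨ε₀, κ * (1 + ε₀ * n1 s) + ε₀, hε₀p, by positivity, fun ξ hξ => ?_⟩
  obtain ⟨hξA, hξ0, hdist⟩ := hξ
  have hpos := n1_pos hξ0
  set ζ := (n1 ξ)⁻¹ • ξ with hζ
  have hζn : n1 ζ = 1 := by rw [hζ, n1_smul, abs_of_pos (by positivity), inv_mul_cancel₀ hpos.ne']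
  have hζA : ζ ∈ A := by
    rw [hA] at hξA ⊢; exact Cp_smul hξA (by positivity)
  have hrel : ∀ t : ℝ, 0 ≤ t → t ≤ ε₀ → ζ - t • s ∈ A → ζ - t • s ∈ intrinsicInterior ℝ A := by
    intro t ht0 ht1 htA
    by_contra hcon
    have h1 := hdist.trans (iInf₂_le (ζ - t • s) ⟨htA, hcon⟩)
    rw [ENNReal.ofReal_le_ofReal_iff (n1_nonneg _)] at h1
    rw [sub_sub_cancel, n1_smul, abs_of_nonneg ht0] at h1
    have : t * n1 s ≤ ε₀ * n1 s := by gcongr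
    linarith
  have hI : Set.Icc 0 ε₀ ⊆ {t : ℝ | ζ - t • s ∈ A} := by
    apply IsClosed.Icc_subset_of_forall_exists_gt
    · apply IsClosed.inter _ isClosed_Icc
      exact hclosed.preimage (by fun_prop)
    · simpa using hζA
    · rintro x ⟨hx1, hx2⟩ y hy
      have hr := hrel x hx2.1 hx2.2.le hx1
      have hev := relint_move (v := s) hr (fun t => affine_mem h0 hx1 (Submodule.subset_span hs) t)
      obtain ⟨r, hr0, hball⟩ := Metric.eventually_nhds_iff.1 hev
      set q := min (r/2) (y - x) with hq
      have hqpos : 0 < q := lt_min (by positivity) (sub_pos.2 hy)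
      have h2 := hball (y := -q) (by
        rw [dist_zero_right, Real.norm_eq_abs, abs_neg, abs_of_pos hqpos]
        exact lt_of_le_of_lt (min_le_left _ _) (by linarith))
      refine ⟨x + q, ?_, by linarith, by linarith [min_le_right (r/2) (y-x)]⟩
      have h3 := intrinsicInterior_subset h2
      show ζ - (x + q) • s ∈ A
      convert h3 using 1
      module
  have hmem : ζ - ε₀ • s ∈ Cp R' := by rw [← hA]; exact hI ⟨hε₀p.le, le_rfl⟩
  obtain ⟨b, hb0, hbl, hbb⟩ := hcb _ hmem
  have hn : n1 (ζ - ε₀ • s) ≤ 1 + ε₀ * n1 s := by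
    have := n1_add ζ ((-ε₀) • s)
    rw [n1_smul (-ε₀) s, abs_neg, abs_of_pos hε₀p, hζn, neg_smul, ← sub_eq_add_neg] at this
    exact this
  refine ⟨fun z => n1 ξ * (b z + ε₀ * 1), ?_, fun z hz => ⟨?_, ?_⟩⟩
  · rw [lin_smul R' (n1 ξ) (fun z => b z + ε₀ * 1), lin_add R' b (fun z => ε₀ * 1),
      lin_smul R' ε₀ (fun _ => 1), ← hbl, ← hsdef, sub_add_cancel, hζ, smul_smul,
      mul_inv_cancel₀ hpos.ne', one_smul]
  · have := hb0 z
    dsimp only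
    nlinarith
  · have h1 : b z ≤ κ * (1 + ε₀ * n1 s) := (hbb z hz).trans (by gcongr)
    dsimp only
    nlinarith

/-- integer representation close to a real one -/
lemma int_rep (R' : Finset (Zd d)) : ∃ E : ℝ, 0 ≤ E ∧ ∀ x ∈ GZ R', ∀ β : Zd d → ℝ, toR x = lin R' β →
    ∃ b : Zd d → ℤ, x = ∑ z ∈ R', b z • z ∧ ∀ z ∈ R', |(b z : ℝ) - β z| ≤ E := by
  let m : Zd d := fun i => ∑ z ∈ R', |z i|
  have hch : ∀ r : Zd d, ∃ e : Zd d → ℤ, r ∈ GZ R' → r = ∑ z ∈ R', e z • z := by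
    intro r
    by_cases h : r ∈ GZ R'
    · obtain ⟨e, he⟩ := h; exact ⟨e, fun _ => he⟩
    · exact ⟨0, fun h' => absurd h' h⟩
  choose e he using hch
  refine ⟨1 + ∑ r ∈ Finset.Icc (-m) m, ∑ z ∈ R', |(e r z : ℝ)|, by positivity, ?_⟩
  rintro x ⟨bx, hbx⟩ β hβ
  set r : Zd d := x - ∑ z ∈ R', ⌊β z⌋ • z with hr
  have hrG : r ∈ GZ R' := ⟨fun z => bx z - ⌊β z⌋, by
    rw [hr, hbx, ← Finset.sum_sub_distrib]
    exact Finset.sum_congr rfl fun z _ => by rw [sub_smul]⟩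
  have hrl : toR r = lin R' (fun z => Int.fract (β z)) := by
    rw [hr, toR_sub, hβ, toR_zsum, ← lin_sub]; rfl
  have hrb : ∀ i, |r i| ≤ m i := by
    intro i
    have h1 : (r i : ℝ) = ∑ z ∈ R', Int.fract (β z) * (z i : ℝ) := by
      have := congrFun hrl i
      simpa [lin, toR, Finset.sum_apply] using this
    have h2 : |(r i : ℝ)| ≤ ∑ z ∈ R', |(z i : ℝ)| := by
      rw [h1]
      refine (Finset.abs_sum_le_sum_abs _ _).trans (Finset.sum_le_sum fun z _ => ?_)
      rw [abs_mul, abs_of_nonneg (Int.fract_nonneg _)]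
      exact mul_le_of_le_one_left (abs_nonneg _) (Int.fract_lt_one _).le
    show |r i| ≤ ∑ z ∈ R', |z i|
    exact_mod_cast h2
  have hrm : r ∈ Finset.Icc (-m) m := by
    rw [Finset.mem_Icc]
    exact ⟨fun i => (abs_le.1 (hrb i)).1, fun i => (abs_le.1 (hrb i)).2⟩
  refine ⟨fun z => ⌊β z⌋ + e r z, ?_, fun z hz => ?_⟩
  · simp only [add_smul, Finset.sum_add_distrib]
    rw [← he r hrG, hr]; abel
  · have h1 : |(e r z : ℝ)| ≤ ∑ r ∈ Finset.Icc (-m) m, ∑ z ∈ R', |(e r z : ℝ)| :=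
      (Finset.single_le_sum (f := fun z => |(e r z : ℝ)|) (fun _ _ => abs_nonneg _) hz).trans
        (Finset.single_le_sum (f := fun r => ∑ z ∈ R', |(e r z : ℝ)|)
          (fun _ _ => Finset.sum_nonneg fun _ _ => abs_nonneg _) hrm)
    have h2 : ((⌊β z⌋ + e r z : ℤ) : ℝ) - β z = e r z - Int.fract (β z) := by
      push_cast; rw [← Int.self_sub_floor]; ring
    rw [h2]
    have h3 := abs_sub (e r z : ℝ) (Int.fract (β z))
    rw [abs_of_nonneg (Int.fract_nonneg (β z))] at h3
    linarith [Int.fract_lt_one (β z)]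

end face
end RWRP

namespace RWRP
set_option linter.unusedSectionVars false
set_option linter.unusedVariables false

variable {d : ℕ} {Ω : Type*}

section walk
variable (T : Zd d → Ω → Ω) (V : Ω → Zd d → ℝ) (p : Zd d → ℝ) (R : Finset (Zd d))

/-- one-step weight -/
def qW (ω : Ω) (x w : Zd d) : ℝ≥0∞ :=
  ENNReal.ofReal (p w) * ENNReal.ofReal (Real.exp (-(V (T x ω) w)))

/-- contribution of paths of length n+1 -/
def hitH (ω : Ω) (n : ℕ) (x y : Zd d) : ℝ≥0∞ :=
  ∑ s : Fin (n+1) → {z : Zd d // z ∈ R},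
    if firstHit x y (n+1) (stepF (n+1) s) then
      pathW p s * ENNReal.ofReal (Real.exp (-(pathV T V ω x (n+1) (stepF (n+1) s))))
    else 0

/-- kernel with value 1 on the diagonal -/
def Kt (ω : Ω) (x y : Zd d) : ℝ≥0∞ := if y = x then 1 else walkK T V p R ω x y

lemma pos_succ (x : Zd d) (f : ℕ → Zd d) (k : ℕ) :
    pos x f (k+1) = pos (x + f 0) (fun i => f (i+1)) k := by
  unfold pos; rw [Finset.sum_range_succ']; abel

lemma pathV_succ (ω : Ω) (x : Zd d) (f : ℕ → Zd d) (n : ℕ) :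
    pathV T V ω x (n+1) f = V (T x ω) (f 0) + pathV T V ω (x + f 0) n (fun i => f (i+1)) := by
  unfold pathV; rw [Finset.sum_range_succ', add_comm]
  congr 1
  · simp [pos]
  · exact Finset.sum_congr rfl fun i _ => by rw [pos_succ]

lemma firstHit_succ (x y : Zd d) (n : ℕ) (f : ℕ → Zd d) :
    firstHit x y (n+2) f ↔ x + f 0 ≠ y ∧ firstHit (x + f 0) y (n+1) (fun i => f (i+1)) := by
  unfold firstHit
  rw [pos_succ]
  constructor
  · rintro ⟨h1, h2⟩
    refine ⟨?_, h1, fun k hk => ?_⟩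
    · have := h2 1 (by simp)
      simpa [pos] using this
    · have := h2 (k+1) (by simp at hk ⊢; omega)
      rwa [pos_succ] at this
  · rintro ⟨h0, h1, h2⟩
    refine ⟨h1, fun k hk => ?_⟩
    obtain ⟨j, rfl⟩ : ∃ j, k = j + 1 := ⟨k - 1, by simp at hk; omega⟩
    rw [pos_succ]
    rcases Nat.eq_zero_or_pos j with rfl | hj
    · simpa [pos] using h0
    · exact h2 j (by simp at hk ⊢; omega)

lemma stepF_cons_zero {n : ℕ} (w : {z : Zd d // z ∈ R}) (s : Fin n → {z : Zd d // z ∈ R}) :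
    stepF (n+1) (Fin.cons w s : Fin (n+1) → {z : Zd d // z ∈ R}) 0 = w := by
  unfold stepF
  rw [dif_pos (Nat.succ_pos n)]
  rfl

lemma stepF_cons_succ {n : ℕ} (w : {z : Zd d // z ∈ R}) (s : Fin n → {z : Zd d // z ∈ R}) :
    (fun i => stepF (n+1) (Fin.cons w s : Fin (n+1) → {z : Zd d // z ∈ R}) (i+1)) = stepF n s := by
  funext i
  unfold stepF
  by_cases h : i < n
  · rw [dif_pos h, dif_pos (by omega)]; rfl
  · rw [dif_neg h, dif_neg (by omega)]

lemma sum_cons {n : ℕ} (g : (Fin (n+1) → {z : Zd d // z ∈ R}) → ℝ≥0∞) :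
    ∑ s, g s = ∑ w : {z : Zd d // z ∈ R}, ∑ s : Fin n → {z : Zd d // z ∈ R}, g (Fin.cons w s) := by
  rw [← Fintype.sum_prod_type' (f := fun w s => g (Fin.cons w s))]
  exact (Fintype.sum_equiv (Fin.consEquiv fun _ => {z : Zd d // z ∈ R}) _ _ (fun _ => rfl)).symm

lemma pathW_cons {n : ℕ} (w : {z : Zd d // z ∈ R}) (s : Fin n → {z : Zd d // z ∈ R}) :
    pathW p (Fin.cons w s : Fin (n+1) → {z : Zd d // z ∈ R}) = ENNReal.ofReal (p w) * pathW p s := by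
  unfold pathW; rw [Fin.prod_univ_succ]; rfl

lemma hitH_zero (ω : Ω) (x y : Zd d) :
    hitH T V p R ω 0 x y = ∑ w ∈ R, qW T V p ω x w * (if x + w = y then 1 else 0) := by
  unfold hitH
  rw [sum_cons, ← Finset.sum_coe_sort R]
  refine Finset.sum_congr rfl fun w _ => ?_
  rw [Fintype.sum_unique, pathW_cons, pathV_succ]
  have hf : ∀ f : ℕ → Zd d, firstHit x y 1 f ↔ x + f 0 = y := by
    intro f; simp [firstHit, pos]; intro _ k hk hk0; omega
  simp only [Nat.zero_add, hf, stepF_cons_zero, qW, mul_ite, mul_one, mul_zero]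
  simp [pathV, pathW]

lemma hitH_succ (ω : Ω) (n : ℕ) (x y : Zd d) :
    hitH T V p R ω (n+1) x y = ∑ w ∈ R, qW T V p ω x w * (if x + w = y then 0 else hitH T V p R ω n (x+w) y) := by
  unfold hitH
  rw [sum_cons, ← Finset.sum_coe_sort R]
  refine Finset.sum_congr rfl fun w _ => ?_
  by_cases h : x + (w : Zd d) = y
  · rw [if_pos h, mul_zero]
    refine Finset.sum_eq_zero fun s _ => if_neg ?_
    rw [firstHit_succ, stepF_cons_zero]
    exact fun h' => h'.1 h
  · rw [if_neg h, Finset.mul_sum]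
    refine Finset.sum_congr rfl fun s _ => ?_
    rw [pathW_cons, pathV_succ, firstHit_succ, stepF_cons_zero, stepF_cons_succ]
    simp only [ne_eq, h, not_false_eq_true, true_and]
    rw [mul_ite, mul_zero, neg_add, Real.exp_add, ENNReal.ofReal_mul (Real.exp_pos _).le]
    congr 1
    unfold qW; ring

lemma walkK_eq (ω : Ω) (x y : Zd d) : walkK T V p R ω x y = ∑' n, hitH T V p R ω n x y := rfl

lemma walkK_step (ω : Ω) (x y : Zd d) :
    walkK T V p R ω x y = ∑ w ∈ R, qW T V p ω x w * Kt T V p R ω (x+w) y := by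
  rw [walkK_eq, tsum_eq_zero_add' ENNReal.summable, hitH_zero]
  simp_rw [hitH_succ]
  rw [Summable.tsum_finsetSum (fun _ _ => ENNReal.summable), ← Finset.sum_add_distrib]
  refine Finset.sum_congr rfl fun w _ => ?_
  rw [ENNReal.tsum_mul_left, ← mul_add]
  congr 1
  unfold Kt
  by_cases h : x + w = y
  · simp [h]
  · simp [h, Ne.symm h, walkK_eq]

/-- truncated kernel -/
def Km (ω : Ω) (m : ℕ) (x y : Zd d) : ℝ≥0∞ := ∑ n ∈ Finset.range m, hitH T V p R ω n x y

lemma Km_succ (ω : Ω) (m : ℕ) (x y : Zd d) :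
    Km T V p R ω (m+1) x y = ∑ w ∈ R, qW T V p ω x w * (if x + w = y then 1 else Km T V p R ω m (x+w) y) := by
  unfold Km
  rw [Finset.sum_range_succ', hitH_zero]
  simp_rw [hitH_succ]
  rw [Finset.sum_comm, ← Finset.sum_add_distrib]
  refine Finset.sum_congr rfl fun w _ => ?_
  rw [← Finset.mul_sum, ← mul_add]
  congr 1
  by_cases h : x + w = y <;> simp [h]

variable {T V p R}
variable {v : (Fin d → ℝ) →ₗ[ℝ] ℝ} {ω : Ω}

lemma q_bound (hp : ∀ z ∈ R, 0 < p z) (hp1 : ∑ z ∈ R, p z = 1)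
    (hv : ∀ x, ∀ z ∈ R, -v (toR z) ≤ V (T x ω) z) (x y : Zd d) (g : Zd d → ℝ≥0∞)
    (hg : ∀ w ∈ R, g w ≤ ENNReal.ofReal (Real.exp (v (toR (y - (x + w)))))) :
    ∑ w ∈ R, qW T V p ω x w * g w ≤ ENNReal.ofReal (Real.exp (v (toR (y - x)))) := by
  calc ∑ w ∈ R, qW T V p ω x w * g w
      ≤ ∑ w ∈ R, ENNReal.ofReal (p w) * ENNReal.ofReal (Real.exp (v (toR (y - x)))) := by
        refine Finset.sum_le_sum fun w hw => ?_
        unfold qW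
        rw [mul_assoc]
        refine mul_le_mul_right ?_ _
        calc _ ≤ ENNReal.ofReal (Real.exp (v (toR w))) * ENNReal.ofReal (Real.exp (v (toR (y - (x + w))))) := by
              refine mul_le_mul' (ENNReal.ofReal_le_ofReal (Real.exp_le_exp.2 ?_)) (hg w hw)
              linarith [hv x w hw]
          _ = _ := by
              rw [← ENNReal.ofReal_mul (Real.exp_pos _).le, ← Real.exp_add, ← map_add, ← toR_add]
              congr 4; abel_nf
    _ = _ := by
        rw [← Finset.sum_mul, ← ENNReal.ofReal_sum_of_nonneg (fun w hw => (hp w hw).le), hp1]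
        simp

lemma Km_bound (hp : ∀ z ∈ R, 0 < p z) (hp1 : ∑ z ∈ R, p z = 1)
    (hv : ∀ x, ∀ z ∈ R, -v (toR z) ≤ V (T x ω) z) (m : ℕ) : ∀ x y : Zd d,
    Km T V p R ω m x y ≤ ENNReal.ofReal (Real.exp (v (toR (y - x)))) := by
  induction m with
  | zero => intro x y; simp [Km]
  | succ m ih =>
    intro x y
    rw [Km_succ]
    refine q_bound hp hp1 hv x y _ fun w hw => ?_
    split_ifs with h
    · subst h; simp [toR_zero]
    · exact ih _ _

lemma walkK_iSup (x y : Zd d) : walkK T V p R ω x y = ⨆ m, Km T V p R ω m x y := by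
  rw [walkK_eq, ENNReal.tsum_eq_iSup_nat]; rfl

lemma Kt_bound (hp : ∀ z ∈ R, 0 < p z) (hp1 : ∑ z ∈ R, p z = 1)
    (hv : ∀ x, ∀ z ∈ R, -v (toR z) ≤ V (T x ω) z) (x y : Zd d) :
    Kt T V p R ω x y ≤ ENNReal.ofReal (Real.exp (v (toR (y - x)))) := by
  unfold Kt
  split_ifs with h
  · subst h; simp [toR_zero]
  · rw [walkK_iSup]; exact iSup_le fun m => Km_bound hp hp1 hv m x y

lemma Km_mul (hp : ∀ z ∈ R, 0 < p z) (hp1 : ∑ z ∈ R, p z = 1)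
    (hv : ∀ x, ∀ z ∈ R, -v (toR z) ≤ V (T x ω) z) (m : ℕ) : ∀ x y z : Zd d,
    Km T V p R ω m x y * Kt T V p R ω y z ≤ Kt T V p R ω x z := by
  induction m with
  | zero => intro x y z; simp [Km]
  | succ m ih =>
    intro x y z
    by_cases h : z = x
    · subst h
      calc _ ≤ _ := mul_le_mul' (Km_bound hp hp1 hv _ _ _) (Kt_bound hp hp1 hv _ _)
        _ = 1 := by
          rw [← ENNReal.ofReal_mul (Real.exp_pos _).le, ← Real.exp_add, ← map_add, ← toR_add]
          simp [toR_zero]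
        _ = _ := by simp [Kt]
    · have : Kt T V p R ω x z = walkK T V p R ω x z := by simp [Kt, h]
      rw [this, walkK_step, Km_succ, Finset.sum_mul]
      refine Finset.sum_le_sum fun w hw => ?_
      rw [mul_assoc]
      refine mul_le_mul_right ?_ _
      split_ifs with h2
      · rw [h2, one_mul]
      · exact ih _ _ _

lemma Kt_mul (hp : ∀ z ∈ R, 0 < p z) (hp1 : ∑ z ∈ R, p z = 1)
    (hv : ∀ x, ∀ z ∈ R, -v (toR z) ≤ V (T x ω) z) (x y z : Zd d) :
    Kt T V p R ω x y * Kt T V p R ω y z ≤ Kt T V p R ω x z := by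
  by_cases h : y = x
  · subst h; simp [Kt]
  · have : Kt T V p R ω x y = walkK T V p R ω x y := by simp [Kt, h]
    rw [this, walkK_iSup, ENNReal.iSup_mul]
    exact iSup_le fun m => Km_mul hp hp1 hv m x y z

lemma Kt_shift (hT : ∀ x y, T (x + y) = T x ∘ T y) (x y : Zd d) :
    Kt T V p R ω x (x + y) = Kt T V p R (T x ω) 0 y := by
  have hpos : ∀ f k, pos x f k = x + pos 0 f k := by intro f k; simp [pos]
  have hT' : ∀ u, T (x + u) ω = T u (T x ω) := by intro u; rw [add_comm, hT]; rfl
  unfold Kt walkK pathV firstHit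
  simp only [hpos, hT', add_right_inj, add_eq_left, ne_eq]
  congr!

lemma aFun_eq (x y : Zd d) : aFun T V p R ω x y = - Real.log (Kt T V p R ω x y).toReal := by
  unfold aFun Kt; split_ifs <;> simp

lemma Kt_single (hT0 : T 0 = id) (z : Zd d) (hz : z ∈ R) (hz0 : z ≠ 0) :
    ENNReal.ofReal (p z * Real.exp (-(V ω z))) ≤ Kt T V p R ω 0 z := by
  have : Kt T V p R ω 0 z = walkK T V p R ω 0 z := by simp [Kt, hz0]
  rw [this, walkK_step]
  refine le_trans ?_ (Finset.single_le_sum (f := fun w => qW T V p ω 0 w * Kt T V p R ω (0+w) z) (fun _ _ => zero_le) hz)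
  simp only [zero_add, Kt, if_true, mul_one, qW, hT0, id]
  rw [← ENNReal.ofReal_mul' (Real.exp_pos _).le]

lemma Kt_pos (hT0 : T 0 = id) (hT : ∀ x y, T (x + y) = T x ∘ T y)
    (hp : ∀ z ∈ R, 0 < p z) (hp1 : ∑ z ∈ R, p z = 1)
    (hv : ∀ x, ∀ z ∈ R, -v (toR z) ≤ V (T x ω) z) {x : Zd d} (hx : x ∈ Gp R) :
    0 < Kt T V p R ω 0 x := by
  obtain ⟨b, rfl⟩ := hx
  have step : ∀ y z, z ∈ R → 0 < Kt T V p R ω 0 y → 0 < Kt T V p R ω 0 (y + z) := by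
    intro y z hz hy
    refine lt_of_lt_of_le ?_ (Kt_mul hp hp1 hv 0 y (y+z))
    refine ENNReal.mul_pos hy.ne' ?_
    by_cases hz0 : z = 0
    · simp [Kt, hz0]
    rw [Kt_shift hT]
    refine (lt_of_lt_of_le ?_ (Kt_single hT0 z hz hz0)).ne'
    rw [ENNReal.ofReal_pos]
    exact mul_pos (hp z hz) (Real.exp_pos _)
  have step2 : ∀ (n : ℕ) y z, z ∈ R → 0 < Kt T V p R ω 0 y → 0 < Kt T V p R ω 0 (y + n • z) := by
    intro n y z hz hy
    induction n with
    | zero => simpa using hy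
    | succ n ih => rw [add_smul, one_smul, ← add_assoc]; exact step _ _ hz ih
  have : ∀ J : Finset (Zd d), J ⊆ R → 0 < Kt T V p R ω 0 (∑ z ∈ J, b z • z) := by
    intro J
    induction J using Finset.induction_on with
    | empty => intro _; simp [Kt]
    | insert a s ha ih =>
      intro h
      rw [Finset.sum_insert ha, add_comm]
      exact step2 _ _ _ (h (Finset.mem_insert_self _ _)) (ih (fun z hz => h (Finset.mem_insert_of_mem hz)))
  exact this R subset_rfl

lemma Kt_meas [MeasurableSpace Ω] (hT : ∀ z, Measurable (T z)) (hV : ∀ z : Zd d, Measurable fun ω => V ω z)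
    (x y : Zd d) : Measurable fun ω => Kt T V p R ω x y := by
  unfold Kt
  split_ifs
  · exact measurable_const
  · unfold walkK
    refine Measurable.tsum fun n => Finset.measurable_sum _ fun s _ => ?_
    split_ifs
    · refine Measurable.const_mul (ENNReal.measurable_ofReal.comp (Real.measurable_exp.comp (Measurable.neg ?_))) _
      unfold pathV
      exact Finset.measurable_sum _ fun i _ => (hV _).comp (hT _)
    · exact measurable_const

end walk

section Fdef
variable [MeasurableSpace Ω]

/-- Everything needed about the centered passage times. -/
structure FPack (ℙ : Measure Ω) (T : Zd d → Ω → Ω) (R : Finset (Zd d)) (V : Ω → Zd d → ℝ)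
    (F : Zd d → Ω → ℝ) (κ : ℝ) : Prop where
  meas : ∀ x, Measurable (F x)
  nonneg : ∀ x ∈ Gp R, ∀ ω, 0 ≤ F x ω
  zero : ∀ ω, F 0 ω = 0
  sub : ∀ x ∈ Gp R, ∀ y ∈ Gp R, ∀ ω, F (x + y) ω ≤ F x ω + F y (T x ω)
  step : ∀ z ∈ R, ∀ ω, F z ω ≤ max (V ω z) 0 + κ
  step0 : 0 ≤ κ

lemma Gp_zero (R : Finset (Zd d)) : (0 : Zd d) ∈ Gp R := ⟨fun _ => 0, by simp⟩
lemma Gp_add {R : Finset (Zd d)} {x y : Zd d} (hx : x ∈ Gp R) (hy : y ∈ Gp R) : x + y ∈ Gp R := by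
  obtain ⟨b, rfl⟩ := hx
  obtain ⟨c, rfl⟩ := hy
  exact ⟨fun z => b z + c z, by simp [add_smul, Finset.sum_add_distrib]⟩
lemma Gp_single {R : Finset (Zd d)} {z : Zd d} (hz : z ∈ R) : z ∈ Gp R :=
  ⟨fun w => if w = z then 1 else 0, by simp [ite_smul, hz]⟩
lemma Gp_nsmul {R : Finset (Zd d)} {x : Zd d} (hx : x ∈ Gp R) (n : ℕ) : n • x ∈ Gp R := by
  induction n with
  | zero => simpa using Gp_zero R
  | succ n ih => rw [add_smul, one_smul]; exact Gp_add ih hx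
lemma Gp_mono {R R' : Finset (Zd d)} (h : R' ⊆ R) : Gp R' ⊆ Gp R := by
  rintro x ⟨b, rfl⟩
  refine ⟨fun z => if z ∈ R' then b z else 0, ?_⟩
  rw [← Finset.sum_subset h (f := fun z => (if z ∈ R' then b z else 0) • z)]
  · exact Finset.sum_congr rfl fun z hz => by simp [hz]
  · intro z _ hz; simp [hz]

lemma exists_F (ℙ : Measure Ω) [IsProbabilityMeasure ℙ]
    (T : Zd d → Ω → Ω) (R : Finset (Zd d)) (V : Ω → Zd d → ℝ) (p : Zd d → ℝ)
    (hset : Setting ℙ T R V p)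
    (U₀ : Set (Fin d → ℝ)) (hU₀ : IsZeroFace R U₀)
    (hi : AssumptionI ℙ V R U₀) :
    ∃ (v : (Fin d → ℝ) →ₗ[ℝ] ℝ) (F : Zd d → Ω → ℝ) (κ : ℝ), FPack ℙ T R V F κ ∧
      ∀ᵐ ω ∂ℙ, ∀ x, F x ω = aFun T V p R ω 0 x + v (toR x) := by
  obtain ⟨hTm, hT0, hTa, hTmp, -, hVm, hp, hp1⟩ := hset
  replace hp : ∀ z ∈ R, 0 < p z := fun z hz => (hp z hz).1
  obtain ⟨u, hu⟩ := exists_functional R U₀ hU₀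
  obtain ⟨hi0, c, hic⟩ := hi
  -- constant
  obtain ⟨K, hK0, hK⟩ : ∃ K : ℝ, 0 ≤ K ∧ ∀ z ∈ R, toR z ∉ U₀ → -c ≤ K * u (toR z) := by
    refine ⟨∑ z ∈ R, |c| / u (toR z), Finset.sum_nonneg fun z hz => div_nonneg (abs_nonneg _) (hu z hz).1, ?_⟩
    intro z hz hzU
    have hpos := (hu z hz).2 hzU
    have : |c| / u (toR z) ≤ ∑ z ∈ R, |c| / u (toR z) :=
      Finset.single_le_sum (f := fun z => |c| / u (toR z)) (fun z hz => div_nonneg (abs_nonneg _) (hu z hz).1) hz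
    calc -c ≤ |c| := neg_le_abs c
      _ = |c| / u (toR z) * u (toR z) := by field_simp
      _ ≤ _ := by gcongr
  set v := K • u with hvdef
  have hV : ∀ z ∈ R, ∀ᵐ ω ∂ℙ, -v (toR z) ≤ V ω z := by
    intro z hz
    by_cases hzU : toR z ∈ U₀
    · filter_upwards [hi0 z ⟨hz, hzU⟩] with ω h
      have := mul_nonneg hK0 (hu z hz).1
      simp only [hvdef, LinearMap.smul_apply, smul_eq_mul]; linarith
    · filter_upwards [hic z hz hzU] with ω h
      have := hK z hz hzU
      simp only [hvdef, LinearMap.smul_apply, smul_eq_mul]; linarith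
  set Ω₀ : Set Ω := {ω | ∀ x : Zd d, ∀ z ∈ R, -v (toR z) ≤ V (T x ω) z} with hΩ₀
  have hΩm : MeasurableSet Ω₀ := by
    have : Ω₀ = ⋂ x : Zd d, ⋂ z ∈ R, {ω | -v (toR z) ≤ V (T x ω) z} := by
      ext ω; simp [hΩ₀]
    rw [this]
    exact MeasurableSet.iInter fun x => MeasurableSet.biInter R.countable_toSet fun z _ =>
      measurableSet_le measurable_const ((hVm z).comp (hTm x))
  have hΩae : ∀ᵐ ω ∂ℙ, ω ∈ Ω₀ := by
    show ∀ᵐ ω ∂ℙ, ∀ x : Zd d, ∀ z ∈ R, -v (toR z) ≤ V (T x ω) z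
    rw [ae_all_iff]; intro x
    rw [ae_all_iff]; intro z
    by_cases hz : z ∈ R
    · filter_upwards [(hTmp x).quasiMeasurePreserving.ae (hV z hz)] with ω h _ using h
    · simp [hz]
  have hΩT : ∀ ω ∈ Ω₀, ∀ x, T x ω ∈ Ω₀ := by
    intro ω hω x y z hz
    have : T y (T x ω) = T (y + x) ω := by rw [hTa]; rfl
    rw [this]; exact hω _ z hz
  have hlog : ∀ ω ∈ Ω₀, ∀ x ∈ Gp R, 0 < (Kt T V p R ω 0 x).toReal := by
    intro ω hω x hx
    exact ENNReal.toReal_pos (Kt_pos hT0 hTa hp hp1 hω hx).ne'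
      (ne_top_of_le_ne_top ENNReal.ofReal_ne_top (Kt_bound hp hp1 hω 0 x))
  let F : Zd d → Ω → ℝ := fun x ω => if ω ∈ Ω₀ then aFun T V p R ω 0 x + v (toR x) else 0
  have hnn : ∀ x ∈ Gp R, ∀ ω, 0 ≤ F x ω := by
    intro x hx ω
    by_cases hω : ω ∈ Ω₀
    · simp only [F, hω, if_true]
      rw [aFun_eq]
      have h1 := Kt_bound hp hp1 hω 0 x
      have h2 := ENNReal.toReal_le_of_le_ofReal (Real.exp_pos _).le h1
      have h3 := (Real.log_le_iff_le_exp (hlog ω hω x hx)).2 h2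
      rw [sub_zero] at h3
      linarith
    · simp [F, hω]
  refine ⟨v, F, ∑ z ∈ R, (|Real.log (p z)| + |v (toR z)|), ⟨?_, hnn, ?_, ?_, ?_, ?_⟩, ?_⟩
  · intro x
    refine Measurable.ite hΩm ?_ measurable_const
    simp_rw [aFun_eq]
    exact (((Kt_meas hTm hVm 0 x).ennreal_toReal.log).neg).add_const _
  · intro ω
    simp [F, aFun, toR_zero]
  · intro x hx y hy ω
    by_cases hω : ω ∈ Ω₀
    · simp only [F, hω, hΩT ω hω x, if_true]
      rw [aFun_eq, aFun_eq, aFun_eq, toR_add, map_add]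
      have h1 := Kt_mul hp hp1 hω 0 x (x+y)
      rw [Kt_shift hTa] at h1
      have h2 := ENNReal.toReal_mono
        (ne_top_of_le_ne_top ENNReal.ofReal_ne_top (Kt_bound hp hp1 hω 0 (x+y))) h1
      rw [ENNReal.toReal_mul] at h2
      have hx' := hlog ω hω x hx
      have hy' := hlog _ (hΩT ω hω x) y hy
      have h3 := Real.log_le_log (mul_pos hx' hy') h2
      rw [Real.log_mul hx'.ne' hy'.ne'] at h3
      linarith
    · have := hnn y hy (T x ω)
      simp only [F, hω, if_false] at this ⊢
      linarith
  · intro z hz ω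
    have hκ : |Real.log (p z)| + |v (toR z)| ≤ ∑ z ∈ R, (|Real.log (p z)| + |v (toR z)|) :=
      Finset.single_le_sum (f := fun z => |Real.log (p z)| + |v (toR z)|) (fun _ _ => by positivity) hz
    by_cases hω : ω ∈ Ω₀
    · simp only [F, hω, if_true]
      by_cases hz0 : z = 0
      · subst hz0
        rw [toR_zero] at hκ ⊢
        simp only [aFun, if_true, map_zero, add_zero]
        have : 0 ≤ |Real.log (p 0)| + |v 0| := by positivity
        linarith [le_max_right (V ω 0) 0]
      · rw [aFun_eq]
        have h1 := Kt_single (T := T) (V := V) (p := p) (R := R) (ω := ω) hT0 z hz hz0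
        have h2 := ENNReal.toReal_mono
          (ne_top_of_le_ne_top ENNReal.ofReal_ne_top (Kt_bound hp hp1 hω 0 z)) h1
        have hpe : 0 < p z * Real.exp (-(V ω z)) := mul_pos (hp z hz) (Real.exp_pos _)
        rw [ENNReal.toReal_ofReal hpe.le] at h2
        have h3 := Real.log_le_log hpe h2
        rw [Real.log_mul (hp z hz).ne' (Real.exp_pos _).ne', Real.log_exp] at h3
        linarith [le_max_left (V ω z) 0, neg_le_abs (Real.log (p z)), le_abs_self (v (toR z))]
    · simp only [F, hω, if_false]
      have : 0 ≤ |Real.log (p z)| + |v (toR z)| := by positivity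
      linarith [le_max_right (V ω z) 0]
  · exact Finset.sum_nonneg fun _ _ => by positivity
  · filter_upwards [hΩae] with ω hω x
    simp [F, hω]

end Fdef
end RWRP

namespace RWRP
set_option linter.unusedSectionVars false
set_option linter.unusedVariables false

section prob
variable {d : ℕ} {Ω : Type*} [MeasurableSpace Ω]

/-- abstract subadditive environment -/
structure Env (ℙ : Measure Ω) (T : Zd d → Ω → Ω) (R' : Finset (Zd d)) (F : Zd d → Ω → ℝ) : Prop where
  T0 : T 0 = id
  Tadd : ∀ x y, T (x + y) = T x ∘ T y
  Tmp : ∀ z, MeasurePreserving (T z) ℙ ℙ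
  meas : ∀ x, Measurable (F x)
  nonneg : ∀ x ∈ Gp R', ∀ ω, 0 ≤ F x ω
  zero : ∀ ω, F 0 ω = 0
  sub : ∀ x ∈ Gp R', ∀ y ∈ Gp R', ∀ ω, F (x + y) ω ≤ F x ω + F y (T x ω)
  int : ∀ z ∈ R', Integrable (F z) ℙ

/-- interior lattice points -/
def So (R' : Finset (Zd d)) : Set (Zd d) :=
  {x | x ∈ Gp R' ∧ ∃ c : Zd d → ℝ, (∀ z, 0 < c z) ∧ toR x = lin R' c}

/-- limit along a ray -/
def phi (F : Zd d → Ω → ℝ) (y : Zd d) (ω : Ω) : ℝ := (kLim (fun n => F (n • y)) ω).toReal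

variable {ℙ : Measure Ω} [IsProbabilityMeasure ℙ] {T : Zd d → Ω → Ω} {R' : Finset (Zd d)}
  {F : Zd d → Ω → ℝ}

lemma So_add {x y : Zd d} (hx : x ∈ So R') (hy : y ∈ Gp R') : x + y ∈ So R' := by
  obtain ⟨hx1, c, hc, hxc⟩ := hx
  have hy' := hy
  obtain ⟨b, rfl⟩ := hy
  refine ⟨Gp_add hx1 hy', fun z => c z + b z, fun z => add_pos_of_pos_of_nonneg (hc z) (Nat.cast_nonneg _), ?_⟩
  rw [toR_add, toR_nsum, hxc, lin_add]

lemma So_nsmul {x : Zd d} (hx : x ∈ So R') {n : ℕ} (hn : 0 < n) : n • x ∈ So R' := by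
  obtain ⟨hx1, c, hc, hxc⟩ := hx
  refine ⟨Gp_nsmul hx1 n, fun z => n * c z, fun z => mul_pos (by exact_mod_cast hn) (hc z), ?_⟩
  rw [toR_nsmul, hxc, lin_smul]

lemma Gp_sub_GZ : Gp R' ⊆ GZ R' := by
  rintro x ⟨b, rfl⟩
  exact ⟨fun z => b z, by simp⟩

lemma GZ_add {x y : Zd d} (hx : x ∈ GZ R') (hy : y ∈ GZ R') : x + y ∈ GZ R' := by
  obtain ⟨b, rfl⟩ := hx
  obtain ⟨c, rfl⟩ := hy
  exact ⟨fun z => b z + c z, by simp [add_smul, Finset.sum_add_distrib]⟩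

lemma GZ_neg {x : Zd d} (hx : x ∈ GZ R') : -x ∈ GZ R' := by
  obtain ⟨b, rfl⟩ := hx
  exact ⟨fun z => - b z, by simp⟩

lemma GZ_sub {x y : Zd d} (hx : x ∈ GZ R') (hy : y ∈ GZ R') : x - y ∈ GZ R' := by
  rw [sub_eq_add_neg]; exact GZ_add hx (GZ_neg hy)

lemma zsum_Gp {b : Zd d → ℤ} (hb : ∀ z ∈ R', 0 ≤ b z) :
    (∑ z ∈ R', b z • z) = ∑ z ∈ R', (b z).toNat • z := by
  refine Finset.sum_congr rfl fun z hz => ?_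
  conv_lhs => rw [← Int.toNat_of_nonneg (hb z hz)]
  rw [natCast_zsmul]

lemma phi_meas (hE : Env ℙ T R' F) (y : Zd d) : Measurable (phi F y) :=
  (kLim_meas fun n => hE.meas _).ennreal_toReal

lemma T_iter (hE : Env ℙ T R' F) (y : Zd d) (n : ℕ) : (T y)^[n] = T (n • y) := by
  induction n with
  | zero => simp [hE.T0]
  | succ n ih => rw [Function.iterate_succ, ih, add_smul, one_smul, hE.Tadd]

lemma T_comp (hE : Env ℙ T R' F) (x y : Zd d) (ω : Ω) : T x (T y ω) = T (x + y) ω := by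
  rw [hE.Tadd]; rfl

lemma T_inv_set (hE : Env ℙ T R' F) {B : Set Ω} (hB : ∀ z ∈ R', T z ⁻¹' B = B) {x : Zd d} (hx : x ∈ Gp R') :
    T x ⁻¹' B = B := by
  have h1 : ∀ (n : ℕ) z, z ∈ R' → T (n • z) ⁻¹' B = B := by
    intro n z hz
    induction n with
    | zero => simp [hE.T0]
    | succ n ih => rw [add_smul, one_smul, hE.Tadd, preimage_comp, ih, hB z hz]
  obtain ⟨b, rfl⟩ := hx
  have : ∀ J : Finset (Zd d), J ⊆ R' → T (∑ z ∈ J, b z • z) ⁻¹' B = B := by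
    intro J
    induction J using Finset.induction_on with
    | empty => intro _; simp [hE.T0]
    | insert a s ha ih =>
      intro h
      rw [Finset.sum_insert ha, hE.Tadd, preimage_comp, h1 _ _ (h (Finset.mem_insert_self _ _))]
      exact ih (fun z hz => h (Finset.mem_insert_of_mem hz))
  exact this R' subset_rfl

/-- integral over an invariant set -/
def GB (ℙ : Measure Ω) (F : Zd d → Ω → ℝ) (B : Set Ω) (x : Zd d) : ℝ≥0∞ := ∫⁻ ω in B, ENNReal.ofReal (F x ω) ∂ℙ

lemma GB_add (hE : Env ℙ T R' F) {B : Set Ω} (hBm : MeasurableSet B) (hB : ∀ z ∈ R', T z ⁻¹' B = B)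
    {x y : Zd d} (hx : x ∈ Gp R') (hy : y ∈ Gp R') : GB ℙ F B (x + y) ≤ GB ℙ F B x + GB ℙ F B y := by
  unfold GB
  have h1 := (hE.Tmp x).setLIntegral_comp_preimage hBm (hE.meas y).ennreal_ofReal
  rw [T_inv_set hE hB hx] at h1
  rw [← h1, ← lintegral_add_left (hE.meas x).ennreal_ofReal]
  refine lintegral_mono fun ω => ?_
  dsimp only
  rw [← ENNReal.ofReal_add (hE.nonneg x hx _) (hE.nonneg y hy _)]
  exact ENNReal.ofReal_le_ofReal (hE.sub x hx y hy ω)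

lemma GB_sum (hE : Env ℙ T R' F) {B : Set Ω} (hBm : MeasurableSet B) (hB : ∀ z ∈ R', T z ⁻¹' B = B)
    (b : Zd d → ℕ) : GB ℙ F B (∑ z ∈ R', b z • z) ≤ ∑ z ∈ R', b z * GB ℙ F B z := by
  have h0 : GB ℙ F B 0 = 0 := by simp [GB, hE.zero]
  have h1 : ∀ (n : ℕ) z, z ∈ R' → GB ℙ F B (n • z) ≤ n * GB ℙ F B z := by
    intro n z hz
    induction n with
    | zero => simp [h0]
    | succ n ih =>
      rw [add_smul, one_smul]
      refine (GB_add hE hBm hB (Gp_nsmul (Gp_single hz) n) (Gp_single hz)).trans ?_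
      rw [Nat.cast_add, add_mul, Nat.cast_one, one_mul]
      gcongr
  have : ∀ J : Finset (Zd d), J ⊆ R' → (∑ z ∈ J, b z • z) ∈ Gp R' ∧
      GB ℙ F B (∑ z ∈ J, b z • z) ≤ ∑ z ∈ J, b z * GB ℙ F B z := by
    intro J
    induction J using Finset.induction_on with
    | empty => intro _; simp [h0, Gp_zero]
    | insert a s ha ih =>
      intro h
      have hi := ih (fun z hz => h (Finset.mem_insert_of_mem hz))
      have haR := h (Finset.mem_insert_self _ _)
      rw [Finset.sum_insert ha, Finset.sum_insert ha]
      refine ⟨Gp_add (Gp_nsmul (Gp_single haR) _) hi.1, ?_⟩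
      refine (GB_add hE hBm hB (Gp_nsmul (Gp_single haR) _) hi.1).trans ?_
      exact add_le_add (h1 _ _ haR) hi.2
  exact (this R' subset_rfl).2

lemma GB_single_fin (hE : Env ℙ T R' F) (B : Set Ω) {z : Zd d} (hz : z ∈ R') : GB ℙ F B z < ∞ :=
  lt_of_le_of_lt (lintegral_mono fun ω => by
    dsimp only; rw [Real.enorm_eq_ofReal (hE.nonneg z (Gp_single hz) ω)]) (hE.int z hz).integrableOn.2

lemma F_int (hE : Env ℙ T R' F) {y : Zd d} (hy : y ∈ Gp R') : Integrable (F y) ℙ := by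
  refine ⟨(hE.meas y).aestronglyMeasurable, ?_⟩
  have hy' := hy
  obtain ⟨b, rfl⟩ := hy'
  have h := GB_sum hE (B := univ) MeasurableSet.univ (fun _ _ => rfl) b
  refine lt_of_le_of_lt (lintegral_mono (g := fun ω => ENNReal.ofReal (F (∑ z ∈ R', b z • z) ω)) fun ω => by
    rw [Real.enorm_eq_ofReal (hE.nonneg _ hy ω)]) ?_
  unfold GB at h
  rw [Measure.restrict_univ] at h
  refine h.trans_lt (ENNReal.sum_lt_top.2 fun z hz => ENNReal.mul_lt_top (by simp) ?_)
  have := GB_single_fin hE univ hz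
  simpa [GB] using this

lemma hsub_ray (hE : Env ℙ T R' F) {y : Zd d} (hy : y ∈ Gp R') : ∀ n m ω,
    F ((n+m) • y) ω ≤ F (n • y) ω + F (m • y) ((T y)^[n] ω) := by
  intro n m ω
  rw [add_smul, T_iter hE]
  exact hE.sub _ (Gp_nsmul hy n) _ (Gp_nsmul hy m) ω

lemma phi_tendsto (hE : Env ℙ T R' F) {y : Zd d} (hy : y ∈ Gp R') :
    ∀ᵐ ω ∂ℙ, Tendsto (fun n : ℕ => F (n • y) ω / n) atTop (𝓝 (phi F y ω)) :=
  kingman (hE.Tmp y) (fun n => hE.meas _) (fun ω => by simp [hE.zero])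
    (fun n ω => hE.nonneg _ (Gp_nsmul hy n) ω) (by simpa using F_int hE hy) (hsub_ray hE hy)

lemma phi_fin (hE : Env ℙ T R' F) {y : Zd d} (hy : y ∈ Gp R') : ∫⁻ ω, ENNReal.ofReal (phi F y ω) ∂ℙ ≠ ∞ := by
  refine ne_top_of_le_ne_top (lint_kLim (hE.Tmp y) (f := fun n => F (n • y)) (fun n => hE.meas _) (fun ω => by simp [hE.zero])
    (fun n ω => hE.nonneg _ (Gp_nsmul hy n) ω) (by simpa using F_int hE hy) (hsub_ray hE hy)) ?_
  exact lintegral_mono fun ω => ENNReal.ofReal_toReal_le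

lemma phi_nonneg (y : Zd d) (ω : Ω) : 0 ≤ phi F y ω := ENNReal.toReal_nonneg

lemma im_shift {g : ℕ → Ω → ℝ} (hg : ∀ n, Measurable (g n)) {S : ℕ → Ω → Ω}
    (hS : ∀ n, MeasurePreserving (S n) ℙ ℙ) (h : ∀ᵐ ω ∂ℙ, Tendsto (fun n => g n ω) atTop (𝓝 0)) :
    ∃ ns : ℕ → ℕ, StrictMono ns ∧ ∀ᵐ ω ∂ℙ, Tendsto (fun i => g (ns i) (S (ns i) ω)) atTop (𝓝 0) := by
  have h1 : TendstoInMeasure ℙ g atTop (fun _ => 0) :=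
    tendstoInMeasure_of_tendsto_ae (fun n => (hg n).aestronglyMeasurable) h
  have h2 : TendstoInMeasure ℙ (fun n ω => g n (S n ω)) atTop (fun _ => 0) := by
    intro ε hε
    refine (h1 ε hε).congr fun n => ?_
    have hm : MeasurableSet {x | ε ≤ edist (g n x) 0} :=
      measurableSet_le measurable_const ((hg n).edist measurable_const)
    exact ((hS n).measure_preimage hm.nullMeasurableSet).symm
  exact h2.exists_seq_tendsto_ae

lemma le_of_im {g : ℕ → Ω → ℝ} (hg : ∀ n, Measurable (g n)) {S : ℕ → Ω → Ω}
    (hS : ∀ n, MeasurePreserving (S n) ℙ ℙ) (h : ∀ᵐ ω ∂ℙ, Tendsto (fun n => g n ω) atTop (𝓝 0))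
    {a b : ℕ → Ω → ℝ} {a' b' : Ω → ℝ} (ha : ∀ᵐ ω ∂ℙ, Tendsto (fun n => a n ω) atTop (𝓝 (a' ω)))
    (hb : ∀ᵐ ω ∂ℙ, Tendsto (fun n => b n ω) atTop (𝓝 (b' ω)))
    (hle : ∀ᵐ ω ∂ℙ, ∀ᶠ n in atTop, a n ω ≤ b n ω + g n (S n ω)) : ∀ᵐ ω ∂ℙ, a' ω ≤ b' ω := by
  obtain ⟨ns, hns, h'⟩ := im_shift hg hS h
  filter_upwards [h', ha, hb, hle] with ω h1 h2 h3 h4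
  have h5 := (h3.comp hns.tendsto_atTop).add h1
  rw [add_zero] at h5
  exact le_of_tendsto_of_tendsto (h2.comp hns.tendsto_atTop) h5 (hns.tendsto_atTop.eventually h4)

lemma tendsto_div_shift {u : ℕ → ℝ} {l : ℝ} (h : Tendsto (fun n : ℕ => u n / n) atTop (𝓝 l)) (m : ℕ) :
    Tendsto (fun n : ℕ => u (n + m) / n) atTop (𝓝 l) := by
  have h1 := (tendsto_add_atTop_iff_nat (f := fun n : ℕ => u n / n) m).2 h
  have h2 : Tendsto (fun n : ℕ => ((n + m : ℕ) : ℝ) / n) atTop (𝓝 1) := by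
    have h3 : Tendsto (fun n : ℕ => 1 + (m : ℝ) / n) atTop (𝓝 (1 + 0)) :=
      tendsto_const_nhds.add (tendsto_const_div_atTop_nhds_zero_nat _)
    rw [add_zero] at h3
    refine h3.congr' ?_
    filter_upwards [eventually_gt_atTop 0] with n hn
    have : (n : ℝ) ≠ 0 := by exact_mod_cast hn.ne'
    push_cast; field_simp
  have h4 := h1.mul h2
  rw [mul_one] at h4
  refine h4.congr' ?_
  filter_upwards [eventually_gt_atTop 0] with n hn
  have : (n : ℝ) ≠ 0 := by exact_mod_cast hn.ne'
  have : ((n + m : ℕ) : ℝ) ≠ 0 := by positivity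
  field_simp

/-- large multiples of interior points dominate -/
lemma So_dom {y x : Zd d} (hy : y ∈ So R') (hx : x ∈ GZ R') : ∃ m : ℕ, m • y - x ∈ Gp R' := by
  obtain ⟨E, hE0, hE⟩ := int_rep R'
  obtain ⟨hy1, c, hc, hyc⟩ := hy
  obtain ⟨e, he⟩ := hx
  obtain ⟨m, hm⟩ : ∃ m : ℕ, ∀ z ∈ R', E + e z ≤ m * c z := by
    have : ∀ᶠ m : ℕ in atTop, ∀ z ∈ R', E + e z ≤ m * c z := by
      rw [Finset.eventually_all]
      intro z _
      exact (tendsto_natCast_atTop_atTop.atTop_mul_const (hc z)).eventually_ge_atTop _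
    exact this.exists
  have hG : m • y - x ∈ GZ R' := GZ_sub (Gp_sub_GZ (Gp_nsmul hy1 m)) ⟨e, he⟩
  obtain ⟨b, hb, hbb⟩ := hE _ hG (fun z => m * c z - e z) (by
    rw [toR_sub, toR_nsmul, hyc, he, toR_zsum, lin_sub R' (fun z => (m:ℝ) * c z) (fun z => (e z : ℝ)), lin_smul])
  have hb0 : ∀ z ∈ R', 0 ≤ b z := by
    intro z hz
    have h1 := (abs_le.1 (hbb z hz)).1
    have h2 := hm z hz
    have : (0:ℝ) ≤ b z := by linarith
    exact_mod_cast this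
  exact ⟨m, fun z => (b z).toNat, by rw [hb, zsum_Gp hb0]⟩

lemma phi_inv (hE : Env ℙ T R' F) {y x : Zd d} (hy : y ∈ So R') (hx : x ∈ R') :
    ∀ᵐ ω ∂ℙ, phi F y (T x ω) = phi F y ω := by
  obtain ⟨m, hw⟩ := So_dom hy (Gp_sub_GZ (Gp_single hx))
  set w := m • y - x with hwdef
  have hle : ∀ᵐ ω ∂ℙ, phi F y ω ≤ phi F y (T x ω) := by
    refine le_of_im (g := fun n ω => F w ω / n) (S := fun n => T (n • y + x))
      (a := fun n ω => F ((n + m) • y) ω / n) (b := fun n ω => F x ω / n + F (n • y) (T x ω) / n)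
      (fun n => (hE.meas w).div_const _) (fun n => hE.Tmp _)
      (Eventually.of_forall fun ω => tendsto_const_div_atTop_nhds_zero_nat _) ?_ ?_ ?_
    · filter_upwards [phi_tendsto hE hy.1] with ω h
      exact tendsto_div_shift (u := fun n => F (n • y) ω) h m
    · filter_upwards [(hE.Tmp x).quasiMeasurePreserving.ae (phi_tendsto hE hy.1)] with ω h
      simpa using (tendsto_const_div_atTop_nhds_zero_nat (F x ω)).add h
    · refine Eventually.of_forall fun ω => ?_
      filter_upwards with n
      have h1 := hE.sub _ (Gp_add (Gp_single hx) (Gp_nsmul hy.1 n)) _ hw ω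
      have h2 := hE.sub _ (Gp_single hx) _ (Gp_nsmul hy.1 n) ω
      have h3 : x + n • y + w = (n + m) • y := by rw [hwdef, add_smul]; abel
      rw [h3, add_comm x (n • y)] at h1
      rw [add_comm x (n • y)] at h2
      rw [← add_div, ← add_div]
      gcongr
      linarith
  have h2 := ae_eq_comp_of_le (hE.Tmp x) (phi_meas hE y).ennreal_ofReal (phi_fin hE hy.1)
    (hle.mono fun ω h => ENNReal.ofReal_le_ofReal h)
  filter_upwards [h2] with ω h
  exact (ENNReal.ofReal_eq_ofReal_iff (phi_nonneg _ _) (phi_nonneg _ _)).1 h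

lemma phi_inv_all (hE : Env ℙ T R' F) :
    ∀ᵐ ω ∂ℙ, ∀ g ∈ GZ R', ∀ y ∈ So R', phi F y (T g ω) = phi F y ω := by
  have h0 : ∀ᵐ ω ∂ℙ, ∀ z y u : Zd d, z ∈ R' → y ∈ So R' → phi F y (T z (T u ω)) = phi F y (T u ω) := by
    rw [ae_all_iff]; intro z
    rw [ae_all_iff]; intro y
    rw [ae_all_iff]; intro u
    by_cases hz : z ∈ R' <;> by_cases hy : y ∈ So R'
    · filter_upwards [(hE.Tmp u).quasiMeasurePreserving.ae (phi_inv hE hy hz)] with ω h _ _ using h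
    all_goals simp [hz, hy]
  filter_upwards [h0] with ω h g hg y hy
  have h1 : ∀ (n : ℕ) z u, z ∈ R' → phi F y (T (n • z + u) ω) = phi F y (T u ω) := by
    intro n z u hz
    induction n with
    | zero => simp
    | succ n ih =>
      rw [← ih, ← h z y (n • z + u) hz hy, T_comp hE, add_smul, one_smul]
      congr 2; abel_nf
  have h2 : ∀ (n : ℤ) z u, z ∈ R' → phi F y (T (n • z + u) ω) = phi F y (T u ω) := by
    intro n z u hz
    obtain ⟨k, rfl | rfl⟩ := n.eq_nat_or_neg
    · rw [natCast_zsmul]; exact h1 k z u hz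
    · rw [neg_smul, natCast_zsmul, ← h1 k z (-(k • z) + u) hz]
      congr 2; abel_nf
  obtain ⟨b, rfl⟩ := hg
  have : ∀ J : Finset (Zd d), J ⊆ R' → phi F y (T (∑ z ∈ J, b z • z) ω) = phi F y ω := by
    intro J
    induction J using Finset.induction_on with
    | empty => intro _; simp [hE.T0]
    | insert a s ha ih =>
      intro hJ
      rw [Finset.sum_insert ha, h2 _ _ _ (hJ (Finset.mem_insert_self _ _))]
      exact ih (fun z hz => hJ (Finset.mem_insert_of_mem hz))
  exact this R' subset_rfl

lemma phi_sub (hE : Env ℙ T R' F) {x y : Zd d} (hx : x ∈ So R') (hy : y ∈ So R') :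
    ∀ᵐ ω ∂ℙ, phi F (x + y) ω ≤ phi F x ω + phi F y ω := by
  refine le_of_im (g := fun n ω => F (n • y) ω / n - phi F y ω) (S := fun n => T (n • x))
    (a := fun n ω => F (n • (x + y)) ω / n) (b := fun n ω => F (n • x) ω / n + phi F y ω)
    (fun n => ((hE.meas _).div_const _).sub (phi_meas hE y)) (fun n => hE.Tmp _) ?_ ?_ ?_ ?_
  · filter_upwards [phi_tendsto hE hy.1] with ω h
    simpa using h.sub_const (phi F y ω)
  · exact phi_tendsto hE (Gp_add hx.1 hy.1)
  · filter_upwards [phi_tendsto hE hx.1] with ω h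
    exact h.add_const _
  · filter_upwards [phi_inv_all hE] with ω h
    filter_upwards with n
    rw [h (n • x) (Gp_sub_GZ (Gp_nsmul hx.1 n)) y hy, smul_add]
    have h1 := hE.sub _ (Gp_nsmul hx.1 n) _ (Gp_nsmul hy.1 n) ω
    have h2 : F (n • x + n • y) ω / n ≤ (F (n • x) ω + F (n • y) (T (n • x) ω)) / n := by gcongr
    rw [add_div] at h2
    linarith

end prob
end RWRP

namespace RWRP
set_option linter.unusedSectionVars false
set_option linter.unusedVariables false

section prob2
variable {d : ℕ} {Ω : Type*} [m0 : MeasurableSpace Ω]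
variable {ℙ : Measure Ω} [IsProbabilityMeasure ℙ] {T : Zd d → Ω → Ω} {R' : Finset (Zd d)}
  {F : Zd d → Ω → ℝ}

/-- deterministic facts for a fixed realization -/
structure Det (R' : Finset (Zd d)) (f ϕ : Zd d → ℝ) (h : ℝ) : Prop where
  h0 : 0 ≤ h
  nn : ∀ y, 0 ≤ ϕ y
  lim : ∀ y ∈ So R', Tendsto (fun n : ℕ => f (n • y) / n) atTop (𝓝 (ϕ y))
  sub : ∀ x ∈ So R', ∀ y ∈ So R', ϕ (x + y) ≤ ϕ x + ϕ y
  bd : ∀ y ∈ So R', ∀ b : Zd d → ℕ, y = ∑ z ∈ R', b z • z → ϕ y ≤ h * ∑ z ∈ R', (b z : ℝ)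

lemma inv_le (T : Zd d → Ω → Ω) (S : Set (Zd d)) : invSigma T S ≤ m0 := fun _ h => h.1

lemma inv_meas {S : Set (Zd d)} {g : Ω → ℝ} (hg : Measurable g) (hi : ∀ z ∈ S, ∀ ω, g (T z ω) = g ω) :
    Measurable[invSigma T S] g := by
  intro s hs
  refine ⟨hg hs, fun z hz => ?_⟩
  ext ω
  simp [hi z hz ω]

/-- the set where everything is invariant -/
def Dset (T : Zd d → Ω → Ω) (R' : Finset (Zd d)) (F : Zd d → Ω → ℝ) : Set Ω :=
  {ω | ∀ g ∈ GZ R', ∀ y ∈ So R', phi F y (T g ω) = phi F y ω}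

lemma Dset_meas (hE : Env ℙ T R' F) : MeasurableSet (Dset T R' F) := by
  have : Dset T R' F = ⋂ g : Zd d, ⋂ y : Zd d, {ω | g ∈ GZ R' → y ∈ So R' → phi F y (T g ω) = phi F y ω} := by
    ext ω; simp only [Dset, mem_ofPred_eq, mem_iInter]
    exact ⟨fun h g y hg hy => h g hg y hy, fun h g hg y hy => h g y hg hy⟩
  rw [this]
  refine MeasurableSet.iInter fun g => MeasurableSet.iInter fun y => ?_
  by_cases hg : g ∈ GZ R' <;> by_cases hy : y ∈ So R'
  · simp only [hg, hy, true_imp_iff]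
    exact measurableSet_eq_fun ((phi_meas hE y).comp (hE.Tmp g).measurable) (phi_meas hE y)
  all_goals simp [hg, hy]

lemma Dset_fwd (hE : Env ℙ T R' F) {ω : Ω} (h : ω ∈ Dset T R' F) {g : Zd d} (hg : g ∈ GZ R') :
    T g ω ∈ Dset T R' F := by
  intro k hk y hy
  rw [T_comp hE, h _ (GZ_add hk hg) y hy, h _ hg y hy]

/-- strictly invariant version -/
def phiI (T : Zd d → Ω → Ω) (R' : Finset (Zd d)) (F : Zd d → Ω → ℝ) (y : Zd d) (ω : Ω) : ℝ :=
  if y ∈ So R' then (Dset T R' F).indicator (phi F y) ω else 0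

lemma phiI_meas (hE : Env ℙ T R' F) (y : Zd d) : Measurable[invSigma T (R' : Set (Zd d))] (phiI T R' F y) := by
  unfold phiI
  split_ifs with hy
  · refine inv_meas ((phi_meas hE y).indicator (Dset_meas hE)) ?_
    intro z hz ω
    have hzG : z ∈ GZ R' := Gp_sub_GZ (Gp_single hz)
    by_cases hω : ω ∈ Dset T R' F
    · rw [indicator_of_mem hω, indicator_of_mem (Dset_fwd hE hω hzG), hω z hzG y hy]
    · have : T z ω ∉ Dset T R' F := by
        intro h
        have h2 := Dset_fwd hE h (GZ_neg hzG)
        rw [T_comp hE, neg_add_cancel, hE.T0] at h2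
        exact hω h2
      rw [indicator_of_notMem hω, indicator_of_notMem this]
  · exact measurable_const

lemma phi_bound (hE : Env ℙ T R' F) {y : Zd d} (hy : y ∈ So R') {b : Zd d → ℕ} (hb : y = ∑ z ∈ R', b z • z) :
    ∀ᵐ ω ∂ℙ, phiI T R' F y ω ≤
      (ℙ[fun ω => ∑ z ∈ R', F z ω | invSigma T (R' : Set (Zd d))]) ω * ∑ z ∈ R', (b z : ℝ) := by
  set g : Ω → ℝ := fun ω => ∑ z ∈ R', F z ω with hg
  set h := ℙ[g | invSigma T (R' : Set (Zd d))] with hh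
  set K : ℝ := ∑ z ∈ R', (b z : ℝ) with hK
  have hIle : (invSigma T (R' : Set (Zd d))) ≤ m0 := inv_le T _
  have hgi : Integrable g ℙ := integrable_finsetSum _ fun z hz => hE.int z hz
  have hhm : Measurable[invSigma T (R' : Set (Zd d))] h := stronglyMeasurable_condExp.measurable
  have hpm := phiI_meas hE y
  have hpp : ∀ ω, 0 ≤ phiI T R' F y ω := by
    intro ω; unfold phiI; split_ifs
    · exact indicator_nonneg (fun _ _ => phi_nonneg _ _) _
  have hple : ∀ ω, phiI T R' F y ω ≤ phi F y ω := by
    intro ω; unfold phiI; split_ifs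
    · exact indicator_le_self' (fun _ _ => phi_nonneg _ _) _
  have hpi : Integrable (phiI T R' F y) ℙ := by
    refine ⟨(hpm.mono hIle le_rfl).aestronglyMeasurable, ?_⟩
    refine lt_of_le_of_lt (lintegral_mono fun ω => ?_) (phi_fin hE hy.1).lt_top
    rw [Real.enorm_eq_ofReal (hpp ω)]
    exact ENNReal.ofReal_le_ofReal (hple ω)
  set B : Set Ω := {ω | h ω * K < phiI T R' F y ω} with hB
  have hBI : MeasurableSet[invSigma T (R' : Set (Zd d))] B := measurableSet_lt (hhm.mul_const K) hpm
  have hBm : MeasurableSet B := hBI.1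
  have hBinv : ∀ z ∈ R', T z ⁻¹' B = B := hBI.2
  -- upper bound on integral over B
  have h1 : ∫⁻ ω in B, ENNReal.ofReal (phiI T R' F y ω) ∂ℙ ≤ ∑ z ∈ R', b z * GB ℙ F B z := by
    calc _ ≤ ∫⁻ ω in B, kLim (fun n => F (n • y)) ω ∂ℙ := by
          refine lintegral_mono fun ω => ?_
          exact (ENNReal.ofReal_le_ofReal (hple ω)).trans ENNReal.ofReal_toReal_le
      _ ≤ liminf (fun n : ℕ => ∫⁻ ω in B, ENNReal.ofReal (F (n • y) ω / n) ∂ℙ) atTop :=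
          lintegral_liminf_le fun n => ((hE.meas _).div_const _).ennreal_ofReal
      _ ≤ _ := by
          refine liminf_le_of_le (by isBoundedDefault) fun c hc => ?_
          obtain ⟨n, hn1, hn⟩ := (hc.and (eventually_gt_atTop 0)).exists
          refine hn1.trans ?_
          have h2 := GB_sum hE hBm hBinv (fun z => n * b z)
          have h3 : ∑ z ∈ R', (n * b z) • z = n • y := by
            rw [hb, Finset.smul_sum]; exact Finset.sum_congr rfl fun z _ => by rw [mul_smul]
          rw [h3] at h2
          have h4 : ∑ z ∈ R', ((n * b z : ℕ) : ℝ≥0∞) * GB ℙ F B z = n * ∑ z ∈ R', b z * GB ℙ F B z := by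
            rw [Finset.mul_sum]; exact Finset.sum_congr rfl fun z _ => by push_cast; ring
          rw [h4] at h2
          have hn0 : (n : ℝ≥0∞) ≠ 0 := by exact_mod_cast hn.ne'
          have h5 : ∫⁻ ω in B, ENNReal.ofReal (F (n • y) ω / n) ∂ℙ = GB ℙ F B (n • y) / n := by
            unfold GB
            rw [div_eq_mul_inv, ← lintegral_mul_const _ (hE.meas _).ennreal_ofReal]
            refine lintegral_congr fun ω => ?_
            rw [div_eq_mul_inv, ENNReal.ofReal_mul (hE.nonneg _ (Gp_nsmul hy.1 n) ω),
              ENNReal.ofReal_inv_of_pos (by exact_mod_cast hn), ENNReal.ofReal_natCast]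
          rw [h5]
          refine ENNReal.div_le_of_le_mul ?_
          rwa [mul_comm]
  have h2 : ∫ ω in B, phiI T R' F y ω ∂ℙ ≤ K * ∫ ω in B, g ω ∂ℙ := by
    have e1 : ∫ ω in B, phiI T R' F y ω ∂ℙ = (∫⁻ ω in B, ENNReal.ofReal (phiI T R' F y ω) ∂ℙ).toReal :=
      integral_eq_lintegral_of_nonneg_ae (Eventually.of_forall hpp) hpi.aestronglyMeasurable.restrict
    have e2 : ∀ z ∈ R', (GB ℙ F B z).toReal = ∫ ω in B, F z ω ∂ℙ := fun z hz =>
      (integral_eq_lintegral_of_nonneg_ae (Eventually.of_forall (hE.nonneg z (Gp_single hz)))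
        (hE.meas z).aestronglyMeasurable.restrict).symm
    have e3 : ∫ ω in B, g ω ∂ℙ = ∑ z ∈ R', ∫ ω in B, F z ω ∂ℙ :=
      integral_finsetSum _ fun z hz => (hE.int z hz).integrableOn
    have hfin : ∀ z ∈ R', (b z : ℝ≥0∞) * GB ℙ F B z ≠ ∞ := fun z hz =>
      ENNReal.mul_ne_top (by simp) (GB_single_fin hE B hz).ne
    rw [e1, e3]
    refine (ENNReal.toReal_mono ?_ h1).trans ?_
    · exact (ENNReal.sum_lt_top.2 fun z hz => (hfin z hz).lt_top).ne
    · rw [ENNReal.toReal_sum hfin, Finset.mul_sum]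
      refine Finset.sum_le_sum fun z hz => ?_
      rw [ENNReal.toReal_mul, ENNReal.toReal_natCast, e2 z hz]
      refine mul_le_mul_of_nonneg_right ?_ (integral_nonneg fun ω => hE.nonneg z (Gp_single hz) ω)
      exact Finset.single_le_sum (f := fun z => (b z : ℝ)) (fun _ _ => Nat.cast_nonneg _) hz
  have h3 : ∫ ω in B, h ω ∂ℙ = ∫ ω in B, g ω ∂ℙ := setIntegral_condExp hIle hgi hBI
  have hhi : Integrable h ℙ := integrable_condExp
  have h4 : ∫ ω in B, (phiI T R' F y ω - h ω * K) ∂ℙ ≤ 0 := by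
    rw [integral_sub hpi.integrableOn (hhi.mul_const K).integrableOn, integral_mul_const, h3]
    linarith
  have h5 : 0 ≤ ∫ ω in B, (phiI T R' F y ω - h ω * K) ∂ℙ :=
    setIntegral_nonneg hBm fun ω hω => (sub_pos.2 hω).le
  have h6 := (setIntegral_eq_zero_iff_of_nonneg_ae (μ := ℙ) (s := B) (f := fun ω => phiI T R' F y ω - h ω * K)
    ((ae_restrict_iff' hBm).2 (Eventually.of_forall fun ω hω => (sub_pos.2 hω).le))
    (hpi.sub (hhi.mul_const K)).integrableOn).1 (le_antisymm h4 h5)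
  have h7 := (ae_restrict_iff' hBm).1 h6
  filter_upwards [h7] with ω hω
  by_contra hcon
  have hmem : ω ∈ B := not_le.1 hcon
  have := hω hmem
  have h8 : 0 < phiI T R' F y ω - h ω * K := sub_pos.2 hmem
  simp only [Pi.zero_apply] at this
  linarith

theorem phi_package (hE : Env ℙ T R' F) : ∃ (ϕ : Zd d → Ω → ℝ) (h : Ω → ℝ),
    (∀ y, Measurable[invSigma T (R' : Set (Zd d))] (ϕ y)) ∧ Measurable[invSigma T (R' : Set (Zd d))] h ∧
    Integrable h ℙ ∧ ∀ᵐ ω ∂ℙ, Det R' (fun x => F x ω) (fun x => ϕ x ω) (h ω) := by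
  refine ⟨phiI T R' F, ℙ[fun ω => ∑ z ∈ R', F z ω | invSigma T (R' : Set (Zd d))], phiI_meas hE,
    stronglyMeasurable_condExp.measurable, integrable_condExp, ?_⟩
  have hD : ∀ᵐ ω ∂ℙ, ω ∈ Dset T R' F := phi_inv_all hE
  have hlim : ∀ᵐ ω ∂ℙ, ∀ y, y ∈ So R' → Tendsto (fun n : ℕ => F (n • y) ω / n) atTop (𝓝 (phi F y ω)) := by
    rw [ae_all_iff]; intro y
    by_cases hy : y ∈ So R'
    · filter_upwards [phi_tendsto hE hy.1] with ω h _ using h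
    · simp [hy]
  have hsub : ∀ᵐ ω ∂ℙ, ∀ x y, x ∈ So R' → y ∈ So R' → phi F (x + y) ω ≤ phi F x ω + phi F y ω := by
    rw [ae_all_iff]; intro x
    rw [ae_all_iff]; intro y
    by_cases hx : x ∈ So R' <;> by_cases hy : y ∈ So R'
    · filter_upwards [phi_sub hE hx hy] with ω h _ _ using h
    all_goals simp [hx, hy]
  have hbd : ∀ᵐ ω ∂ℙ, ∀ y, y ∈ So R' → ∀ b : Zd d → ℕ, y = ∑ z ∈ R', b z • z → phiI T R' F y ω ≤
      (ℙ[fun ω => ∑ z ∈ R', F z ω | invSigma T (R' : Set (Zd d))]) ω * ∑ z ∈ R', (b z : ℝ) := by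
    rw [ae_all_iff]; intro y
    have : ∀ᵐ ω ∂ℙ, ∀ b : R' → ℕ, y ∈ So R' → y = ∑ z, b z • (z : Zd d) → phiI T R' F y ω ≤
      (ℙ[fun ω => ∑ z ∈ R', F z ω | invSigma T (R' : Set (Zd d))]) ω * ∑ z, (b z : ℝ) := by
      rw [ae_all_iff]; intro b
      by_cases hy : y ∈ So R'
      · by_cases hb : y = ∑ z, b z • (z : Zd d)
        · have e : ∀ {M : Type} [AddCommMonoid M] (k : Zd d → ℕ → M), ∑ z ∈ R', k z (if hz : z ∈ R' then b ⟨z, hz⟩ else 0) = ∑ z : R', k z (b z) := by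
            intro M _ k
            rw [← Finset.sum_coe_sort]
            exact Finset.sum_congr rfl fun z _ => by simp
          have h1 := phi_bound hE hy (b := fun z => if hz : z ∈ R' then b ⟨z, hz⟩ else 0)
            (by rw [hb]; exact (e (fun z n => n • z)).symm)
          filter_upwards [h1] with ω hω _ _
          refine hω.trans (le_of_eq ?_)
          congr 1
          exact e (fun z n => (n : ℝ))
        · exact Eventually.of_forall fun ω _ h => absurd h hb
      · simp [hy]
    filter_upwards [this] with ω h hy b hb
    have := h (fun z => b z) hy (by rw [hb, ← Finset.sum_coe_sort])
    rwa [Finset.sum_coe_sort R' (fun z => (b z : ℝ))] at this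
  have hh0 : ∀ᵐ ω ∂ℙ, 0 ≤ (ℙ[fun ω => ∑ z ∈ R', F z ω | invSigma T (R' : Set (Zd d))]) ω :=
    condExp_nonneg (Eventually.of_forall fun ω => Finset.sum_nonneg fun z hz => hE.nonneg z (Gp_single hz) ω)
  filter_upwards [hD, hlim, hsub, hbd, hh0] with ω h1 h2 h3 h4 h5
  have heq : ∀ y ∈ So R', phiI T R' F y ω = phi F y ω := by
    intro y hy; simp [phiI, hy, h1]
  refine ⟨h5, ?_, ?_, ?_, ?_⟩
  · intro y
    unfold phiI; split_ifs
    · exact indicator_nonneg (fun _ _ => phi_nonneg _ _) _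
    · exact le_rfl
  · intro y hy; rw [heq y hy]; exact h2 y hy
  · intro x hx y hy
    rw [heq _ (So_add hx hy.1), heq x hx, heq y hy]; exact h3 x y hx hy
  · exact h4

end prob2
end RWRP

namespace RWRP
set_option linter.unusedSectionVars false
set_option linter.unusedVariables false

section det
variable {d : ℕ} {R' : Finset (Zd d)} {f ϕ : Zd d → ℝ} {h : ℝ}

lemma le_of_nat {a b K : ℝ} (N0 : ℕ) (H : ∀ N : ℕ, N0 ≤ N → N * a ≤ N * b + K) : a ≤ b := by
  by_contra hab
  push Not at hab
  obtain ⟨N, hN⟩ := exists_nat_gt (K / (a - b))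
  have h1 := H (max N N0) (le_max_right _ _)
  have h2 : (N : ℝ) ≤ (max N N0 : ℕ) := by exact_mod_cast le_max_left _ _
  have h3 : K / (a - b) < (max N N0 : ℕ) := by linarith
  rw [div_lt_iff₀ (by linarith)] at h3
  nlinarith

lemma Det.mul (D : Det R' f ϕ h) {y : Zd d} (hy : y ∈ So R') {k : ℕ} (hk : 0 < k) : ϕ (k • y) = k * ϕ y := by
  have h1 := D.lim _ (So_nsmul hy hk)
  have h2 := (D.lim _ hy).comp (tendsto_id.atTop_mul_const' hk : Tendsto (fun n : ℕ => n * k) atTop atTop)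
  have h3 := h2.const_mul (k : ℝ)
  refine tendsto_nhds_unique h1 (h3.congr fun n => ?_)
  simp only [Function.comp]
  rw [mul_smul]
  have : (k : ℝ) ≠ 0 := by exact_mod_cast hk.ne'
  push_cast
  rcases eq_or_ne (n : ℝ) 0 with h0 | h0
  · simp [h0]
  · field_simp

lemma Det.add_bd (D : Det R' f ϕ h) {y : Zd d} (hy : y ∈ So R') (b : Zd d → ℕ) :
    ϕ (y + ∑ z ∈ R', b z • z) ≤ ϕ y + h * ∑ z ∈ R', (b z : ℝ) := by
  have hw : (∑ z ∈ R', b z • z) ∈ Gp R' := ⟨b, rfl⟩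
  set w := ∑ z ∈ R', b z • z with hwd
  obtain ⟨c, hc⟩ := hy.1
  refine le_of_nat (K := h * ∑ z ∈ R', (c z : ℝ)) 2 fun N hN => ?_
  rw [← D.mul (So_add hy hw) (by omega)]
  have e1 : N • (y + w) = (N - 1) • y + (y + N • w) := by
    obtain ⟨k, rfl⟩ : ∃ k, N = k + 1 := ⟨N - 1, by omega⟩
    simp only [Nat.add_sub_cancel, smul_add, add_smul, one_smul]; abel
  have hs : y + N • w ∈ So R' := So_add hy (Gp_nsmul hw N)
  have h1 := D.sub _ (So_nsmul hy (n := N - 1) (by omega)) _ hs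
  rw [← e1, D.mul hy (by omega)] at h1
  have h2 := D.bd _ hs (fun z => c z + N * b z) (by
    conv_lhs => rw [hc, hwd, Finset.smul_sum]
    rw [← Finset.sum_add_distrib]
    exact Finset.sum_congr rfl fun z _ => by rw [add_smul, mul_smul])
  push_cast at h2
  rw [Finset.sum_add_distrib, ← Finset.mul_sum] at h2
  have h3 : ((N - 1 : ℕ) : ℝ) ≤ N := by exact_mod_cast Nat.sub_le _ _
  have h4 := mul_le_mul_of_nonneg_right h3 (D.nn y)
  linarith

lemma Det.M (D : Det R' f ϕ h) {y y' : Zd d} (hy : y ∈ So R') (hy' : y' ∈ So R') {s s' : ℝ} (hs : 0 < s)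
    (hs' : 0 < s') {b : Zd d → ℝ} (hb : ∀ z ∈ R', 0 ≤ b z) (he : s' • toR y' - s • toR y = lin R' b) :
    s' * ϕ y' ≤ s * ϕ y + h * ∑ z ∈ R', b z := by
  obtain ⟨E, hE0, hE⟩ := int_rep R'
  have hyS := hy
  have hyS' := hy'
  obtain ⟨hy1, c, hc, hyc⟩ := hy
  obtain ⟨hy1', c', hc', hyc'⟩ := hy'
  obtain ⟨k, hk⟩ : ∃ k : ℕ, ∀ z ∈ R', E + c' z ≤ k * c z := by
    have : ∀ᶠ m : ℕ in atTop, ∀ z ∈ R', E + c' z ≤ m * c z := by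
      rw [Finset.eventually_all]
      intro z _
      exact (tendsto_natCast_atTop_atTop.atTop_mul_const (hc z)).eventually_ge_atTop _
    exact this.exists
  obtain ⟨N0, hN0⟩ : ∃ N0 : ℕ, ∀ N : ℕ, N0 ≤ N → (k : ℝ) + 1 ≤ N * s ∧ 1 ≤ N * s' := by
    have := ((tendsto_natCast_atTop_atTop.atTop_mul_const hs).eventually_ge_atTop ((k:ℝ)+1)).and
      ((tendsto_natCast_atTop_atTop.atTop_mul_const hs').eventually_ge_atTop (1:ℝ))
    exact eventually_atTop.1 this
  refine le_of_nat (K := h * ∑ z ∈ R', ((k + 1) * c z + E) + ϕ y') N0 fun N hN => ?_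
  obtain ⟨hNk, hN1⟩ := hN0 N hN
  set n' := ⌊(N:ℝ) * s'⌋₊ with hn'
  set n0 := ⌊(N:ℝ) * s⌋₊ with hn0
  have a1 : (n' : ℝ) ≤ N * s' := Nat.floor_le (by positivity)
  have a2 : N * s' < n' + 1 := Nat.lt_floor_add_one _
  have a3 : (n0 : ℝ) ≤ N * s := Nat.floor_le (by positivity)
  have a4 : N * s < n0 + 1 := Nat.lt_floor_add_one _
  have hkn : k + 1 ≤ n0 := Nat.le_floor (by push_cast; exact hNk)
  have hn'1 : 1 ≤ n' := Nat.le_floor (by push_cast; exact hN1)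
  obtain ⟨n, hn⟩ : ∃ n, n0 = n + k := ⟨n0 - k, by omega⟩
  have hnR : (n0 : ℝ) = n + k := by rw [hn]; push_cast; ring
  have hGZ : n' • y' - n • y ∈ GZ R' := GZ_sub (Gp_sub_GZ (Gp_nsmul hy1' _)) (Gp_sub_GZ (Gp_nsmul hy1 _))
  have hrep : toR (n' • y' - n • y) = lin R' (fun z => (N * b z + ((n':ℝ) - N * s') * c' z) + ((N:ℝ) * s - n) * c z) := by
    rw [lin_add R' (fun z => N * b z + ((n':ℝ) - N * s') * c' z) (fun z => ((N:ℝ) * s - n) * c z),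
      lin_add R' (fun z => N * b z) (fun z => ((n':ℝ) - N * s') * c' z), lin_smul, lin_smul, lin_smul, ← he, ← hyc, ← hyc',
      toR_sub, toR_nsmul, toR_nsmul]
    module
  obtain ⟨e, hee, heb⟩ := hE _ hGZ _ hrep
  have e0 : ∀ z ∈ R', 0 ≤ e z := by
    intro z hz
    have h1 := (abs_le.1 (heb z hz)).1
    have h2 := hk z hz
    have h3 : -(c' z) ≤ ((n':ℝ) - N * s') * c' z := by nlinarith [hc' z]
    have h4 : k * c z ≤ ((N:ℝ) * s - n) * c z := mul_le_mul_of_nonneg_right (by linarith) (hc z).le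
    have h5 : 0 ≤ N * b z := mul_nonneg (Nat.cast_nonneg _) (hb z hz)
    have : (0:ℝ) ≤ e z := by linarith
    exact_mod_cast this
  have e1 : ∀ z ∈ R', ((e z).toNat : ℝ) ≤ N * b z + ((k + 1) * c z + E) := by
    intro z hz
    have h1 := (abs_le.1 (heb z hz)).2
    have h3 : ((n':ℝ) - N * s') * c' z ≤ 0 := by nlinarith [hc' z]
    have h4 : ((N:ℝ) * s - n) * c z ≤ (k + 1) * c z := mul_le_mul_of_nonneg_right (by linarith) (hc z).le
    have h5 : ((e z).toNat : ℝ) = e z := by exact_mod_cast Int.toNat_of_nonneg (e0 z hz)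
    rw [h5]; linarith
  have h1 := D.add_bd (So_nsmul hyS (n := n) (by omega)) (fun z => (e z).toNat)
  rw [← zsum_Gp e0, ← hee, add_sub_cancel, D.mul hyS (by omega), D.mul hyS' (by omega)] at h1
  have h2 : h * ∑ z ∈ R', ((e z).toNat : ℝ) ≤ h * ∑ z ∈ R', (N * b z + ((k + 1) * c z + E)) :=
    mul_le_mul_of_nonneg_left (Finset.sum_le_sum e1) D.h0
  rw [Finset.sum_add_distrib, ← Finset.mul_sum] at h2
  have h3 : (N * s' - 1) * ϕ y' ≤ n' * ϕ y' := mul_le_mul_of_nonneg_right (by linarith) (D.nn _)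
  have h4 : (n:ℝ) * ϕ y ≤ N * s * ϕ y := mul_le_mul_of_nonneg_right (by
    have : (0:ℝ) ≤ k := Nat.cast_nonneg _
    linarith) (D.nn _)
  linarith

/-- `(t, y)` approximates `ξ` up to `η`. -/
def Apx (R' : Finset (Zd d)) (ξ : Fin d → ℝ) (η t : ℝ) (y : Zd d) : Prop :=
  0 < t ∧ y ∈ So R' ∧ ∃ b : Zd d → ℝ, (∀ z ∈ R', 0 ≤ b z ∧ b z ≤ η) ∧ t • toR y = ξ + lin R' b

lemma Det.M' (D : Det R' f ϕ h) {ξ : Fin d → ℝ} {c : Zd d → ℝ} (hc : ∀ z, 0 < c z) (hξ : ξ = lin R' c) :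
    ∃ K : ℝ, 0 ≤ K ∧ ∀ η t t' y y', 0 < η → η ≤ 1 → Apx R' ξ η t y → Apx R' ξ η t' y' →
      |t * ϕ y - t' * ϕ y'| ≤ K * η := by
  obtain ⟨r, hr0, hr⟩ : ∃ r : ℝ, 0 < r ∧ ∀ z ∈ R', r ≤ c z := by
    by_cases hne : R'.Nonempty
    · obtain ⟨z0, _, h0⟩ := R'.exists_min_image c hne
      exact ⟨c z0, hc z0, h0⟩
    · exact ⟨1, one_pos, fun z hz => absurd ⟨z, hz⟩ hne⟩
  have key : ∀ η t t' y y', 0 < η → η ≤ 1 → Apx R' ξ η t y → Apx R' ξ η t' y' →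
      t' * ϕ y' - t * ϕ y ≤ (h * ∑ z ∈ R', (c z / r + (1 + 1 / r))) * η := by
    rintro η t t' y y' hη hη1 ⟨ht, hy, b, hb, hbe⟩ ⟨ht', hy', b', hb', hbe'⟩
    set θ := η / r with hθ
    have hθ0 : 0 < θ := div_pos hη hr0
    have hθr : θ * r = η := by rw [hθ]; field_simp
    have h1 := D.M hy hy' (s := t) (s' := (1 + θ) * t') ht (by positivity)
      (b := fun z => (θ * c z + (1 + θ) * b' z) - b z) (by
        intro z hz
        have h1 := mul_le_mul_of_nonneg_left (hr z hz) hθ0.le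
        have h2 := mul_nonneg (by linarith : 0 ≤ 1 + θ) (hb' z hz).1
        linarith [(hb z hz).2]) (by
        rw [lin_sub R' (fun z => θ * c z + (1 + θ) * b' z) b, lin_add R' (fun z => θ * c z) (fun z => (1 + θ) * b' z),
          lin_smul, lin_smul, mul_smul, hbe', hbe, ← hξ]
        module)
    have h2 : ∑ z ∈ R', ((θ * c z + (1 + θ) * b' z) - b z) ≤ (∑ z ∈ R', (c z / r + (1 + 1 / r))) * η := by
      rw [Finset.sum_mul]
      refine Finset.sum_le_sum fun z hz => ?_
      have h3 : (1 + θ) * b' z ≤ (1 + θ) * η := mul_le_mul_of_nonneg_left (hb' z hz).2 (by linarith)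
      have h4 : (1 + θ) * η ≤ (1 + 1 / r) * η := by
        refine mul_le_mul_of_nonneg_right ?_ hη.le
        rw [hθ]; gcongr
      have h5 : θ * c z = c z / r * η := by rw [hθ]; field_simp
      linarith [(hb z hz).1]
    have h3 := mul_le_mul_of_nonneg_left h2 D.h0
    have h4 : t' * ϕ y' ≤ (1 + θ) * t' * ϕ y' :=
      mul_le_mul_of_nonneg_right (by nlinarith) (D.nn _)
    linarith
  refine ⟨h * ∑ z ∈ R', (c z / r + (1 + 1 / r)), mul_nonneg D.h0 (Finset.sum_nonneg fun z _ => ?_), ?_⟩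
  · have := hc z; positivity
  · intro η t t' y y' h1 h2 h3 h4
    exact abs_le.2 ⟨by linarith [key η t t' y y' h1 h2 h3 h4], by linarith [key η t' t y' y h1 h2 h4 h3]⟩

/-- lattice approximation with given coefficients -/
def ceilPt (R' : Finset (Zd d)) (c : Zd d → ℝ) (n : ℕ) : Zd d := ∑ z ∈ R', ⌈n * c z⌉₊ • z

lemma ceilPt_apx {c : Zd d → ℝ} (hc : ∀ z, 0 < c z) {n : ℕ} (hn : 0 < n) {η : ℝ} (hη : (1:ℝ) / n ≤ η) :
    Apx R' (lin R' c) η (1 / n) (ceilPt R' c n) := by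
  have hn' : (0:ℝ) < n := by exact_mod_cast hn
  have hcp : ∀ z, 0 < n * c z := fun z => mul_pos hn' (hc z)
  refine ⟨by positivity, ⟨⟨_, rfl⟩, fun z => (⌈n * c z⌉₊ : ℝ), fun z => ?_, toR_nsum _ _⟩,
    fun z => 1 / n * ⌈n * c z⌉₊ - c z, fun z hz => ⟨?_, ?_⟩, ?_⟩
  · show (0:ℝ) < (⌈n * c z⌉₊ : ℝ)
    exact_mod_cast Nat.ceil_pos.2 (hcp z)
  · have := Nat.le_ceil (n * c z)
    rw [sub_nonneg, one_div, inv_mul_eq_div, le_div_iff₀ hn']; linarith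
  · have := Nat.ceil_lt_add_one (hcp z).le
    refine le_trans ?_ hη
    rw [sub_le_iff_le_add, one_div, inv_mul_eq_div, div_le_iff₀ hn', add_mul, inv_mul_cancel₀ hn'.ne']; linarith
  · rw [lin_sub R' (fun z => 1 / (n:ℝ) * ⌈n * c z⌉₊) c, lin_smul, ceilPt, toR_nsum]
    abel

/-- chosen positive coefficients -/
def cof (R' : Finset (Zd d)) (ξ : Fin d → ℝ) : Zd d → ℝ :=
  if hξ : ∃ c : Zd d → ℝ, (∀ z, 0 < c z) ∧ ξ = lin R' c then hξ.choose else fun _ => 1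

/-- the limit function -/
def alphaW (R' : Finset (Zd d)) (ϕ : Zd d → ℝ) (ξ : Fin d → ℝ) : ℝ :=
  if ξ = 0 then 0 else liminf (fun n : ℕ => ϕ (ceilPt R' (cof R' ξ) n) / n) atTop

lemma liminf_near {u : ℕ → ℝ} {q e : ℝ} (H : ∀ᶠ n in atTop, |q - u n| ≤ e) : |q - liminf u atTop| ≤ e := by
  have hb1 : ∀ᶠ n in atTop, q - e ≤ u n := H.mono fun n hn => by linarith [(abs_le.1 hn).2]
  have hb2 : ∀ᶠ n in atTop, u n ≤ q + e := H.mono fun n hn => by linarith [(abs_le.1 hn).1]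
  have h1 : q - e ≤ liminf u atTop :=
    le_liminf_of_le (Filter.IsBoundedUnder.isCoboundedUnder_ge ⟨q + e, hb2⟩) hb1
  have h2 : liminf u atTop ≤ q + e :=
    liminf_le_of_frequently_le hb2.frequently ⟨q - e, hb1⟩
  exact abs_le.2 ⟨by linarith, by linarith⟩

/-- positive combinations -/
def Pos (R' : Finset (Zd d)) (ξ : Fin d → ℝ) : Prop := ∃ c : Zd d → ℝ, (∀ z, 0 < c z) ∧ ξ = lin R' c

lemma Det.char (D : Det R' f ϕ h) {ξ : Fin d → ℝ} (hξ0 : ξ ≠ 0) (hξ : Pos R' ξ) :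
    ∃ K : ℝ, 0 ≤ K ∧ ∀ η t y, 0 < η → η ≤ 1 → Apx R' ξ η t y → |t * ϕ y - alphaW R' ϕ ξ| ≤ K * η := by
  have hcof : (∀ z, 0 < cof R' ξ z) ∧ ξ = lin R' (cof R' ξ) := by
    unfold cof
    have hξ' : ∃ c : Zd d → ℝ, (∀ z, 0 < c z) ∧ ξ = lin R' c := hξ
    rw [dif_pos hξ']; exact hξ'.choose_spec
  obtain ⟨K, hK0, hK⟩ := D.M' hcof.1 hcof.2
  refine ⟨K, hK0, fun η t y hη hη1 ha => ?_⟩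
  unfold alphaW
  rw [if_neg hξ0]
  refine liminf_near ?_
  have h1 : Tendsto (fun n : ℕ => (1:ℝ) / n) atTop (𝓝 0) := tendsto_one_div_atTop_nhds_zero_nat
  filter_upwards [h1.eventually_le_const hη, eventually_gt_atTop 0] with n hn hn0
  have h2 := ceilPt_apx (R' := R') hcof.1 hn0 hn
  rw [← hcof.2] at h2
  have h3 := hK η t _ y _ hη hη1 ha h2
  rwa [one_div, inv_mul_eq_div] at h3

lemma alphaW_zero : alphaW R' ϕ 0 = 0 := by simp [alphaW]

lemma le_of_nat_eps {a b K : ℝ} (hK : ∀ n : ℕ, 0 < n → a ≤ b + K * (1 / n)) : a ≤ b := by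
  refine le_of_nat (K := K) 1 fun N hN => ?_
  have hN' : (0:ℝ) < N := by exact_mod_cast hN
  have := mul_le_mul_of_nonneg_left (hK N hN) hN'.le
  have e : (N:ℝ) * (b + K * (1 / N)) = N * b + K := by field_simp
  linarith

lemma inv_nat_bd {n : ℕ} (hn : 0 < n) : (0:ℝ) < 1 / n ∧ (1:ℝ) / n ≤ 1 := by
  have hn' : (1:ℝ) ≤ n := by exact_mod_cast hn
  exact ⟨by positivity, by rw [div_le_one (by linarith)]; exact hn'⟩

lemma Det.alpha_nonneg (D : Det R' f ϕ h) {ξ : Fin d → ℝ} (hξ : Pos R' ξ) : 0 ≤ alphaW R' ϕ ξ := by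
  by_cases hξ0 : ξ = 0
  · simp [hξ0, alphaW_zero]
  obtain ⟨K, hK0, hK⟩ := D.char hξ0 hξ
  obtain ⟨c, hc, rfl⟩ := hξ
  refine le_of_nat_eps (K := K) fun n hn => ?_
  have h1 := hK (1/n) _ _ (inv_nat_bd hn).1 (inv_nat_bd hn).2 (ceilPt_apx hc hn le_rfl)
  have h2 := mul_nonneg (inv_nat_bd hn).1.le (D.nn (ceilPt R' c n))
  linarith [(abs_le.1 h1).2]

lemma Det.alpha_lat (D : Det R' f ϕ h) {x : Zd d} (hx : x ∈ So R') (hx0 : toR x ≠ 0) : alphaW R' ϕ (toR x) = ϕ x := by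
  have hap : ∀ η > 0, Apx R' (toR x) η 1 x := fun η hη =>
    ⟨one_pos, hx, fun _ => 0, fun _ _ => ⟨le_rfl, hη.le⟩, by simp [lin]⟩
  obtain ⟨K, hK0, hK⟩ := D.char hx0 hx.2
  have h1 : ∀ n : ℕ, 0 < n → |1 * ϕ x - alphaW R' ϕ (toR x)| ≤ K * (1 / n) := fun n hn =>
    hK (1/n) _ _ (inv_nat_bd hn).1 (inv_nat_bd hn).2 (hap _ (inv_nat_bd hn).1)
  refine le_antisymm (le_of_nat_eps (K := K) fun n hn => ?_) (le_of_nat_eps (K := K) fun n hn => ?_)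
  · linarith [(abs_le.1 (h1 n hn)).1]
  · linarith [(abs_le.1 (h1 n hn)).2]

lemma Pos_smul {ξ : Fin d → ℝ} (hξ : Pos R' ξ) {s : ℝ} (hs : 0 < s) : Pos R' (s • ξ) := by
  obtain ⟨c, hc, rfl⟩ := hξ
  exact ⟨fun z => s * c z, fun z => mul_pos hs (hc z), (lin_smul _ _ _).symm⟩

lemma Pos_add {ξ ζ : Fin d → ℝ} (hξ : Pos R' ξ) (hζ : Pos R' ζ) : Pos R' (ξ + ζ) := by
  obtain ⟨c, hc, rfl⟩ := hξ
  obtain ⟨c', hc', rfl⟩ := hζ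
  exact ⟨fun z => c z + c' z, fun z => add_pos (hc z) (hc' z), (lin_add _ _ _).symm⟩

lemma Apx_mono {ξ : Fin d → ℝ} {η η' t : ℝ} {y : Zd d} (h : Apx R' ξ η t y) (hη : η ≤ η') : Apx R' ξ η' t y := by
  obtain ⟨h1, h2, b, h3, h4⟩ := h
  exact ⟨h1, h2, b, fun z hz => ⟨(h3 z hz).1, (h3 z hz).2.trans hη⟩, h4⟩

lemma Det.alpha_smul (D : Det R' f ϕ h) {ξ : Fin d → ℝ} (hξ : Pos R' ξ) {s : ℝ} (hs : 0 ≤ s) :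
    alphaW R' ϕ (s • ξ) = s * alphaW R' ϕ ξ := by
  by_cases hξ0 : ξ = 0
  · simp [hξ0, alphaW_zero]
  rcases hs.eq_or_lt with rfl | hs
  · simp [alphaW_zero]
  obtain ⟨K, hK0, hK⟩ := D.char hξ0 hξ
  obtain ⟨K', hK0', hK'⟩ := D.char (smul_ne_zero hs.ne' hξ0) (Pos_smul hξ hs)
  obtain ⟨c, hc, rfl⟩ := hξ
  obtain ⟨N1, hN1⟩ := exists_nat_gt s
  have hN1p : 0 < N1 := by exact_mod_cast hs.trans hN1
  have key : ∀ n : ℕ, 0 < n → |alphaW R' ϕ (s • lin R' c) - s * alphaW R' ϕ (lin R' c)| ≤ (K' * s + s * K) * (1 / n) := by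
    intro n hn
    have hnN : 0 < n * N1 := Nat.mul_pos hn hN1p
    have hη := inv_nat_bd hnN
    have hle : (1:ℝ) / (n * N1 : ℕ) ≤ 1 / n := by
      have : (1:ℝ) ≤ N1 := by exact_mod_cast hN1p
      have : (1:ℝ) ≤ n := by exact_mod_cast hn
      push_cast
      apply one_div_le_one_div_of_le <;> nlinarith
    set η : ℝ := (1:ℝ) / (n * N1 : ℕ) with hηdef
    have ha := ceilPt_apx (R' := R') hc hnN (le_refl _)
    have h1 := hK η _ _ hη.1 hη.2 ha
    have ha' : Apx R' (s • lin R' c) (s * η) (s * η) (ceilPt R' c (n * N1)) := by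
      obtain ⟨q1, q2, b, q3, q4⟩ := ha
      refine ⟨mul_pos hs hη.1, q2, fun z => s * b z, fun z hz => ⟨mul_nonneg hs.le (q3 z hz).1,
        mul_le_mul_of_nonneg_left (q3 z hz).2 hs.le⟩, ?_⟩
      rw [mul_smul, q4, lin_smul, smul_add]
    have hsη : s * η ≤ 1 := by
      have : (1:ℝ) ≤ n := by exact_mod_cast hn
      have hN1' : (0:ℝ) < N1 := by exact_mod_cast hN1p
      rw [hηdef, mul_one_div, div_le_one (by positivity)]
      push_cast
      nlinarith
    have h2 := hK' (s * η) _ _ (mul_pos hs hη.1) hsη ha'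
    have h3 : |s * η * ϕ (ceilPt R' c (n * N1)) - s * alphaW R' ϕ (lin R' c)| ≤ s * (K * η) := by
      rw [mul_assoc, ← mul_sub, abs_mul, abs_of_pos hs]
      exact mul_le_mul_of_nonneg_left h1 hs.le
    have h4 : (K' * s + s * K) * η ≤ (K' * s + s * K) * (1 / n) :=
      mul_le_mul_of_nonneg_left hle (by positivity)
    rw [abs_le] at h2 h3 ⊢
    constructor <;> nlinarith
  refine le_antisymm (le_of_nat_eps (K := K' * s + s * K) fun n hn => ?_) (le_of_nat_eps (K := K' * s + s * K) fun n hn => ?_)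
  · linarith [(abs_le.1 (key n hn)).2]
  · linarith [(abs_le.1 (key n hn)).1]

lemma Det.alpha_add (D : Det R' f ϕ h) {ξ ζ : Fin d → ℝ} (hξ : Pos R' ξ) (hζ : Pos R' ζ) :
    alphaW R' ϕ (ξ + ζ) ≤ alphaW R' ϕ ξ + alphaW R' ϕ ζ := by
  by_cases hξ0 : ξ = 0
  · simp [hξ0, alphaW_zero]
  by_cases hζ0 : ζ = 0
  · simp [hζ0, alphaW_zero]
  by_cases h0 : ξ + ζ = 0
  · rw [h0, alphaW_zero]; exact add_nonneg (D.alpha_nonneg hξ) (D.alpha_nonneg hζ)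
  obtain ⟨K, hK0, hK⟩ := D.char hξ0 hξ
  obtain ⟨K', hK0', hK'⟩ := D.char hζ0 hζ
  obtain ⟨K'', hK0'', hK''⟩ := D.char h0 (Pos_add hξ hζ)
  obtain ⟨c, hc, rfl⟩ := hξ
  obtain ⟨c', hc', rfl⟩ := hζ
  refine le_of_nat_eps (K := K + K' + K'') fun n hn => ?_
  have h2n : 0 < 2 * n := by omega
  have hη := inv_nat_bd h2n
  have hη1 := inv_nat_bd hn
  have e2 : (1:ℝ) / (2 * n : ℕ) = 1 / 2 * (1 / n) := by push_cast; field_simp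
  have ha := ceilPt_apx (R' := R') hc h2n (le_refl _)
  have ha' := ceilPt_apx (R' := R') hc' h2n (le_refl _)
  have h1 := hK _ _ _ hη.1 hη.2 ha
  have h2 := hK' _ _ _ hη.1 hη.2 ha'
  have ha'' : Apx R' (lin R' c + lin R' c') (1 / n) (1 / (2 * n : ℕ)) (ceilPt R' c (2 * n) + ceilPt R' c' (2 * n)) := by
    obtain ⟨q1, q2, b, q3, q4⟩ := ha
    obtain ⟨q1', q2', b', q3', q4'⟩ := ha'
    refine ⟨q1, So_add q2 q2'.1, fun z => b z + b' z, fun z hz => ⟨add_nonneg (q3 z hz).1 (q3' z hz).1, ?_⟩, ?_⟩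
    · linarith [(q3 z hz).2, (q3' z hz).2]
    · rw [toR_add, smul_add, q4, q4', lin_add]; abel
  have h3 := hK'' _ _ _ hη1.1 hη1.2 ha''
  have h4 := mul_le_mul_of_nonneg_left (D.sub _ ha.2.1 _ ha'.2.1) hη.1.le
  rw [abs_le] at h1 h2 h3
  have e3 : K * (1 / (2 * n : ℕ)) ≤ K * (1 / n) := mul_le_mul_of_nonneg_left (by linarith [hη1.1]) hK0
  have e4 : K' * (1 / (2 * n : ℕ)) ≤ K' * (1 / n) := mul_le_mul_of_nonneg_left (by linarith [hη1.1]) hK0'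
  linarith [h1.1, h2.1, h3.1, h1.2, h2.2, h3.2]

lemma Det.alpha_bd (D : Det R' f ϕ h) {ξ : Fin d → ℝ} (hξ : Pos R' ξ) {b : Zd d → ℝ} (hb : ∀ z, 0 ≤ b z)
    (hξb : ξ = lin R' b) : alphaW R' ϕ ξ ≤ h * ∑ z ∈ R', b z := by
  by_cases hξ0 : ξ = 0
  · rw [hξ0, alphaW_zero]; exact mul_nonneg D.h0 (Finset.sum_nonneg fun z _ => hb z)
  obtain ⟨K, hK0, hK⟩ := D.char hξ0 hξ
  obtain ⟨c, hc, hξc⟩ := hξ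
  refine le_of_nat_eps (K := h * ∑ z ∈ R', (c z + 1) + K) fun n hn => ?_
  have hη := inv_nat_bd hn
  have hn' : (0:ℝ) < n := by exact_mod_cast hn
  set η : ℝ := 1 / n with hηd
  set cθ : Zd d → ℝ := fun z => η * c z + (1 - η) * b z with hcθ
  have hcp : ∀ z, 0 < cθ z := fun z =>
    add_pos_of_pos_of_nonneg (mul_pos hη.1 (hc z)) (mul_nonneg (by linarith [hη.2]) (hb z))
  have hrep : lin R' cθ = ξ := by
    rw [hcθ, lin_add R' (fun z => η * c z) (fun z => (1 - η) * b z), lin_smul, lin_smul, ← hξc, ← hξb]; module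
  have ha := ceilPt_apx (R' := R') hcp hn (le_refl _)
  rw [hrep] at ha
  have h1 := hK _ _ _ hη.1 hη.2 ha
  have h2 := D.bd _ ha.2.1 _ rfl
  have h3 : η * ∑ z ∈ R', ((⌈n * cθ z⌉₊ : ℕ) : ℝ) ≤ ∑ z ∈ R', b z + (∑ z ∈ R', (c z + 1)) * η := by
    rw [Finset.mul_sum, Finset.sum_mul, ← Finset.sum_add_distrib]
    refine Finset.sum_le_sum fun z _ => ?_
    have h4 := Nat.ceil_lt_add_one (mul_pos hn' (hcp z)).le
    have h5 : η * ((⌈n * cθ z⌉₊ : ℕ) : ℝ) ≤ η * (n * cθ z + 1) := mul_le_mul_of_nonneg_left h4.le hη.1.le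
    have h6 : η * (n * cθ z + 1) = cθ z + η := by rw [hηd]; field_simp
    rw [h6] at h5
    have h7 : 0 ≤ η * b z := mul_nonneg hη.1.le (hb z)
    simp only [hcθ] at h5 ⊢
    nlinarith
  have h4 := mul_le_mul_of_nonneg_left h2 hη.1.le
  have h5 := mul_le_mul_of_nonneg_left h3 D.h0
  have h6 := (abs_le.1 h1).1
  nlinarith

end det
end RWRP

namespace RWRP
set_option linter.unusedSectionVars false
set_option linter.unusedVariables false

section det2
variable {d : ℕ} {R' : Finset (Zd d)} {f ϕ : Zd d → ℝ} {h : ℝ} {A : Set (Fin d → ℝ)}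

/-- small increments are cheap -/
def Flat (J R' : Finset (Zd d)) (f : Zd d → ℝ) : Prop :=
  ∀ K > (0:ℝ), ∀ ε > (0:ℝ), ∃ η > (0:ℝ), ∃ M : ℝ, ∀ L ≥ M, ∀ u ∈ Gp R', n1Z u ≤ K * L →
    ∀ b : Zd d → ℕ, (∀ z ∈ J, (b z : ℝ) ≤ η * L) → f (u + ∑ z ∈ J, b z • z) ≤ f u + ε * L

/-- one direction -/
def FlatZ (R' : Finset (Zd d)) (f : Zd d → ℝ) (z : Zd d) : Prop :=
  ∀ K > (0:ℝ), ∀ ε > (0:ℝ), ∃ η > (0:ℝ), ∃ M : ℝ, ∀ L ≥ M, ∀ u ∈ Gp R', n1Z u ≤ K * L →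
    ∀ b : ℕ, (b : ℝ) ≤ η * L → f (u + b • z) ≤ f u + ε * L

lemma n1Z_add (x y : Zd d) : n1Z (x + y) ≤ n1Z x + n1Z y := by
  unfold n1Z; rw [toR_add]; exact n1_add _ _

lemma n1Z_nonneg (x : Zd d) : 0 ≤ n1Z x := n1_nonneg _

lemma n1Z_nsum_le (J : Finset (Zd d)) (b : Zd d → ℕ) {t : ℝ} (hb : ∀ z ∈ J, (b z : ℝ) ≤ t) :
    n1Z (∑ z ∈ J, b z • z) ≤ t * ∑ z ∈ J, n1Z z := by
  unfold n1Z
  rw [toR_nsum]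
  refine (n1_lin _ _).trans ?_
  rw [Finset.mul_sum]
  refine Finset.sum_le_sum fun z hz => ?_
  rw [abs_of_nonneg (Nat.cast_nonneg _)]
  exact mul_le_mul_of_nonneg_right (hb z hz) (n1Z_nonneg z)

lemma flat_all (H : ∀ z ∈ R', FlatZ R' f z) : ∀ J ⊆ R', Flat J R' f := by
  intro J
  induction J using Finset.induction_on with
  | empty =>
    intro _ K hK ε hε
    refine ⟨1, one_pos, 0, fun L hL u hu huK b hb => ?_⟩
    simp only [Finset.sum_empty, add_zero]
    nlinarith
  | insert a J ha ih =>
    intro hJ K hK ε hε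
    have hJ' : J ⊆ R' := fun z hz => hJ (Finset.mem_insert_of_mem hz)
    have haR : a ∈ R' := hJ (Finset.mem_insert_self _ _)
    have hS : 0 ≤ ∑ z ∈ J, n1Z z := Finset.sum_nonneg fun z _ => n1Z_nonneg z
    obtain ⟨η1, hη1, M1, h1⟩ := ih hJ' K hK (ε / 2) (by linarith)
    obtain ⟨η2, hη2, M2, h2⟩ := H a haR (K + ∑ z ∈ J, n1Z z) (by linarith) (ε / 2) (by linarith)
    refine ⟨min (min η1 η2) 1, by positivity, max (max M1 M2) 0, fun L hL u hu huK b hb => ?_⟩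
    have hL0 : 0 ≤ L := (le_max_right _ _).trans hL
    have hLM : max M1 M2 ≤ L := (le_max_left _ _).trans hL
    have hm1 : min (min η1 η2) 1 * L ≤ η1 * L :=
      mul_le_mul_of_nonneg_right ((min_le_left _ _).trans (min_le_left _ _)) hL0
    have hm2 : min (min η1 η2) 1 * L ≤ η2 * L :=
      mul_le_mul_of_nonneg_right ((min_le_left _ _).trans (min_le_right _ _)) hL0
    have hm3 : min (min η1 η2) 1 * L ≤ L := by
      have := mul_le_mul_of_nonneg_right (min_le_right (min η1 η2) (1:ℝ)) hL0
      linarith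
    have q1 := h1 L ((le_max_left _ _).trans hLM) u hu huK b
      (fun z hz => (hb z (Finset.mem_insert_of_mem hz)).trans hm1)
    have hG : (∑ z ∈ J, b z • z) ∈ Gp R' := by
      refine Gp_mono hJ' ⟨b, rfl⟩
    have hn : n1Z (∑ z ∈ J, b z • z) ≤ L * ∑ z ∈ J, n1Z z :=
      n1Z_nsum_le J b (fun z hz => (hb z (Finset.mem_insert_of_mem hz)).trans hm3)
    have q2 := h2 L ((le_max_right _ _).trans hLM) (u + ∑ z ∈ J, b z • z) (Gp_add hu hG)
      (by have := n1Z_add u (∑ z ∈ J, b z • z); nlinarith) (b a)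
      ((hb a (Finset.mem_insert_self _ _)).trans hm2)
    rw [Finset.sum_insert ha, add_comm (b a • a), ← add_assoc]
    linarith

lemma finite_pts (R' : Finset (Zd d)) (Q : ℕ) :
    {y : Zd d | ∃ m : Zd d → ℕ, (∀ z ∈ R', m z ≤ Q) ∧ y = ∑ z ∈ R', m z • z}.Finite := by
  refine ((R'.pi fun _ => Finset.range (Q + 1)).image
    (fun g => ∑ z ∈ R'.attach, g z.1 z.2 • z.1)).finite_toSet.subset ?_
  rintro y ⟨m, hm, rfl⟩
  rw [Finset.mem_coe, Finset.mem_image]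
  refine ⟨fun z _ => m z, ?_, ?_⟩
  · rw [Finset.mem_pi]; intro z hz; rw [Finset.mem_range]; have := hm z hz; omega
  · exact Finset.sum_attach R' (fun z => m z • z)

lemma Det.unif (D : Det R' f ϕ h) (Q : ℕ) {ε : ℝ} (hε : 0 < ε) : ∃ N0 : ℕ, ∀ n : ℕ, N0 ≤ n →
    ∀ m : Zd d → ℕ, (∀ z ∈ R', m z ≤ Q) → (∑ z ∈ R', m z • z) ∈ So R' →
      |f (n • ∑ z ∈ R', m z • z) - n * ϕ (∑ z ∈ R', m z • z)| ≤ ε * n := by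
  have h1 : ∀ᶠ n : ℕ in atTop, ∀ y ∈ {y : Zd d | ∃ m : Zd d → ℕ, (∀ z ∈ R', m z ≤ Q) ∧ y = ∑ z ∈ R', m z • z},
      y ∈ So R' → |f (n • y) - n * ϕ y| ≤ ε * n := by
    rw [(finite_pts R' Q).eventually_all]
    intro y _
    by_cases hy : y ∈ So R'
    · have h2 := (D.lim y hy).sub_const (ϕ y)
      rw [sub_self] at h2
      have h3 := h2.abs
      rw [abs_zero] at h3
      filter_upwards [h3.eventually_le_const hε, eventually_gt_atTop 0] with n hn hn0 _
      have hn' : (0:ℝ) < n := by exact_mod_cast hn0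
      have e : f (n • y) - n * ϕ y = (f (n • y) / n - ϕ y) * n := by field_simp
      rw [e, abs_mul, abs_of_pos hn']
      exact mul_le_mul_of_nonneg_right hn hn'.le
    · exact Eventually.of_forall fun n hn => absurd hn hy
  obtain ⟨N0, hN0⟩ := eventually_atTop.1 h1
  exact ⟨N0, fun n hn m hm hs => hN0 n hn _ ⟨m, hm, rfl⟩ hs⟩

lemma ar1 {β L N m m0 B E k n : ℝ} (hL : 0 < L) (hN : 0 < N) (h1 : m * L ≤ N * β) (h2 : N * β ≤ (m + 1) * L)
    (hm : 1 ≤ m) (hβ : β ≤ B * L) (hk0 : 0 ≤ k)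
    (hn : n + k ≤ L / N) (hn' : L / N ≤ n + k + 1) (hn0 : 0 ≤ n) :
    k ≤ β - n * m ∧ β - n * m ≤ L / N + (1 + k) * (N * B) := by
  have e1 : m * (L / N) ≤ β := by rw [← mul_div_assoc, div_le_iff₀ hN]; linarith
  have e2 : β ≤ (m + 1) * (L / N) := by rw [← mul_div_assoc, le_div_iff₀ hN]; linarith
  have e3 : m ≤ N * B := by
    have : m * L ≤ N * B * L := by nlinarith
    exact le_of_mul_le_mul_right this hL
  constructor
  · nlinarith
  · nlinarith

lemma ar2 {β L N m m0 B E n : ℝ} (hL : 0 < L) (hN : 0 < N) (h1 : m * L ≤ N * β) (h2 : N * β ≤ (m + 1) * L)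
    (hm : 1 ≤ m) (hm0 : 0 < m0) (hmm : m0 ≤ m) (hβ : β ≤ B * L) (hE : 0 ≤ E)
    (hn : (1 + 1 / m0) * (L / N) + E ≤ n) (hn' : n ≤ (1 + 1 / m0) * (L / N) + E + 1) :
    E ≤ n * m - β ∧ n * m - β ≤ B / m0 * L + (E + 1) * (N * B) := by
  have e1 : m * (L / N) ≤ β := by rw [← mul_div_assoc, div_le_iff₀ hN]; linarith
  have e2 : β ≤ (m + 1) * (L / N) := by rw [← mul_div_assoc, le_div_iff₀ hN]; linarith
  have e3 : m ≤ N * B := by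
    have : m * L ≤ N * B * L := by nlinarith
    exact le_of_mul_le_mul_right this hL
  have e4 : m + 1 ≤ (1 + 1 / m0) * m := by
    have : 1 ≤ 1 / m0 * m := by rw [one_div, inv_mul_eq_div, le_div_iff₀ hm0]; linarith
    linarith
  have hLN : 0 < L / N := by positivity
  have hq : 0 < 1 / m0 := by positivity
  constructor
  · have h3 : ((1 + 1 / m0) * (L / N) + E) * m ≤ n * m := mul_le_mul_of_nonneg_right hn (by linarith)
    have h4 : (m + 1) * (L / N) ≤ ((1 + 1 / m0) * m) * (L / N) := mul_le_mul_of_nonneg_right e4 hLN.le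
    nlinarith
  · have h3 : n * m ≤ ((1 + 1 / m0) * (L / N) + E + 1) * m := mul_le_mul_of_nonneg_right hn' (by linarith)
    have h4 : (E + 1) * m ≤ (E + 1) * (N * B) := mul_le_mul_of_nonneg_left e3 (by linarith)
    have h5 : (1 + 1 / m0) * (m * (L / N)) ≤ (1 + 1 / m0) * β := mul_le_mul_of_nonneg_left e1 (by linarith)
    have h6 : 1 / m0 * β ≤ 1 / m0 * (B * L) := mul_le_mul_of_nonneg_left hβ hq.le
    have h7 : B / m0 * L = 1 / m0 * (B * L) := by ring
    rw [h7]; nlinarith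

set_option maxHeartbeats 4000000 in
lemma Det.shape (D : Det R' f ϕ h) (hF : Flat R' R' f) (hA : A = Cp R') {δ ε : ℝ} (hδ : 0 < δ) (hε : 0 < ε) :
    ∃ M : ℝ, ∀ x ∈ Gp R', toR x ∈ faceDelta A δ → M ≤ n1Z x → x ∈ So R' ∧ |f x - ϕ x| ≤ ε * n1Z x := by
  obtain ⟨ε₀, B, hε₀, hB, hrep⟩ := delta_rep hA hδ
  obtain ⟨E, hE0, hE⟩ := int_rep R'
  have hS : 0 ≤ ∑ z ∈ R', n1Z z := Finset.sum_nonneg fun z _ => n1Z_nonneg z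
  obtain ⟨η0, hη0, M1, hflat⟩ := hF (B * (∑ z ∈ R', n1Z z) + 1) (by positivity) (ε / 4) (by linarith)
  have hh := D.h0
  set η : ℝ := min (min η0 1) (ε / (4 * (h * R'.card + 1))) with hη
  have hηp : 0 < η := by rw [hη]; positivity
  have hη1 : η ≤ η0 := (min_le_left _ _).trans (min_le_left _ _)
  have hη2 : η ≤ 1 := (min_le_left _ _).trans (min_le_right _ _)
  have hη3 : h * R'.card * η ≤ ε / 4 := by
    have h1 : η ≤ ε / (4 * (h * R'.card + 1)) := min_le_right _ _
    have hp : 0 ≤ h * R'.card := by positivity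
    rw [le_div_iff₀ (by positivity)] at h1
    linarith
  obtain ⟨N, hN1, hNm, hNη, hNB⟩ : ∃ N : ℕ, 0 < N ∧ 1 ≤ N * ε₀ - 1 ∧ (1:ℝ) / N ≤ η / 2 ∧ B / (N * ε₀ - 1) ≤ η / 2 := by
    have t1 : Tendsto (fun n : ℕ => (n:ℝ) * ε₀ - 1) atTop atTop :=
      tendsto_atTop_add_const_right _ (-1) (tendsto_natCast_atTop_atTop.atTop_mul_const hε₀)
    have t2 : Tendsto (fun n : ℕ => (1:ℝ) / n) atTop (𝓝 0) := tendsto_one_div_atTop_nhds_zero_nat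
    have t3 := t1.const_div_atTop B
    have := (eventually_gt_atTop 0).and ((t1.eventually_ge_atTop 1).and
      ((t2.eventually_le_const (half_pos hηp)).and (t3.eventually_le_const (half_pos hηp))))
    exact this.exists
  set m0 : ℝ := N * ε₀ - 1 with hm0
  have hNr : (1:ℝ) ≤ N := by exact_mod_cast hN1
  have hNp : (0:ℝ) < N := by linarith
  obtain ⟨N0, hN0⟩ := D.unif ⌊N * B⌋₊ (ε := ε / 8) (by linarith)
  set k := ⌈E⌉₊ with hk
  have hkE : E ≤ k := Nat.le_ceil E
  set C1 : ℝ := (1 + k) * (N * B) + E with hC1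
  set C2 : ℝ := (E + 1) * (N * B) + E with hC2
  refine ⟨M1 + |M1| + 2 * C1 / η + 2 * C2 / η + (E + 1) + N * (N0 + k + 2) , fun x hx hxA hxM => ?_⟩
  set L := n1Z x with hL
  have hC1p : 0 ≤ C1 := by positivity
  have hC2p : 0 ≤ C2 := by positivity
  have q1 : 0 ≤ 2 * C1 / η := by positivity
  have q2 : 0 ≤ 2 * C2 / η := by positivity
  have q3 : 0 ≤ N * (N0 + k + 2 : ℝ) := by positivity
  have q4 : 0 ≤ M1 + |M1| := by linarith [neg_abs_le M1]
  have hLM1 : M1 ≤ L := by linarith [abs_nonneg M1]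
  have hLC1 : C1 ≤ η / 2 * L := by
    have : 2 * C1 / η ≤ L := by linarith
    rw [div_le_iff₀ hηp] at this; linarith
  have hLC2 : C2 ≤ η / 2 * L := by
    have : 2 * C2 / η ≤ L := by linarith
    rw [div_le_iff₀ hηp] at this; linarith
  have hLE : E + 1 ≤ L := by linarith
  have hLp : 0 < L := by linarith
  have hLN : N0 + k + 2 ≤ L / N := by rw [le_div_iff₀ hNp]; linarith
  obtain ⟨β, hxβ, hβ⟩ := hrep _ hxA
  have hβ1 : ∀ z ∈ R', ε₀ * L ≤ β z := fun z hz => (hβ z hz).1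
  have hβ2 : ∀ z ∈ R', β z ≤ B * L := fun z hz => (hβ z hz).2
  have hxS : x ∈ So R' := by
    refine ⟨hx, fun z => if z ∈ R' then β z else 1, fun z => ?_, ?_⟩
    · dsimp only
      split_ifs with hz
      · exact lt_of_lt_of_le (by positivity) (hβ1 z hz)
      · exact one_pos
    · rw [hxβ]; exact lin_congr _ fun z hz => by rw [if_pos hz]
  refine ⟨hxS, ?_⟩
  set m : Zd d → ℕ := fun z => ⌊N * β z / L⌋₊ with hm
  have hβ0 : ∀ z ∈ R', 0 ≤ β z := fun z hz => le_trans (by positivity) (hβ1 z hz)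
  have m1 : ∀ z ∈ R', (m z : ℝ) * L ≤ N * β z := fun z hz => by
    rw [← le_div_iff₀ hLp]; exact Nat.floor_le (div_nonneg (mul_nonneg hNp.le (hβ0 z hz)) hLp.le)
  have m2 : ∀ z ∈ R', N * β z ≤ ((m z : ℝ) + 1) * L := fun z hz => by
    rw [← div_le_iff₀ hLp]; exact (Nat.lt_floor_add_one _).le
  have m3 : ∀ z ∈ R', m0 ≤ m z := fun z hz => by
    have h1 := m2 z hz
    have h2 := mul_le_mul_of_nonneg_left (hβ1 z hz) hNp.le
    have h3 : (N * ε₀) * L ≤ ((m z : ℝ) + 1) * L := by linarith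
    have := le_of_mul_le_mul_right h3 hLp
    linarith
  have m4 : ∀ z ∈ R', (1:ℝ) ≤ m z := fun z hz => hNm.trans (m3 z hz)
  have mQ : ∀ z ∈ R', m z ≤ ⌊N * B⌋₊ := fun z hz => by
    refine Nat.floor_le_floor ?_
    rw [div_le_iff₀ hLp]
    have := mul_le_mul_of_nonneg_left (hβ2 z hz) hNp.le
    linarith
  set y : Zd d := ∑ z ∈ R', m z • z with hy
  have hyG : y ∈ Gp R' := ⟨m, rfl⟩
  have hyR : toR y = lin R' (fun z => (m z : ℝ)) := toR_nsum _ _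
  have hyS : y ∈ So R' := by
    refine ⟨hyG, fun z => if z ∈ R' then (m z : ℝ) else 1, fun z => ?_, ?_⟩
    · dsimp only
      split_ifs with hz
      · linarith [m4 z hz]
      · exact one_pos
    · rw [hyR]; exact lin_congr _ fun z hz => by rw [if_pos hz]
  -- lower multiple
  have hfl1 : (⌊L / N⌋₊ : ℝ) ≤ L / N := Nat.floor_le (by positivity)
  have hfl2 : L / N < ⌊L / N⌋₊ + 1 := Nat.lt_floor_add_one _
  have hkf : k ≤ ⌊L / N⌋₊ := Nat.le_floor (by
    have : (0:ℝ) ≤ N0 := Nat.cast_nonneg _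
    linarith)
  obtain ⟨n, hn⟩ : ∃ n, ⌊L / N⌋₊ = n + k := ⟨⌊L / N⌋₊ - k, by omega⟩
  have hnR : (⌊L / N⌋₊ : ℝ) = n + k := by rw [hn]; push_cast; ring
  rw [hnR] at hfl1 hfl2
  have hnN0' : (N0 : ℝ) + 1 ≤ n := by linarith
  have hnN0 : N0 + 1 ≤ n := by exact_mod_cast hnN0'
  have hk0 : (0:ℝ) ≤ k := Nat.cast_nonneg _
  have hLNle : L / N ≤ L := div_le_self hLp.le hNr
  have hnL : (n:ℝ) ≤ L := by linarith
  have hLNη : L / N ≤ η / 2 * L := by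
    have := mul_le_mul_of_nonneg_right hNη hLp.le
    rw [one_div, inv_mul_eq_div] at this; exact this
  -- upper multiple
  set n' := ⌈(1 + 1 / m0) * (L / N) + E⌉₊ with hn'
  have hm0p : 0 < m0 := by linarith
  have hce1 : (1 + 1 / m0) * (L / N) + E ≤ n' := Nat.le_ceil _
  have hce2 : (n' : ℝ) ≤ (1 + 1 / m0) * (L / N) + E + 1 := (Nat.ceil_lt_add_one (by positivity)).le
  have hqle : 1 / m0 ≤ 1 := by rw [div_le_one hm0p]; exact hNm
  have hqp : 0 < 1 / m0 := by positivity
  have hLNp : 0 < L / N := by positivity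
  have hnn' : (n:ℝ) ≤ n' := by
    have h1 := mul_pos hqp hLNp
    linarith
  have hnn'' : n ≤ n' := by exact_mod_cast hnn'
  have hn'L : (n' : ℝ) ≤ 2 * L := by
    have h1 : (1 + 1 / m0) * (L / N) ≤ 2 * (η / 2 * L) := by
      have h3 := mul_le_mul_of_nonneg_right hqle hLNp.le
      linarith
    have h2 : η * L ≤ 1 * L := mul_le_mul_of_nonneg_right hη2 hLp.le
    linarith
  -- representation of x - n y
  obtain ⟨b, hb, hbE⟩ := hE (x - n • y) (GZ_sub (Gp_sub_GZ hx) (Gp_sub_GZ (Gp_nsmul hyG n)))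
    (fun z => β z - n * m z) (by
      rw [lin_sub R' β (fun z => n * (m z : ℝ)), lin_smul, toR_sub, toR_nsmul, hxβ, hyR])
  have hb1 : ∀ z ∈ R', (0:ℝ) ≤ b z ∧ (b z : ℝ) ≤ η * L := fun z hz => by
    have h1 := abs_le.1 (hbE z hz)
    have h2 := ar1 hLp hNp (m1 z hz) (m2 z hz) (m4 z hz) (hβ2 z hz) hk0 hfl1 hfl2.le (Nat.cast_nonneg n) (m0 := 0) (E := 0)
    constructor
    · linarith [h1.1, h2.1]
    · linarith [h1.2, h2.2]
  have hb0 : ∀ z ∈ R', 0 ≤ b z := fun z hz => by exact_mod_cast (hb1 z hz).1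
  have hbN : ∀ z ∈ R', (((b z).toNat : ℕ) : ℝ) ≤ η * L := fun z hz => by
    have h5 : ((b z).toNat : ℝ) = b z := by exact_mod_cast Int.toNat_of_nonneg (hb0 z hz)
    rw [h5]; exact (hb1 z hz).2
  have hxe : n • y + ∑ z ∈ R', (b z).toNat • z = x := by
    rw [← zsum_Gp hb0, ← hb, add_sub_cancel]
  -- representation of n' y - x
  obtain ⟨b', hb', hbE'⟩ := hE (n' • y - x) (GZ_sub (Gp_sub_GZ (Gp_nsmul hyG n')) (Gp_sub_GZ hx))
    (fun z => n' * m z - β z) (by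
      rw [lin_sub R' (fun z => n' * (m z : ℝ)) β, lin_smul, toR_sub, toR_nsmul, hxβ, hyR])
  have hb1' : ∀ z ∈ R', (0:ℝ) ≤ b' z ∧ (b' z : ℝ) ≤ η * L := fun z hz => by
    have h1 := abs_le.1 (hbE' z hz)
    have h2 := ar2 hLp hNp (m1 z hz) (m2 z hz) (m4 z hz) hm0p (m3 z hz) (hβ2 z hz) hE0 hce1 hce2
    have h3 := mul_le_mul_of_nonneg_right hNB hLp.le
    constructor
    · linarith [h1.1, h2.1]
    · linarith [h1.2, h2.2]
  have hb0' : ∀ z ∈ R', 0 ≤ b' z := fun z hz => by exact_mod_cast (hb1' z hz).1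
  have hbN' : ∀ z ∈ R', (((b' z).toNat : ℕ) : ℝ) ≤ η * L := fun z hz => by
    have h5 : ((b' z).toNat : ℝ) = b' z := by exact_mod_cast Int.toNat_of_nonneg (hb0' z hz)
    rw [h5]; exact (hb1' z hz).2
  have hxe' : x + ∑ z ∈ R', (b' z).toNat • z = n' • y := by
    rw [← zsum_Gp hb0', ← hb', add_sub_cancel]
  have hηL : η * L ≤ η0 * L := mul_le_mul_of_nonneg_right hη1 hLp.le
  -- sums
  have hsum : ∀ c : Zd d → ℕ, (∀ z ∈ R', (c z : ℝ) ≤ η * L) → h * ∑ z ∈ R', (c z : ℝ) ≤ ε / 4 * L := by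
    intro c hc
    have h1 : ∑ z ∈ R', (c z : ℝ) ≤ R'.card * (η * L) := by
      have := Finset.sum_le_card_nsmul R' (fun z => (c z : ℝ)) (η * L) hc
      rwa [nsmul_eq_mul] at this
    have h2 := mul_le_mul_of_nonneg_left h1 hh
    have h3 := mul_le_mul_of_nonneg_right hη3 hLp.le
    linarith
  -- bounds on norms
  have hny : n1Z (n • y) ≤ (B * (∑ z ∈ R', n1Z z) + 1) * L := by
    have e : n • y = ∑ z ∈ R', (n * m z) • z := by
      rw [hy, Finset.smul_sum]; exact Finset.sum_congr rfl fun z _ => by rw [mul_smul]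
    rw [e]
    have := n1Z_nsum_le R' (fun z => n * m z) (t := B * L) (fun z hz => by
      have h2 := ar1 hLp hNp (m1 z hz) (m2 z hz) (m4 z hz) (hβ2 z hz) hk0 hfl1 hfl2.le (Nat.cast_nonneg n) (m0 := 0) (E := 0)
      push_cast
      linarith [h2.1, hβ2 z hz])
    linarith
  have hxK : n1Z x ≤ (B * (∑ z ∈ R', n1Z z) + 1) * L := by
    have : 0 ≤ B * (∑ z ∈ R', n1Z z) := by positivity
    have h2 := mul_nonneg this hLp.le
    linarith
  have f1 := hflat L hLM1 (n • y) (Gp_nsmul hyG n) hny (fun z => (b z).toNat) (fun z hz => (hbN z hz).trans hηL)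
  rw [hxe] at f1
  have f2 := hflat L hLM1 x hx hxK (fun z => (b' z).toNat) (fun z hz => (hbN' z hz).trans hηL)
  rw [hxe'] at f2
  have g1 := D.add_bd (So_nsmul hyS (n := n) (by omega)) (fun z => (b z).toNat)
  rw [hxe, D.mul hyS (by omega)] at g1
  have g2 := D.add_bd hxS (fun z => (b' z).toNat)
  rw [hxe', D.mul hyS (by omega)] at g2
  have s1 := hsum _ hbN
  have s2 := hsum _ hbN'
  have u1 := abs_le.1 (hN0 n (by omega) m mQ hyS)
  have u2 := abs_le.1 (hN0 n' (by omega) m mQ hyS)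
  have v1 : (n:ℝ) * ϕ y ≤ n' * ϕ y := mul_le_mul_of_nonneg_right hnn' (D.nn y)
  have w1 : ε / 8 * (n:ℝ) ≤ ε / 8 * (2 * L) := mul_le_mul_of_nonneg_left (by linarith) (by linarith)
  have w2 : ε / 8 * (n':ℝ) ≤ ε / 8 * (2 * L) := mul_le_mul_of_nonneg_left hn'L (by linarith)
  have hεL : 0 < ε * L := by positivity
  rw [abs_le]
  constructor
  · linarith [u2.1]
  · linarith [u1.2]

end det2
end RWRP

namespace RWRP
set_option linter.unusedSectionVars false
set_option linter.unusedVariables false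

section fin
variable {d : ℕ} {Ω : Type*} [m0 : MeasurableSpace Ω]
variable {ℙ : Measure Ω} [IsProbabilityMeasure ℙ] {T : Zd d → Ω → Ω} {R R' : Finset (Zd d)}
  {F : Zd d → Ω → ℝ} {V : Ω → Zd d → ℝ} {κ : ℝ}

lemma erg_const {S : Set (Zd d)} {g : Ω → ℝ} (he : ErgodicUnder ℙ T S) (hg : Measurable[invSigma T S] g) :
    ∃ c : ℝ, ∀ᵐ ω ∂ℙ, g ω = c := by
  have : ∃ a, g =ᵐ[ℙ] fun _ => a := by
    refine exists_eventuallyEq_const_of_forall_separating MeasurableSet fun U hU => ?_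
    have h1 := hg hU
    have hm : MeasurableSet (g ⁻¹' U) := h1.1
    rcases he _ h1.1 h1.2 with h0 | h0
    · right
      exact measure_eq_zero_iff_ae_notMem.1 h0
    · left
      exact (prob_compl_eq_zero_iff hm).2 h0
  exact this

lemma F_line (hF : FPack ℙ T R V F κ) (hTadd : ∀ x y, T (x + y) = T x ∘ T y) {u z : Zd d} (hu : u ∈ Gp R) (hz : z ∈ R) (ω : Ω) (b : ℕ) :
    F (u + b • z) ω ≤ F u ω + ∑ k ∈ Finset.range b, (max (V (T (u + k • z) ω) z) 0) + κ * b := by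
  induction b with
  | zero => simp
  | succ b ih =>
    rw [add_smul, one_smul, ← add_assoc, Finset.sum_range_succ]
    have h1 := hF.sub _ (Gp_add hu (Gp_nsmul (Gp_single hz) b)) _ (Gp_single hz) ω
    have h2 := hF.step z hz (T (u + b • z) ω)
    push_cast
    linarith

lemma flatZ_of (hF : FPack ℙ T R V F κ) (hTadd : ∀ x y, T (x + y) = T x ∘ T y) (hR : R' ⊆ R) {z : Zd d} (hz : z ∈ R') {ω : Ω}
    (hω : (⨅ ε : {e : ℝ // 0 < e},
      Filter.limsup (fun n : ℕ =>
        ⨆ (x : Zd d) (_ : x ∈ Gp R' ∧ n1Z x ≤ n),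
          (n : ℝ≥0∞)⁻¹ *
            ∑ k ∈ Finset.range (⌊(ε : ℝ) * n⌋₊ + 1), ENNReal.ofReal ((fun ω => max (V ω z) 0) (T (x + k • z) ω)))
        Filter.atTop) = 0) : FlatZ R' (fun x => F x ω) z := by
  intro K hK ε hε
  have hκ := hF.step0
  have hε1 : 0 < ε / (4 * K) := by positivity
  have h1 : _ < ENNReal.ofReal (ε / (4 * K)) := lt_of_eq_of_lt hω (ENNReal.ofReal_pos.2 hε1)
  obtain ⟨⟨e, he⟩, h2⟩ := iInf_lt_iff.1 h1
  obtain ⟨n0, hn0⟩ := eventually_atTop.1 (eventually_lt_of_limsup_lt h2)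
  refine ⟨min (e * K) (ε / (2 * (κ + 1))), by positivity, ((n0:ℝ) + 1) / K, fun L hL u hu huK b hb => ?_⟩
  have hL' : (n0:ℝ) + 1 ≤ K * L := by
    have := (div_le_iff₀ hK).1 hL
    linarith
  have hn0p : (0:ℝ) ≤ n0 := Nat.cast_nonneg _
  have hL0 : 0 < L := by
    by_contra hc
    push Not at hc
    nlinarith
  set n := ⌈K * L⌉₊ with hn
  have c1 : K * L ≤ n := Nat.le_ceil _
  have c2 : (n:ℝ) < K * L + 1 := Nat.ceil_lt_add_one (by positivity)
  have hnn : n0 ≤ n := by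
    have : (n0:ℝ) ≤ n := by linarith
    exact_mod_cast this
  have hnp : (0:ℝ) < n := by linarith
  have h3 := hn0 n hnn
  have h4 : (n : ℝ≥0∞)⁻¹ * ∑ k ∈ Finset.range (⌊e * n⌋₊ + 1), ENNReal.ofReal (max (V (T (u + k • z) ω) z) 0)
      ≤ ENNReal.ofReal (ε / (4 * K)) :=
    (le_iSup₂ (f := fun (x : Zd d) (_ : x ∈ Gp R' ∧ n1Z x ≤ n) => (n : ℝ≥0∞)⁻¹ *
      ∑ k ∈ Finset.range (⌊e * n⌋₊ + 1), ENNReal.ofReal (max (V (T (x + k • z) ω) z) 0)) u ⟨hu, huK.trans c1⟩).trans h3.le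
  have hbe : (b:ℝ) ≤ e * n := by
    have a1 := hb.trans (mul_le_mul_of_nonneg_right (min_le_left _ _) hL0.le)
    have a2 := mul_le_mul_of_nonneg_left c1 he.le
    linarith
  have hbf : b ≤ ⌊e * n⌋₊ := Nat.le_floor hbe
  have hsub : Finset.range b ⊆ Finset.range (⌊e * n⌋₊ + 1) := Finset.range_subset_range.2 (by omega)
  have h5 : ENNReal.ofReal (∑ k ∈ Finset.range b, max (V (T (u + k • z) ω) z) 0) ≤ ENNReal.ofReal (n * (ε / (4 * K))) := by
    rw [ENNReal.ofReal_sum_of_nonneg (fun _ _ => le_max_right _ _), ENNReal.ofReal_mul hnp.le, ENNReal.ofReal_natCast]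
    refine (Finset.sum_le_sum_of_subset hsub).trans ?_
    rw [mul_comm (n : ℝ≥0∞)⁻¹, ← div_eq_mul_inv, ENNReal.div_le_iff (by
      have : n ≠ 0 := by rintro hc; rw [hc] at hnp; simp at hnp
      exact_mod_cast this) (ENNReal.natCast_ne_top n)] at h4
    exact h4.trans (mul_comm _ _).le
  have h6 := (ENNReal.ofReal_le_ofReal_iff (by positivity)).1 h5
  have h7 : n * (ε / (4 * K)) ≤ ε / 2 * L := by
    have : (n:ℝ) ≤ 2 * (K * L) := by linarith
    calc n * (ε / (4 * K)) ≤ 2 * (K * L) * (ε / (4 * K)) := mul_le_mul_of_nonneg_right this hε1.le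
      _ = ε / 2 * L := by field_simp; ring
  have h8 : κ * b ≤ ε / 2 * L := by
    have a1 := hb.trans (mul_le_mul_of_nonneg_right (min_le_right _ _) hL0.le)
    have a2 : (κ + 1) * b ≤ (κ + 1) * (ε / (2 * (κ + 1)) * L) := mul_le_mul_of_nonneg_left a1 (by linarith)
    have a3 : (κ + 1) * (ε / (2 * (κ + 1)) * L) = ε / 2 * L := by field_simp
    have : (0:ℝ) ≤ b := Nat.cast_nonneg _
    linarith
  have h9 := F_line hF hTadd (Gp_mono hR hu) (hR hz) ω b
  show F (u + b • z) ω ≤ F u ω + ε * L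
  linarith

lemma flatZ_zero {f : Zd d → ℝ} : FlatZ R' f 0 := by
  intro K hK ε hε
  refine ⟨1, one_pos, 0, fun L hL u hu huK b hb => ?_⟩
  simp only [smul_zero, add_zero]
  have : 0 ≤ ε * L := mul_nonneg hε.le hL
  linarith

lemma v_bd (v : (Fin d → ℝ) →ₗ[ℝ] ℝ) : ∃ K : ℝ, 0 ≤ K ∧ ∀ ξ, |v ξ| ≤ K * n1 ξ := by
  have hc : Continuous v := v.continuous_of_finiteDimensional
  refine ⟨‖(⟨v, hc⟩ : (Fin d → ℝ) →L[ℝ] ℝ)‖, norm_nonneg _, fun ξ => ?_⟩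
  have h1 := (⟨v, hc⟩ : (Fin d → ℝ) →L[ℝ] ℝ).le_opNorm ξ
  exact h1.trans (mul_le_mul_of_nonneg_left (norm_le_n1 ξ) (norm_nonneg _))

lemma alphaW_meas {ϕ : Zd d → Ω → ℝ} (hϕ : ∀ y, Measurable (ϕ y)) (ξ : Fin d → ℝ) :
    Measurable fun ω => alphaW R' (fun y => ϕ y ω) ξ := by
  unfold alphaW
  split_ifs
  · exact measurable_const
  · exact Measurable.liminf fun n => (hϕ _).div_const _

end fin
end RWRP

open RWRP in
/-- shape theorem and properties of the quenched Lyapunov exponent `α`. -/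
theorem statement0
    {d : ℕ} {Ω : Type*} [MeasurableSpace Ω]
    (ℙ : Measure Ω) [IsProbabilityMeasure ℙ]
    (T : Zd d → Ω → Ω) (R : Finset (Zd d)) (V : Ω → Zd d → ℝ) (p : Zd d → ℝ)
    (hset : Setting ℙ T R V p)
    (hV1 : VplusL1 ℙ V R)
    (U₀ : Set (Fin d → ℝ)) (hU₀ : IsZeroFace R U₀)
    (hi : AssumptionI ℙ V R U₀)
    (A : Set (Fin d → ℝ)) (hA : IsFace (Cp R) A) (hAne : A ≠ {0})
    (R' : Finset (Zd d)) (hR' : ∀ z, z ∈ R' ↔ z ∈ R ∧ toR z ∈ A)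
    (hL : ∀ z ∈ R', z ≠ 0 → classL ℙ T (fun ω => max (V ω z) 0) z R')
    (hL0 : ∃ zh ∈ R', zh ≠ 0 ∧ classL ℙ T (fun ω => max (V ω 0) 0) zh R')
    :
    ∃ (α : Ω → (Fin d → ℝ) → ℝ) (C : Ω → ℝ),
      (∀ ξ, Measurable fun ω => α ω ξ) ∧ Measurable C ∧ Integrable C ℙ ∧
      (∀ᵐ ω ∂ℙ,
        0 < C ω ∧
        (∀ ξ ∈ intrinsicInterior ℝ A, |α ω ξ| ≤ C ω * n1 ξ) ∧
        (∀ s : ℝ, 0 ≤ s → ∀ ξ ∈ intrinsicInterior ℝ A, α ω (s • ξ) = s * α ω ξ) ∧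
        (∀ ξ ∈ intrinsicInterior ℝ A, ∀ ζ ∈ intrinsicInterior ℝ A,
          α ω (ξ + ζ) ≤ α ω ξ + α ω ζ) ∧
        (∀ δ > (0:ℝ), ∀ ε > (0:ℝ), ∃ M : ℝ, ∀ x ∈ Gp R, toR x ∈ faceDelta A δ →
          M ≤ n1Z x → |aFun T V p R ω 0 x - α ω (toR x)| ≤ ε * n1Z x)) ∧
      (ErgodicUnder ℙ T {z | z ∈ R ∧ toR z ∈ A} →
        ∃ (α₀ : (Fin d → ℝ) → ℝ) (C₀ : ℝ),
          ∀ᵐ ω ∂ℙ, C ω = C₀ ∧ ∀ ξ ∈ intrinsicInterior ℝ A, α ω ξ = α₀ ξ) := by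
  obtain ⟨zh, hzh, -, -⟩ := hL0
  have hAe : A = Cp R' := face_eq hA hR' ⟨zh, hzh⟩
  have hsub : R' ⊆ R := fun z hz => ((hR' z).1 hz).1
  obtain ⟨v, F, κ, hF, hFa⟩ := exists_F ℙ T R V p hset U₀ hU₀ hi
  have hset' := hset
  obtain ⟨hTm, hT0, hTa, hTmp, -, hVm, hp, hp1⟩ := hset'
  have hE : Env ℙ T R' F :=
    { T0 := hT0
      Tadd := hTa
      Tmp := hTmp
      meas := hF.meas
      nonneg := fun x hx => hF.nonneg x (Gp_mono hsub hx)
      zero := hF.zero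
      sub := fun x hx y hy => hF.sub x (Gp_mono hsub hx) y (Gp_mono hsub hy)
      int := fun z hz => by
        refine ((hV1 z (hsub hz)).add (integrable_const κ)).mono' (hF.meas z).aestronglyMeasurable
          (Eventually.of_forall fun ω => ?_)
        rw [Real.norm_eq_abs, abs_of_nonneg (hF.nonneg z (Gp_single (hsub hz)) ω)]
        exact hF.step z (hsub hz) ω }
  obtain ⟨ϕ, h, hϕm, hhm, hhi, hDet⟩ := phi_package hE
  have hϕm' : ∀ y, Measurable (ϕ y) := fun y => (hϕm y).mono (inv_le T _) le_rfl
  have hhm' : Measurable h := hhm.mono (inv_le T _) le_rfl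
  obtain ⟨Kv, hKv0, hKv⟩ := v_bd v
  obtain ⟨κc, hκc, hcone⟩ := cone_bound R'.card R' rfl
  have hFlat : ∀ᵐ ω ∂ℙ, ∀ z ∈ R', FlatZ R' (fun x => F x ω) z := by
    rw [Finset.eventually_all]
    intro z hz
    by_cases hz0 : z = 0
    · subst hz0
      exact Eventually.of_forall fun ω => flatZ_zero
    · exact (hL z hz hz0).mono fun ω hω => flatZ_of hF hTa hsub hz hω
  refine ⟨fun ω ξ => alphaW R' (fun y => ϕ y ω) ξ - v ξ, fun ω => (R'.card * κc) * h ω + (Kv + 1), ?_, ?_, ?_, ?_, ?_⟩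
  · exact fun ξ => (alphaW_meas hϕm' ξ).sub_const _
  · exact (hhm'.const_mul _).add_const _
  · exact (hhi.const_mul _).add (integrable_const _)
  · filter_upwards [hFlat, hDet, hFa] with ω hfl D hfa
    have hcard : (0:ℝ) ≤ R'.card := Nat.cast_nonneg _
    have hch : 0 ≤ (R'.card * κc) * h ω := mul_nonneg (mul_nonneg hcard hκc.le) D.h0
    have hrel : ∀ ξ ∈ intrinsicInterior ℝ A, Pos R' ξ := fun ξ hξ => relint_pos hAe hξ
    refine ⟨by linarith, fun ξ hξ => ?_, fun s hs ξ hξ => ?_, fun ξ hξ ζ hζ => ?_, fun δ hδ ε hε => ?_⟩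
    · have h1 := D.alpha_nonneg (hrel ξ hξ)
      obtain ⟨b, hb, hξb, hbk⟩ := hcone ξ (hAe ▸ intrinsicInterior_subset hξ)
      have h2 := D.alpha_bd (hrel ξ hξ) hb hξb
      have h3 : ∑ z ∈ R', b z ≤ R'.card * (κc * n1 ξ) := by
        have := Finset.sum_le_card_nsmul R' b _ hbk
        rwa [nsmul_eq_mul] at this
      have h4 := mul_le_mul_of_nonneg_left h3 D.h0
      have h5 := abs_le.1 (hKv ξ)
      have h6 := n1_nonneg ξ
      have h7 := mul_nonneg hch h6
      rw [abs_le]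
      constructor <;> linarith [h5.1, h5.2]
    · rw [D.alpha_smul (hrel ξ hξ) hs, map_smul, smul_eq_mul]; ring
    · have := D.alpha_add (hrel ξ hξ) (hrel ζ hζ)
      rw [map_add]; linarith
    · obtain ⟨M, hM⟩ := D.shape (flat_all hfl R' subset_rfl) hAe hδ hε
      refine ⟨M, fun x hx hxA hxM => ?_⟩
      obtain ⟨hxS, h1⟩ := hM x (face_Gp hA hR' hx hxA.1) hxA hxM
      rw [D.alpha_lat hxS hxA.2.1]
      have h2 := hfa x
      have e : aFun T V p R ω 0 x - (ϕ x ω - v (toR x)) = F x ω - ϕ x ω := by rw [h2]; ring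
      rw [e]; exact h1
  · intro herg
    have hS : {z | z ∈ R ∧ toR z ∈ A} = (R' : Set (Zd d)) := by
      ext z; simp [hR' z]
    rw [hS] at herg
    choose ϕ₀ hϕ₀ using fun y => erg_const herg (hϕm y)
    obtain ⟨h₀, hh₀⟩ := erg_const herg hhm
    refine ⟨fun ξ => alphaW R' ϕ₀ ξ - v ξ, (R'.card * κc) * h₀ + (Kv + 1), ?_⟩
    filter_upwards [hh₀, ae_all_iff.2 hϕ₀] with ω h1 h2
    refine ⟨by rw [h1], fun ξ _ => ?_⟩
    have : (fun y => ϕ y ω) = ϕ₀ := funext h2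
    rw [this]
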